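/- Suppose the Jacobi parameters (a_n), (b_n) are N-periodically modulated, that for every i ∈ {0, 1, …, N−1} the real sequences (a_{kN+i−1}/a_{kN+i} : k ≥ 1), (b_{kN+i}/a_{kN+i} : k ≥ 1) and (1/a_{kN+i} : k ≥ 1) belong to 𝒟_1, and that ∑_{n=0}^∞ 1/a_n = ∞. Assume |tr 𝔛_0(0)| < 2 and set τ = |tr 𝔛_0′(0)| / (N √(−discr 𝔛_0(0))). Let μ be the unique probability measure on ℝ with ∫ p_n p_m dμ = δ_{nm} for all n, m, and set ρ_n = ∑_{j=0}^n α_j/a_j. Then μ is absolutely continuous with a density w that is continuous and strictly positive on ℝ, and lim_{n→∞} (1/ρ_n) · ∑_{j=0}^n p_j(x + u/ρ_n) · p_j(x + v/ρ_n) = (τ/(π w(x))) · sin((u − v)τ) / ((u − v)τ), locally uniformly with respect to x, u, v ∈ ℝ (for u = v the last factor is interpreted as 1). -/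

import Mathlib

open Filter Topology MeasureTheory Real

noncomputable section

abbrev Mat2 := Matrix (Fin 2) (Fin 2) ℝ

/-- The transfer matrix `𝔅_j(x)` built from (N-periodic) sequences `(α_n)`, `(β_n)`. -/
def frakB (α β : ℤ → ℝ) (j : ℤ) (x : ℝ) : Mat2 :=
  !![0, 1; -(α (j - 1)) / α j, (x - β j) / α j]

/-- Product in decreasing index order with integer starting point. -/
def prodDZ (C : ℤ → Mat2) (n0 : ℤ) : ℕ → Mat2
  | 0 => 1
  | (len + 1) => C (n0 + len) * prodDZ C n0 len

/-- `𝔛_0(x) = 𝔅_{N−1}(x) ⋯ 𝔅_0(x)`. -/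
def frakX0 (α β : ℤ → ℝ) (N : ℕ) (x : ℝ) : Mat2 :=
  prodDZ (fun j => frakB α β j x) 0 N

/-- Discriminant of a `2×2` matrix. -/
def discr (M : Mat2) : ℝ := (Matrix.trace M) ^ 2 - 4 * M.det

/-- The constant `τ = |tr 𝔛_0′(0)| / (N √(−discr 𝔛_0(0)))`; `τ/π` is the density at `0` of
the equilibrium measure of `{x : |tr 𝔛_0(x)| ≤ 2}`. -/
def tauC (α β : ℤ → ℝ) (N : ℕ) : ℝ :=
  |deriv (fun y => Matrix.trace (frakX0 α β N y)) 0| /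
    (N * Real.sqrt (-discr (frakX0 α β N 0)))

/-- The orthonormal polynomials `p_n` associated to `(a_n)`, `(b_n)`. -/
def opoly (a b : ℕ → ℝ) : ℕ → ℝ → ℝ
  | 0 => fun _ => 1
  | 1 => fun x => (x - b 0) / a 0
  | (n + 2) => fun x =>
      ((x - b (n + 1)) * opoly a b (n + 1) x - a n * opoly a b n x) / a (n + 1)

/-- Membership of a real sequence in the Stolz class `𝒟_1`. -/
def memD1 (f : ℕ → ℝ) : Prop :=
  (∃ C, ∀ n, |f n| ≤ C) ∧ Summable fun n : ℕ => |f (n + 1) - f n|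

/-- `ρ_n = ∑_{j=0}^n α_j/a_j`. -/
def rho (a : ℕ → ℝ) (α : ℤ → ℝ) (n : ℕ) : ℝ :=
  ∑ j ∈ Finset.range (n + 1), α (j : ℤ) / a j


/-- Controlled families: uniform limit, bounded variation, first-order expansion. -/
def Tame {E : Type*} [NormedField E] [NormedAlgebra ℝ E] (e : ℕ → ℝ) (g : ℕ → ℝ → E)
    (G0 G1 : E) : Prop :=
  ∀ R : ℝ, ∃ ε δ : ℕ → ℝ, Summable ε ∧ Tendsto δ atTop (𝓝 0) ∧
    ∀ᶠ k in atTop, ∀ x, |x| ≤ R →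
      ‖g k x - G0‖ ≤ δ k ∧ ‖g (k + 1) x - g k x‖ ≤ ε k ∧
      ∀ y, |y| ≤ R → ‖g k x - g k y - ((x - y) * e k) • G1‖ ≤ δ k * (|x - y| * e k)

section
variable {E : Type*} [NormedField E] [NormedAlgebra ℝ E] {e : ℕ → ℝ} {g h : ℕ → ℝ → E}
  {G0 G1 H0 H1 : E}

lemma Tame.const (he : ∀ k, 0 ≤ e k) (c : E) : Tame e (fun _ _ => c) c 0 := by
  intro R
  refine ⟨fun _ => 0, fun _ => 0, summable_zero, tendsto_const_nhds, Eventually.of_forall ?_⟩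
  intro k x _
  simp

lemma Tame.congr_val (hg : Tame e g G0 G1) {G0' G1' : E} (h0 : G0 = G0') (h1 : G1 = G1') :
    Tame e g G0' G1' := by subst h0; subst h1; exact hg

lemma Tame.congr_fun {g' : ℕ → ℝ → E} (hg : Tame e g G0 G1)
    (h : ∀ᶠ k in atTop, ∀ x, g k x = g' k x) : Tame e g' G0 G1 := by
  intro R
  obtain ⟨ε, δ, hε, hδ, H⟩ := hg R
  refine ⟨ε, δ, hε, hδ, ?_⟩
  filter_upwards [H, h, (tendsto_add_atTop_nat 1).eventually h] with k hk h1 h2 x hx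
  simp only [← h1, ← h2]
  exact hk x hx

lemma Tame.add (he : ∀ k, 0 ≤ e k) (hg : Tame e g G0 G1) (hh : Tame e h H0 H1) :
    Tame e (fun k x => g k x + h k x) (G0 + H0) (G1 + H1) := by
  intro R
  obtain ⟨ε, δ, hε, hδ, H⟩ := hg R
  obtain ⟨ε', δ', hε', hδ', H'⟩ := hh R
  refine ⟨fun k => ε k + ε' k, fun k => δ k + δ' k, hε.add hε', by simpa using hδ.add hδ', ?_⟩
  filter_upwards [H, H'] with k h1 h2 x hx
  obtain ⟨a1, a2, a3⟩ := h1 x hx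
  obtain ⟨b1, b2, b3⟩ := h2 x hx
  refine ⟨?_, ?_, ?_⟩
  · rw [show g k x + h k x - (G0 + H0) = (g k x - G0) + (h k x - H0) by ring]
    exact (norm_add_le _ _).trans (add_le_add a1 b1)
  · rw [show g (k+1) x + h (k+1) x - (g k x + h k x)
      = (g (k+1) x - g k x) + (h (k+1) x - h k x) by ring]
    exact (norm_add_le _ _).trans (add_le_add a2 b2)
  · intro y hy
    rw [show g k x + h k x - (g k y + h k y) - ((x - y) * e k) • (G1 + H1)
      = (g k x - g k y - ((x - y) * e k) • G1) + (h k x - h k y - ((x - y) * e k) • H1) by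
        rw [smul_add]; ring]
    refine (norm_add_le _ _).trans ((add_le_add (a3 y hy) (b3 y hy)).trans (le_of_eq ?_))
    ring

lemma Tame.bdd (hg : Tame e g G0 G1) (R : ℝ) :
    ∀ᶠ k in atTop, ∀ x, |x| ≤ R → ‖g k x‖ ≤ ‖G0‖ + 1 := by
  obtain ⟨ε, δ, hε, hδ, H⟩ := hg R
  filter_upwards [H, hδ.eventually (gt_mem_nhds one_pos)] with k h1 h2 x hx
  have := (h1 x hx).1
  calc ‖g k x‖ = ‖G0 + (g k x - G0)‖ := by congr 1; ring
    _ ≤ ‖G0‖ + ‖g k x - G0‖ := norm_add_le _ _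
    _ ≤ _ := by linarith

lemma Tame.mul (he : ∀ k, 0 ≤ e k) (hg : Tame e g G0 G1) (hh : Tame e h H0 H1) :
    Tame e (fun k x => g k x * h k x) (G0 * H0) (G0 * H1 + G1 * H0) := by
  intro R
  have bg := hg.bdd R
  have bh := hh.bdd R
  have bh' := (tendsto_add_atTop_nat 1).eventually bh
  obtain ⟨ε, δ, hε, hδ, H⟩ := hg R
  obtain ⟨ε', δ', hε', hδ', H'⟩ := hh R
  refine ⟨fun k => ε k * (‖H0‖ + 1) + (‖G0‖ + 1) * ε' k,
    fun k => δ k * (‖H0‖ + 1 + ‖H1‖) + δ' k * (‖G0‖ + 1 + ‖G1‖),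
    (hε.mul_right _).add (hε'.mul_left _), by
      simpa using (hδ.mul_const _).add (hδ'.mul_const _), ?_⟩
  filter_upwards [H, H', bg, bh, bh'] with k h1 h2 bg bh bh' x hx
  obtain ⟨a1, a2, a3⟩ := h1 x hx
  obtain ⟨b1, b2, b3⟩ := h2 x hx
  have hd : 0 ≤ δ k := (norm_nonneg _).trans a1
  have hd' : 0 ≤ δ' k := (norm_nonneg _).trans b1
  refine ⟨?_, ?_, ?_⟩
  · calc ‖g k x * h k x - G0 * H0‖ = ‖(g k x - G0) * h k x + G0 * (h k x - H0)‖ := by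
          congr 1; ring
      _ ≤ ‖(g k x - G0) * h k x‖ + ‖G0 * (h k x - H0)‖ := norm_add_le _ _
      _ = ‖g k x - G0‖ * ‖h k x‖ + ‖G0‖ * ‖h k x - H0‖ := by rw [norm_mul, norm_mul]
      _ ≤ δ k * (‖H0‖ + 1) + ‖G0‖ * δ' k := by
          gcongr
          exact bh x hx
      _ ≤ _ := by nlinarith [norm_nonneg H1, norm_nonneg G1, mul_nonneg hd (norm_nonneg H1),
                    mul_nonneg hd' (norm_nonneg G1)]
  · calc ‖g (k+1) x * h (k+1) x - g k x * h k x‖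
        = ‖(g (k+1) x - g k x) * h (k+1) x + g k x * (h (k+1) x - h k x)‖ := by
          congr 1; ring
      _ ≤ ‖(g (k+1) x - g k x) * h (k+1) x‖ + ‖g k x * (h (k+1) x - h k x)‖ := norm_add_le _ _
      _ = ‖g (k+1) x - g k x‖ * ‖h (k+1) x‖ + ‖g k x‖ * ‖h (k+1) x - h k x‖ := by
          rw [norm_mul, norm_mul]
      _ ≤ _ := by
          gcongr
          · exact (norm_nonneg _).trans a2
          · exact bh' x hx
          · exact bg x hx
  · intro y hy
    have a1' := (h1 y hy).1
    have hD : ‖((x - y) * e k : ℝ)‖ = |x - y| * e k := by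
      rw [norm_mul, Real.norm_eq_abs, Real.norm_eq_abs, abs_of_nonneg (he k)]
    have hD0 : 0 ≤ |x - y| * e k := mul_nonneg (abs_nonneg _) (he k)
    set D := (x - y) * e k with hDdef
    set D' := |x - y| * e k with hDdef'
    calc ‖g k x * h k x - g k y * h k y - D • (G0 * H1 + G1 * H0)‖
        = ‖(g k x - g k y - D • G1) * h k x + D • G1 * (h k x - H0)
            + g k y * (h k x - h k y - D • H1) + (g k y - G0) * D • H1‖ := by
          congr 1
          simp only [Algebra.smul_def]; ring
      _ ≤ ‖(g k x - g k y - D • G1) * h k x‖ + ‖D • G1 * (h k x - H0)‖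
            + ‖g k y * (h k x - h k y - D • H1)‖ + ‖(g k y - G0) * D • H1‖ := by
          refine (norm_add_le _ _).trans ?_
          gcongr
          refine (norm_add_le _ _).trans ?_
          gcongr
          exact norm_add_le _ _
      _ = ‖g k x - g k y - D • G1‖ * ‖h k x‖ + D' * ‖G1‖ * ‖h k x - H0‖
            + ‖g k y‖ * ‖h k x - h k y - D • H1‖ + ‖g k y - G0‖ * (D' * ‖H1‖) := by
          simp only [norm_mul, norm_smul, hD]
      _ ≤ (δ k * D') * (‖H0‖ + 1) + D' * ‖G1‖ * δ' k + (‖G0‖ + 1) * (δ' k * D')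
            + δ k * (D' * ‖H1‖) := by
          gcongr
          · exact a3 y hy
          · exact bh x hx
          · exact bg y hy
          · exact b3 y hy
      _ = _ := by ring

lemma Tame.neg (he : ∀ k, 0 ≤ e k) (hg : Tame e g G0 G1) :
    Tame e (fun k x => - g k x) (- G0) (- G1) := by
  refine ((Tame.const he (-1 : E)).mul he hg).congr_val (by ring) (by ring) |>.congr_fun ?_
  exact Eventually.of_forall fun k x => by ring

lemma Tame.sub (he : ∀ k, 0 ≤ e k) (hg : Tame e g G0 G1) (hh : Tame e h H0 H1) :
    Tame e (fun k x => g k x - h k x) (G0 - H0) (G1 - H1) := by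
  refine (hg.add he (hh.neg he)).congr_val (by ring) (by ring) |>.congr_fun ?_
  exact Eventually.of_forall fun k x => by ring

lemma Tame.lip (he : ∀ k, 0 ≤ e k) (hg : Tame e g G0 G1) (R : ℝ) :
    ∀ᶠ k in atTop, ∀ x, |x| ≤ R → ∀ y, |y| ≤ R →
      ‖g k x - g k y‖ ≤ (‖G1‖ + 1) * (|x - y| * e k) := by
  obtain ⟨ε, δ, hε, hδ, H⟩ := hg R
  filter_upwards [H, hδ.eventually (gt_mem_nhds one_pos)] with k h1 h2 x hx y hy
  have := (h1 x hx).2.2 y hy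
  have hD : ‖((x - y) * e k : ℝ)‖ = |x - y| * e k := by
      rw [norm_mul, Real.norm_eq_abs, Real.norm_eq_abs, abs_of_nonneg (he k)]
  have hD0 : 0 ≤ |x - y| * e k := mul_nonneg (abs_nonneg _) (he k)
  calc ‖g k x - g k y‖ = ‖(g k x - g k y - ((x - y) * e k) • G1) + ((x - y) * e k) • G1‖ := by
        congr 1; ring
    _ ≤ δ k * (|x - y| * e k) + |x - y| * e k * ‖G1‖ := by
        refine (norm_add_le _ _).trans (add_le_add this ?_)
        rw [norm_smul, hD]
    _ ≤ _ := by nlinarith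
end

lemma Tame.ofReal {e : ℕ → ℝ} {g : ℕ → ℝ → ℝ} {G0 G1 : ℝ} (hg : Tame e g G0 G1) :
    Tame e (fun k x => (g k x : ℂ)) (G0 : ℂ) (G1 : ℂ) := by
  intro R
  obtain ⟨ε, δ, hε, hδ, H⟩ := hg R
  refine ⟨ε, δ, hε, hδ, ?_⟩
  filter_upwards [H] with k hk x hx
  obtain ⟨a1, a2, a3⟩ := hk x hx
  refine ⟨?_, ?_, ?_⟩
  · rw [← Complex.ofReal_sub, Complex.norm_real]; exact a1
  · rw [← Complex.ofReal_sub, Complex.norm_real]; exact a2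
  · intro y hy
    have := a3 y hy
    have h2 : (g k x : ℂ) - (g k y : ℂ) - ((x - y) * e k) • (G1 : ℂ)
        = ((g k x - g k y - ((x - y) * e k) • G1 : ℝ) : ℂ) := by
      rw [Complex.real_smul, smul_eq_mul]; push_cast; ring
    rw [h2, Complex.norm_real]
    exact this

lemma Tame.sqrt {e : ℕ → ℝ} (he : ∀ k, 0 ≤ e k) {g : ℕ → ℝ → ℝ} {G0 G1 : ℝ}
    (hg : Tame e g G0 G1) (h0 : 0 < G0) :
    Tame e (fun k x => √(g k x)) (√G0) (G1 / (2 * √G0)) := by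
  intro R
  obtain ⟨ε, δ, hε, hδ, H⟩ := hg R
  set s := √G0 with hs
  have hs0 : 0 < s := Real.sqrt_pos.2 h0
  have hss : s * s = G0 := Real.mul_self_sqrt h0.le
  refine ⟨fun k => ε k / s, fun k => δ k / s + |G1| * δ k / (s * s * s), hε.div_const s, by
    simpa using (hδ.div_const s).add ((hδ.const_mul |G1|).div_const _), ?_⟩
  have hsm := hδ.eventually (gt_mem_nhds (show (0:ℝ) < 3 / 4 * G0 by positivity))
  filter_upwards [H, (tendsto_add_atTop_nat 1).eventually H, hsm,
    (tendsto_add_atTop_nat 1).eventually hsm] with k hk hk1 hd hd1 x hx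
  obtain ⟨a1, a2, a3⟩ := hk x hx
  have hd0 : 0 ≤ δ k := (norm_nonneg _).trans a1
  have lo : ∀ A : ℝ, G0 / 4 ≤ A → s / 2 ≤ √A := by
    intro A hA
    apply Real.le_sqrt_of_sq_le
    nlinarith
  have pos : ∀ x, |x| ≤ R → G0 / 4 ≤ g k x := by
    intro x hx
    have := (hk x hx).1
    rw [Real.norm_eq_abs, abs_le] at this
    linarith [this.1]
  have pos1 : ∀ x, |x| ≤ R → G0 / 4 ≤ g (k+1) x := by
    intro x hx
    have := (hk1 x hx).1
    rw [Real.norm_eq_abs, abs_le] at this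
    linarith [this.1]
  have sub_eq : ∀ A B : ℝ, G0 / 4 ≤ A → G0 / 4 ≤ B → √A - √B = (A - B) / (√A + √B) := by
    intro A B hA hB
    have := lo A hA
    have := lo B hB
    rw [eq_div_iff (by linarith)]
    nlinarith [Real.mul_self_sqrt (show 0 ≤ A by linarith),
      Real.mul_self_sqrt (show 0 ≤ B by linarith)]
  have sub_le : ∀ A B : ℝ, G0 / 4 ≤ A → G0 / 4 ≤ B → |√A - √B| ≤ |A - B| / s := by
    intro A B hA hB
    have := lo A hA
    have := lo B hB
    rw [sub_eq A B hA hB, abs_div, abs_of_pos (show 0 < √A + √B by linarith)]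
    gcongr
    linarith
  refine ⟨?_, ?_, ?_⟩
  · exact (sub_le _ _ (pos x hx) (by linarith)).trans (by
      have : 0 ≤ |G1| * δ k / (s * s * s) := by positivity
      have h2 : |g k x - G0| / s ≤ δ k / s := by gcongr; exact a1
      linarith)
  · exact (sub_le _ _ (pos1 x hx) (pos x hx)).trans (by gcongr; exact a2)
  · intro y hy
    have hA := pos x hx
    have hB := pos y hy
    have e1 := a3 y hy
    have f1 : |√(g k x) - s| ≤ δ k / s :=
      (sub_le _ _ hA (by linarith)).trans (by gcongr; exact a1)
    have f2 : |√(g k y) - s| ≤ δ k / s :=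
      (sub_le _ _ hB (by linarith)).trans (by gcongr; exact (hk y hy).1)
    have l1 := lo _ hA
    have l2 := lo _ hB
    have hD0 : 0 ≤ |x - y| * e k := mul_nonneg (abs_nonneg _) (he k)
    have hD : |(x - y) * e k| = |x - y| * e k := by
      rw [abs_mul, abs_of_nonneg (he k)]
    rw [Real.norm_eq_abs, sub_eq _ _ hA hB]
    rw [Real.norm_eq_abs] at e1
    simp only [smul_eq_mul] at e1 ⊢
    set q := √(g k x) + √(g k y) with hq
    have hqs : s ≤ q := by linarith
    have hq0 : 0 < q := by linarith
    set D := (x - y) * e k with hDdef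
    set D' := |x - y| * e k with hDdef'
    have f3 : |2 * s - q| ≤ 2 * (δ k / s) := by
      rw [show 2 * s - q = -((√(g k x) - s) + (√(g k y) - s)) by rw [hq]; ring, abs_neg]
      exact (abs_add_le _ _).trans (by linarith)
    calc |(g k x - g k y) / q - D * (G1 / (2 * s))|
        = |(g k x - g k y - D * G1) / q + D * G1 * ((2 * s - q) / (2 * s * q))| := by
          congr 1; field_simp; ring
      _ ≤ |(g k x - g k y - D * G1) / q| + |D * G1 * ((2 * s - q) / (2 * s * q))| :=
          abs_add_le _ _
      _ = |g k x - g k y - D * G1| / q + D' * |G1| * (|2 * s - q| / (2 * s * q)) := by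
          rw [abs_div, abs_mul, abs_mul, abs_div, abs_of_pos hq0, hD,
            abs_of_pos (show 0 < 2 * s * q by positivity)]
      _ ≤ (δ k * D') / s + D' * |G1| * ((2 * (δ k / s)) / (2 * s * s)) := by
          gcongr
      _ = _ := by field_simp


/-- Abstract two-dimensional dynamics with asymptotically elliptic transfer matrices. -/
structure Dyn where
  e : ℕ → ℝ
  A : ℕ → ℝ
  P : ℕ → ℝ → ℝ
  Q : ℕ → ℝ → ℝ
  R : ℕ → ℝ → ℝ
  S : ℕ → ℝ → ℝ
  v1 : ℕ → ℝ → ℝ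
  v2 : ℕ → ℝ → ℝ
  P0 : ℝ
  Q0 : ℝ
  R0 : ℝ
  S0 : ℝ
  P1 : ℝ
  Q1 : ℝ
  R1 : ℝ
  S1 : ℝ
  he : ∀ k, 0 < e k
  he0 : Tendsto e atTop (𝓝 0)
  hA : ∀ k, 0 < A k
  tP : Tame e P P0 P1
  tQ : Tame e Q Q0 Q1
  tR : Tame e R R0 R1
  tS : Tame e S S0 S1
  cP : ∀ k, Continuous (P k)
  cQ : ∀ k, Continuous (Q k)
  cR : ∀ k, Continuous (R k)
  cS : ∀ k, Continuous (S k)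
  cv1 : ∀ k, Continuous (v1 k)
  cv2 : ∀ k, Continuous (v2 k)
  rec1 : ∀ᶠ k in atTop, ∀ x, v1 (k + 1) x = P k x * v1 k x + Q k x * v2 k x
  rec2 : ∀ᶠ k in atTop, ∀ x, v2 (k + 1) x = R k x * v1 k x + S k x * v2 k x
  det : ∀ᶠ k in atTop, ∀ x, P k x * S k x - Q k x * R k x = A k / A (k + 1)
  det0 : P0 * S0 - Q0 * R0 = 1
  dis : (P0 + S0) ^ 2 < 4
  lip : ∀ k, ∀ Rd : ℝ, ∃ L : ℝ, ∀ x, |x| ≤ Rd → ∀ y, |y| ≤ Rd →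
    |v1 k x - v1 k y| + |v2 k x - v2 k y| ≤ L * |x - y|
  nz : ∀ᶠ k in atTop, ∀ x, v1 k x ≠ 0 ∨ v2 k x ≠ 0

namespace Dyn
variable (D : Dyn)

lemma he' (k : ℕ) : 0 ≤ D.e k := (D.he k).le

/-- determinant -/
def dt (k : ℕ) (x : ℝ) : ℝ := D.P k x * D.S k x - D.Q k x * D.R k x
/-- trace -/
def tr (k : ℕ) (x : ℝ) : ℝ := D.P k x + D.S k x
def t0 : ℝ := D.P0 + D.S0
def t1 : ℝ := D.P1 + D.S1
/-- imaginary part of the eigenvalue -/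
def om (k : ℕ) (x : ℝ) : ℝ := √(D.dt k x - (D.tr k x * D.tr k x) * (1 / 4))
def om0 : ℝ := √(1 - (D.t0 * D.t0) * (1 / 4))
def om1 : ℝ := (0 - (D.t0 * D.t1 + D.t1 * D.t0) * (1 / 4)) / (2 * D.om0)
def lam (k : ℕ) (x : ℝ) : ℂ := ((D.tr k x * (1 / 2) : ℝ) : ℂ) + (D.om k x : ℂ) * Complex.I
def lam0 : ℂ := ((D.t0 * (1 / 2) : ℝ) : ℂ) + (D.om0 : ℂ) * Complex.I
def lam1 : ℂ := ((D.t1 * (1 / 2) : ℝ) : ℂ) + (D.om1 : ℂ) * Complex.I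
def th : ℝ := - D.t1 / (2 * D.om0)

lemma om0_arg : 0 < 1 - (D.t0 * D.t0) * (1 / 4) := by
  have := D.dis
  unfold t0; nlinarith

lemma om0_pos : 0 < D.om0 := Real.sqrt_pos.2 D.om0_arg

lemma om0_sq : D.om0 * D.om0 = 1 - (D.t0 * D.t0) * (1 / 4) := Real.mul_self_sqrt D.om0_arg.le

lemma R0_ne : D.R0 ≠ 0 := by
  intro h
  have h1 := D.det0
  have h2 := D.dis
  rw [h] at h1
  nlinarith [sq_nonneg (D.P0 - D.S0)]

lemma tame_tr : Tame D.e D.tr D.t0 D.t1 := D.tP.add D.he' D.tS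

lemma tame_dt : Tame D.e D.dt 1 0 := by
  have h := ((D.tP.mul D.he' D.tS).sub D.he' (D.tQ.mul D.he' D.tR)).congr_val D.det0 rfl
  set G := (D.P0 * D.S1 + D.P1 * D.S0 - (D.Q0 * D.R1 + D.Q1 * D.R0)) with hG
  have hG0 : G = 0 := by
    obtain ⟨ε, δ, hε, hδ, H⟩ := h 1
    have : ∀ᶠ k in atTop, |G| ≤ δ k := by
      filter_upwards [H, D.det] with k hk hd
      have := (hk 1 (by simp)).2.2 0 (by simp)
      rw [hd, hd, sub_self, zero_sub, norm_neg, norm_smul] at this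
      simp only [sub_zero, one_mul, Real.norm_eq_abs, abs_one] at this
      rw [abs_of_pos (D.he k)] at this
      have hek := D.he k
      nlinarith
    have h2 : |G| ≤ 0 := ge_of_tendsto hδ this
    exact abs_nonpos_iff.1 h2
  exact h.congr_val rfl hG0

lemma tame_om : Tame D.e D.om D.om0 D.om1 := by
  have h := (D.tame_dt.sub D.he' ((D.tame_tr.mul D.he' D.tame_tr).mul D.he'
    (Tame.const D.he' (1/4 : ℝ)))).sqrt D.he' D.om0_arg
  refine h.congr_val rfl ?_
  unfold om1 om0
  ring

lemma tame_lam : Tame D.e D.lam D.lam0 D.lam1 := by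
  have h := ((D.tame_tr.mul D.he' (Tame.const D.he' (1/2 : ℝ))).ofReal).add D.he'
    (D.tame_om.ofReal.mul D.he' (Tame.const D.he' Complex.I))
  refine h.congr_val rfl ?_
  unfold lam1; push_cast; ring

lemma c_tr (k : ℕ) : Continuous (D.tr k) := (D.cP k).add (D.cS k)
lemma c_dt (k : ℕ) : Continuous (D.dt k) :=
  ((D.cP k).mul (D.cS k)).sub ((D.cQ k).mul (D.cR k))
lemma c_om (k : ℕ) : Continuous (D.om k) :=
  ((D.c_dt k).sub (((D.c_tr k).mul (D.c_tr k)).mul continuous_const)).sqrt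
lemma c_lam (k : ℕ) : Continuous (D.lam k) :=
  (Complex.continuous_ofReal.comp ((D.c_tr k).mul continuous_const)).add
    ((Complex.continuous_ofReal.comp (D.c_om k)).mul continuous_const)

/-- eventual uniform closeness -/
lemma _root_.Tame.close {E : Type*} [NormedField E] [NormedAlgebra ℝ E] {e : ℕ → ℝ}
    {g : ℕ → ℝ → E} {G0 G1 : E} (h : Tame e g G0 G1) (R : ℝ) {η : ℝ} (hη : 0 < η) :
    ∀ᶠ k in atTop, ∀ x, |x| ≤ R → ‖g k x - G0‖ < η := by
  obtain ⟨ε, δ, hε, hδ, H⟩ := h R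
  filter_upwards [H, hδ.eventually (gt_mem_nhds hη)] with k hk h2 x hx
  exact (hk x hx).1.trans_lt h2

lemma om_lower (Rd : ℝ) : ∀ᶠ k in atTop, ∀ x, |x| ≤ Rd → D.om0 / 2 ≤ D.om k x := by
  filter_upwards [D.tame_om.close Rd (half_pos D.om0_pos)] with k hk x hx
  have := hk x hx
  rw [Real.norm_eq_abs, abs_lt] at this
  linarith [this.1]

lemma dt_lower (Rd : ℝ) : ∀ᶠ k in atTop, ∀ x, |x| ≤ Rd → 1 / 2 ≤ D.dt k x ∧ D.dt k x ≤ 2 := by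
  filter_upwards [D.tame_dt.close Rd (show (0:ℝ) < 1/2 by norm_num)] with k hk x hx
  have := hk x hx
  rw [Real.norm_eq_abs, abs_lt] at this
  constructor <;> linarith [this.1, this.2]

lemma om_sq (Rd : ℝ) : ∀ᶠ k in atTop, ∀ x, |x| ≤ Rd →
    D.om k x * D.om k x = D.dt k x - (D.tr k x * D.tr k x) * (1 / 4) := by
  filter_upwards [D.om_lower Rd] with k hk x hx
  have h := hk x hx
  have h0 := D.om0_pos
  apply Real.mul_self_sqrt
  by_contra hc
  have : D.om k x = 0 := Real.sqrt_eq_zero_of_nonpos (le_of_not_ge hc)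
  linarith

lemma lam_conj (Rd : ℝ) : ∀ᶠ k in atTop, ∀ x, |x| ≤ Rd →
    D.lam k x * (starRingEnd ℂ) (D.lam k x) = (D.dt k x : ℂ) := by
  filter_upwards [D.om_sq Rd] with k hk x hx
  rw [Complex.mul_conj]
  congr 1
  have := hk x hx
  simp [lam, Complex.normSq_apply]
  linarith

lemma lam0_conj : D.lam1 * (starRingEnd ℂ) D.lam0 = Complex.I * (D.th : ℂ) := by
  have h0 := D.om0_pos
  have h1 := D.om0_sq
  have e1 : D.om1 = - (D.t0 * D.t1) / (4 * D.om0) := by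
    unfold om1; field_simp; ring
  apply Complex.ext
  · simp [lam1, lam0, -Complex.ofReal_div, -Complex.ofReal_mul, -Complex.ofReal_neg]
    rw [e1]
    field_simp; ring
  · have hth : (Complex.I * (D.th : ℂ)).im = D.th := by simp
    rw [hth]
    simp [lam1, lam0]
    rw [e1, th]
    field_simp
    linear_combination (4 * D.t1) * (-1) * h1

/-- unimodular eigenvalue -/
def u (k : ℕ) (x : ℝ) : ℂ := D.lam k x * ((√(D.dt k x))⁻¹ : ℝ)

lemma c_u_on (Rd : ℝ) : ∀ᶠ k in atTop, ContinuousOn (D.u k) {x | |x| ≤ Rd} := by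
  filter_upwards [D.dt_lower Rd] with k hk
  refine (D.c_lam k).continuousOn.mul ?_
  refine Complex.continuous_ofReal.comp_continuousOn ?_
  refine ContinuousOn.inv₀ (D.c_dt k).sqrt.continuousOn ?_
  intro x hx
  have := (hk x hx).1
  exact (Real.sqrt_pos.2 (by linarith)).ne'

lemma u_conj (Rd : ℝ) : ∀ᶠ k in atTop, ∀ x, |x| ≤ Rd → ‖D.u k x‖ = 1 := by
  filter_upwards [D.lam_conj Rd, D.dt_lower Rd] with k hk hd x hx
  have h1 := hk x hx
  have h2 : 0 < D.dt k x := by linarith [(hd x hx).1]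
  rw [Complex.mul_conj] at h1
  have h3 : Complex.normSq (D.lam k x) = D.dt k x := by exact_mod_cast h1
  have h4 : ‖D.lam k x‖ = √(D.dt k x) := by
    rw [← h3]; rfl
  rw [u, norm_mul, h4, Complex.norm_real, norm_inv, Real.norm_of_nonneg (Real.sqrt_nonneg _)]
  exact mul_inv_cancel₀ (Real.sqrt_pos.2 h2).ne'

lemma phase (Rd : ℝ) : ∃ δ : ℕ → ℝ, Tendsto δ atTop (𝓝 0) ∧ ∀ᶠ k in atTop,
    ∀ x, |x| ≤ Rd → ∀ y, |y| ≤ Rd →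
    ‖D.u k x * (starRingEnd ℂ) (D.u k y) -
      Complex.exp (Complex.I * ((D.th * ((x - y) * D.e k) : ℝ) : ℂ))‖
      ≤ δ k * (|x - y| * D.e k) := by
  obtain ⟨ε, δ, hε, hδ, H⟩ := D.tame_lam Rd
  obtain ⟨ε', δ', hε', hδ', H'⟩ := D.tame_dt Rd
  refine ⟨fun k => 2 * (δ k * (‖D.lam0‖ + 1) + ‖D.lam1‖ * δ k) + |D.th| * (2 * δ' k)
      + |D.th| ^ 2 * (2 * Rd * D.e k), ?_, ?_⟩
  · have := ((((hδ.mul_const (‖D.lam0‖ + 1)).add (hδ.const_mul ‖D.lam1‖)).const_mul 2).add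
      ((hδ'.const_mul 2).const_mul |D.th|)).add ((D.he0.const_mul (2 * Rd)).const_mul (|D.th| ^ 2))
    simp only [mul_zero, zero_mul, add_zero] at this
    exact this
  have hsm : ∀ᶠ k in atTop, |D.th| * (2 * Rd * D.e k) < 1 := by
    have : Tendsto (fun k => |D.th| * (2 * Rd * D.e k)) atTop (𝓝 0) := by
      simpa using (D.he0.const_mul (2 * Rd)).const_mul |D.th|
    exact this.eventually (gt_mem_nhds one_pos)
  filter_upwards [H, H', D.tame_lam.bdd Rd, D.dt_lower Rd, D.lam_conj Rd, D.det, hsm]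
    with k hk hk' hb hdl hlc hdet hsm x hx y hy
  have hd1 : D.dt k x = D.dt k y := by unfold dt; rw [hdet, hdet]
  have hdy := hdl y hy
  have hdp : 0 < D.dt k y := by linarith [hdy.1]
  have hlam := hlc y hy
  set d := D.dt k y with hddef
  set T := (x - y) * D.e k with hT
  set T' := |x - y| * D.e k with hT'
  have hTT : |T| = T' := by rw [hT, hT', abs_mul, abs_of_pos (D.he k)]
  have hT0 : 0 ≤ T' := by rw [← hTT]; exact abs_nonneg _
  have hT2 : T' ≤ 2 * Rd * D.e k := by
    rw [hT']
    have := D.he' k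
    gcongr
    calc |x - y| ≤ |x| + |y| := abs_sub _ _
      _ ≤ 2 * Rd := by linarith
  have hdne : (d : ℂ) ≠ 0 := by exact_mod_cast hdp.ne'
  have e1 : D.u k x * (starRingEnd ℂ) (D.u k y) = 1 + (D.lam k x - D.lam k y) *
      (starRingEnd ℂ) (D.lam k y) / d := by
    have hs : ((√d)⁻¹ : ℝ) * ((√d)⁻¹ : ℝ) = d⁻¹ := by
      rw [← mul_inv, Real.mul_self_sqrt hdp.le]
    have hs' : (((√d)⁻¹ : ℝ) : ℂ) * (((√d)⁻¹ : ℝ) : ℂ) = (d : ℂ)⁻¹ := by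
      rw [← Complex.ofReal_mul, hs, Complex.ofReal_inv]
    unfold u
    rw [hd1, ← hddef, map_mul, Complex.conj_ofReal]
    rw [show D.lam k x * (((√d)⁻¹ : ℝ) : ℂ) * ((starRingEnd ℂ) (D.lam k y) * (((√d)⁻¹ : ℝ) : ℂ))
      = D.lam k x * (starRingEnd ℂ) (D.lam k y) * ((((√d)⁻¹ : ℝ) : ℂ) * (((√d)⁻¹ : ℝ) : ℂ)) by ring,
      hs', sub_mul, hlam]
    field_simp
    ring
  have a3 := (hk x hx).2.2 y hy
  have b1 := (hk y hy).1
  have bl := hb y hy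
  have cd := (hk' y hy).1
  rw [Real.norm_eq_abs] at cd
  have hδ0 : 0 ≤ δ k := (norm_nonneg _).trans b1
  have hδ0' : 0 ≤ δ' k := (abs_nonneg _).trans cd
  -- first-order term
  have f1 : ‖(D.lam k x - D.lam k y) * (starRingEnd ℂ) (D.lam k y) - (T : ℂ) * (Complex.I * D.th)‖
      ≤ T' * (δ k * (‖D.lam0‖ + 1) + ‖D.lam1‖ * δ k) := by
    rw [← D.lam0_conj]
    rw [Complex.real_smul] at a3
    calc _ = ‖(D.lam k x - D.lam k y - T * D.lam1) * (starRingEnd ℂ) (D.lam k y)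
          + T * D.lam1 * (starRingEnd ℂ) (D.lam k y - D.lam0)‖ := by
          congr 1; rw [map_sub]; ring
      _ ≤ ‖(D.lam k x - D.lam k y - T * D.lam1) * (starRingEnd ℂ) (D.lam k y)‖
          + ‖T * D.lam1 * (starRingEnd ℂ) (D.lam k y - D.lam0)‖ := norm_add_le _ _
      _ = ‖D.lam k x - D.lam k y - T * D.lam1‖ * ‖D.lam k y‖
          + T' * ‖D.lam1‖ * ‖D.lam k y - D.lam0‖ := by
          simp only [norm_mul, RCLike.norm_conj, Complex.norm_real, Real.norm_eq_abs, hTT]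
      _ ≤ (δ k * T') * (‖D.lam0‖ + 1) + T' * ‖D.lam1‖ * δ k := by
          gcongr
      _ = _ := by ring
  have f2 : ‖(D.lam k x - D.lam k y) * (starRingEnd ℂ) (D.lam k y) / d - (T : ℂ) * (Complex.I * D.th)‖
      ≤ T' * (2 * (δ k * (‖D.lam0‖ + 1) + ‖D.lam1‖ * δ k) + |D.th| * (2 * δ' k)) := by
    set Z := (D.lam k x - D.lam k y) * (starRingEnd ℂ) (D.lam k y) with hZ
    have hdinv : d⁻¹ ≤ 2 := by
      rw [inv_le_comm₀ hdp (by norm_num)]; linarith [hdy.1]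
    have hdinv' : |d⁻¹ - 1| ≤ 2 * δ' k := by
      rw [show d⁻¹ - 1 = - (d⁻¹ * (d - 1)) by field_simp; ring, abs_neg, abs_mul,
        abs_of_pos (inv_pos.2 hdp)]
      gcongr
    calc _ = ‖(Z - (T : ℂ) * (Complex.I * D.th)) * ((d⁻¹ : ℝ) : ℂ)
          + (T : ℂ) * (Complex.I * D.th) * ((d⁻¹ - 1 : ℝ) : ℂ)‖ := by
          congr 1; push_cast; field_simp; ring
      _ ≤ _ := norm_add_le _ _
      _ = ‖Z - (T : ℂ) * (Complex.I * D.th)‖ * d⁻¹ + T' * |D.th| * |d⁻¹ - 1| := by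
          simp only [norm_mul, Complex.norm_real, Real.norm_eq_abs, hTT, Complex.norm_I, one_mul,
            abs_of_pos (inv_pos.2 hdp)]
      _ ≤ T' * (δ k * (‖D.lam0‖ + 1) + ‖D.lam1‖ * δ k) * 2 + T' * |D.th| * (2 * δ' k) := by
          gcongr
      _ = _ := by ring
  have hη : ‖Complex.I * ((D.th * T : ℝ) : ℂ)‖ = |D.th| * T' := by
    rw [norm_mul, Complex.norm_I, one_mul, Complex.norm_real, Real.norm_eq_abs, abs_mul, hTT]
  have f3 : ‖Complex.exp (Complex.I * ((D.th * T : ℝ) : ℂ)) - 1 - Complex.I * ((D.th * T : ℝ) : ℂ)‖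
      ≤ (|D.th| * T') ^ 2 := by
    rw [← hη]
    apply Complex.norm_exp_sub_one_sub_id_le
    rw [hη]
    exact (mul_le_mul_of_nonneg_left hT2 (abs_nonneg _)).trans hsm.le
  rw [e1]
  calc _ = ‖((D.lam k x - D.lam k y) * (starRingEnd ℂ) (D.lam k y) / d - (T : ℂ) * (Complex.I * D.th))
        - (Complex.exp (Complex.I * ((D.th * T : ℝ) : ℂ)) - 1 - Complex.I * ((D.th * T : ℝ) : ℂ))‖ := by
        congr 1; push_cast; ring
    _ ≤ _ := norm_sub_le _ _
    _ ≤ T' * (2 * (δ k * (‖D.lam0‖ + 1) + ‖D.lam1‖ * δ k) + |D.th| * (2 * δ' k))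
        + (|D.th| * T') ^ 2 := add_le_add f2 f3
    _ ≤ T' * (2 * (δ k * (‖D.lam0‖ + 1) + ‖D.lam1‖ * δ k) + |D.th| * (2 * δ' k))
        + |D.th| ^ 2 * (T' * (2 * Rd * D.e k)) := by
        rw [mul_pow, sq T']
        gcongr
    _ = _ := by ring

end Dyn

namespace Dyn
variable (D : Dyn)

/-- left eigenvector functional -/
def lin (k : ℕ) (x : ℝ) (a b : ℝ) : ℂ :=
  (D.R k x : ℂ) * a + (D.lam k x - (D.P k x : ℂ)) * b
def lin0 (a b : ℝ) : ℂ := (D.R0 : ℂ) * a + (D.lam0 - (D.P0 : ℂ)) * b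

lemma lin_sub (k : ℕ) (x a b a' b' : ℝ) :
    D.lin k x a b - D.lin k x a' b' = D.lin k x (a - a') (b - b') := by
  unfold lin; push_cast; ring

lemma lin_add (k : ℕ) (x a b a' b' : ℝ) :
    D.lin k x (a + a') (b + b') = D.lin k x a b + D.lin k x a' b' := by
  unfold lin; push_cast; ring

lemma tame_LP : Tame D.e (fun k x => D.lam k x - (D.P k x : ℂ)) (D.lam0 - (D.P0 : ℂ))
    (D.lam1 - (D.P1 : ℂ)) := D.tame_lam.sub D.he' D.tP.ofReal

lemma coercive (Rd : ℝ) : ∃ C : ℝ, 0 < C ∧ ∀ᶠ k in atTop, ∀ x, |x| ≤ Rd → ∀ a b : ℝ,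
    |a| + |b| ≤ C * ‖D.lin k x a b‖ ∧ ‖D.lin k x a b‖ ≤ C * (|a| + |b|) := by
  have h0 := D.om0_pos
  have hR := abs_pos.2 D.R0_ne
  set L := ‖D.lam0 - (D.P0 : ℂ)‖ + 1 with hL
  have hL0 : 0 < L := by positivity
  set C1 := 2 / D.om0
  set C2 := (2 / |D.R0|) * (1 + L * C1)
  have hC1 : 0 < C1 := by positivity
  have hC2 : 0 < C2 := by positivity
  refine ⟨C1 + C2 + L + (|D.R0| + 1), by positivity, ?_⟩
  filter_upwards [D.om_lower Rd, D.tame_LP.bdd Rd, D.tR.bdd Rd,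
    D.tR.close Rd (half_pos hR)] with k h1 h2 h3 h4 x hx a b
  have e1 := h1 x hx
  have e2 := h2 x hx
  have e3 := h3 x hx
  have e4 := h4 x hx
  rw [Real.norm_eq_abs] at e3 e4
  rw [Real.norm_eq_abs] at e3
  have e5 : |D.R0| / 2 ≤ |D.R k x| := by
    have := abs_sub_abs_le_abs_sub D.R0 (D.R k x)
    rw [abs_sub_comm] at this
    linarith
  set l := ‖D.lin k x a b‖ with hl
  have hl0 : 0 ≤ l := norm_nonneg _
  have hb : |b| ≤ C1 * l := by
    have him : (D.lin k x a b).im = D.om k x * b := by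
      simp [lin, lam]
    have := Complex.abs_im_le_norm (D.lin k x a b)
    rw [him, abs_mul, abs_of_pos (by linarith)] at this
    rw [show C1 * l = l / (D.om0 / 2) by simp only [C1]; field_simp, le_div_iff₀ (by positivity)]
    nlinarith [abs_nonneg b]
  have ha : |a| ≤ C2 * l := by
    have : ‖(D.R k x : ℂ) * a‖ ≤ l + L * |b| := by
      have e : (D.R k x : ℂ) * a = D.lin k x a b - (D.lam k x - (D.P k x : ℂ)) * b := by
        unfold lin; ring
      rw [e]
      refine (norm_sub_le _ _).trans ?_
      rw [norm_mul, Complex.norm_real, Real.norm_eq_abs]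
      gcongr
    rw [norm_mul, Complex.norm_real, Complex.norm_real, Real.norm_eq_abs, Real.norm_eq_abs] at this
    have h6 : |D.R0| / 2 * |a| ≤ (1 + L * C1) * l := by
      calc |D.R0| / 2 * |a| ≤ |D.R k x| * |a| := by gcongr
        _ ≤ l + L * |b| := this
        _ ≤ l + L * (C1 * l) := by gcongr
        _ = _ := by ring
    rw [show C2 * l = ((1 + L * C1) * l) / (|D.R0| / 2) by simp only [C2]; field_simp,
      le_div_iff₀ (by positivity)]
    linarith
  constructor
  · have : 0 ≤ (L + (|D.R0| + 1)) * l := by positivity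
    nlinarith
  · calc l ≤ ‖(D.R k x : ℂ) * a‖ + ‖(D.lam k x - (D.P k x : ℂ)) * b‖ := norm_add_le _ _
      _ = |D.R k x| * |a| + ‖D.lam k x - (D.P k x : ℂ)‖ * |b| := by
        rw [norm_mul, norm_mul, Complex.norm_real, Complex.norm_real, Complex.norm_real]; rfl
      _ ≤ (|D.R0| + 1) * |a| + L * |b| := by gcongr
      _ ≤ (C1 + C2 + L + (|D.R0| + 1)) * |a| + (C1 + C2 + L + (|D.R0| + 1)) * |b| := by
        have i1 := mul_le_mul_of_nonneg_right
          (show |D.R0| + 1 ≤ C1 + C2 + L + (|D.R0| + 1) by linarith) (abs_nonneg a)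
        have i2 := mul_le_mul_of_nonneg_right
          (show L ≤ C1 + C2 + L + (|D.R0| + 1) by linarith) (abs_nonneg b)
        linarith
      _ = _ := by ring

lemma lin_step (Rd : ℝ) : ∀ᶠ k in atTop, ∀ x, |x| ≤ Rd → ∀ a b : ℝ,
    D.lin k x (D.P k x * a + D.Q k x * b) (D.R k x * a + D.S k x * b)
      = D.lam k x * D.lin k x a b := by
  filter_upwards [D.om_sq Rd] with k hk x hx a b
  have h := hk x hx
  have hq : D.lam k x * D.lam k x = (D.tr k x : ℂ) * D.lam k x - (D.dt k x : ℂ) := by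
    have h' : (D.om k x : ℂ) * (D.om k x : ℂ) =
      (D.dt k x : ℂ) - (D.tr k x * D.tr k x : ℂ) * (1 / 4) := by
      have := congrArg Complex.ofReal h
      push_cast at this
      exact this
    unfold lam
    push_cast
    linear_combination (D.om k x : ℂ) * (D.om k x : ℂ) * Complex.I_mul_I - h'
  unfold lin
  unfold tr dt at hq
  push_cast at hq ⊢
  linear_combination (-(b : ℂ)) * hq

/-- scaled functional -/
def Y (k : ℕ) (x a b : ℝ) : ℂ := (√(D.A k) : ℂ) * D.lin k x a b

lemma step (Rd : ℝ) : ∃ ε : ℕ → ℝ, Summable ε ∧ (∀ k, 0 ≤ ε k) ∧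
    ∀ᶠ k in atTop, ∀ x, |x| ≤ Rd → ∀ a b : ℝ,
    ‖D.Y (k + 1) x (D.P k x * a + D.Q k x * b) (D.R k x * a + D.S k x * b)
      - D.u k x * D.Y k x a b‖ ≤ ε k * ‖D.Y k x a b‖ := by
  obtain ⟨C, hC, hco⟩ := D.coercive Rd
  obtain ⟨ε, δ, hε, hδ, H⟩ := D.tame_LP Rd
  obtain ⟨ε', δ', hε', hδ', H'⟩ := D.tR Rd
  set B := |D.P0| + 1 + (|D.Q0| + 1) + (|D.R0| + 1) + (|D.S0| + 1) with hB
  refine ⟨fun k => 2 * ((|ε k| + |ε' k|) * (B * C)), ?_, ?_, ?_⟩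
  · exact ((hε.abs.add hε'.abs).mul_right _).mul_left 2
  · intro k; positivity
  filter_upwards [hco, H, H', D.lin_step Rd, D.tP.bdd Rd, D.tQ.bdd Rd, D.tR.bdd Rd, D.tS.bdd Rd,
    D.dt_lower Rd, D.det] with k hco h1 h2 hls bP bQ bR bS hdl hdet x hx a b
  have bP := bP x hx
  have bQ := bQ x hx
  have bR := bR x hx
  have bS := bS x hx
  simp only [Real.norm_eq_abs] at bP bQ bR bS
  have c1 := (hco x hx a b).1
  have g1 := (h1 x hx).2.1
  have g2 := (h2 x hx).2.1
  rw [Real.norm_eq_abs] at g2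
  have hd := hdl x hx
  have hdd : D.dt k x = D.A k / D.A (k+1) := hdet x
  set a' := D.P k x * a + D.Q k x * b with ha'
  set b' := D.R k x * a + D.S k x * b with hb'
  have hAk := D.hA k
  have hAk1 := D.hA (k+1)
  have hs := Real.sqrt_pos.2 hAk
  have hs1 := Real.sqrt_pos.2 hAk1
  have hsd : √(D.dt k x) = √(D.A k) / √(D.A (k+1)) := by rw [hdd, Real.sqrt_div hAk.le]
  have hratio : √(D.A (k+1)) ≤ 2 * √(D.A k) := by
    rw [show 2 * √(D.A k) = √(4 * D.A k) by
      rw [Real.sqrt_mul (by norm_num), show (4:ℝ) = 2^2 by norm_num, Real.sqrt_sq (by norm_num)]]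
    apply Real.sqrt_le_sqrt
    have := hd.1
    rw [hdd, le_div_iff₀ hAk1] at this
    linarith
  have hu : (√(D.A (k+1)) : ℂ) * D.lam k x = D.u k x * (√(D.A k) : ℂ) := by
    unfold u
    rw [hsd]
    have : (√(D.A k) : ℂ) ≠ 0 := by exact_mod_cast hs.ne'
    have : (√(D.A (k+1)) : ℂ) ≠ 0 := by exact_mod_cast hs1.ne'
    push_cast
    field_simp
  have e1 : D.Y (k + 1) x a' b' - D.u k x * D.Y k x a b
      = (√(D.A (k+1)) : ℂ) * (D.lin (k+1) x a' b' - D.lin k x a' b') := by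
    rw [hls x hx a b]
    unfold Y
    linear_combination (D.lin k x a b) * hu
  have e2 : ‖D.lin (k+1) x a' b' - D.lin k x a' b'‖ ≤ (|ε k| + |ε' k|) * (|a'| + |b'|) := by
    have : D.lin (k+1) x a' b' - D.lin k x a' b' = ((D.R (k+1) x - D.R k x : ℝ) : ℂ) * a'
      + ((D.lam (k+1) x - (D.P (k+1) x : ℂ)) - (D.lam k x - (D.P k x : ℂ))) * b' := by
      unfold lin; push_cast; ring
    rw [this]
    refine (norm_add_le _ _).trans ?_
    rw [norm_mul, norm_mul, Complex.norm_real, Complex.norm_real, Complex.norm_real,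
      Real.norm_eq_abs, Real.norm_eq_abs, Real.norm_eq_abs]
    have i1 : |D.R (k+1) x - D.R k x| ≤ |ε k| + |ε' k| :=
      g2.trans ((le_abs_self _).trans (by linarith [abs_nonneg (ε k)]))
    have i2 := g1.trans ((le_abs_self _).trans (show |ε k| ≤ |ε k| + |ε' k| by
      linarith [abs_nonneg (ε' k)]))
    rw [mul_add]
    gcongr
  have e3 : |a'| + |b'| ≤ B * (|a| + |b|) := by
    have i1 : |a'| ≤ (|D.P0| + 1) * |a| + (|D.Q0| + 1) * |b| := by
      refine (abs_add_le _ _).trans ?_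
      rw [abs_mul, abs_mul]; gcongr
    have i2 : |b'| ≤ (|D.R0| + 1) * |a| + (|D.S0| + 1) * |b| := by
      refine (abs_add_le _ _).trans ?_
      rw [abs_mul, abs_mul]; gcongr
    have := abs_nonneg a
    have := abs_nonneg b
    have := abs_nonneg D.P0
    have := abs_nonneg D.Q0
    have := abs_nonneg D.R0
    have := abs_nonneg D.S0
    calc _ ≤ _ := add_le_add i1 i2
      _ = ((|D.P0| + 1) + (|D.R0| + 1)) * |a| + ((|D.Q0| + 1) + (|D.S0| + 1)) * |b| := by ring
      _ ≤ B * |a| + B * |b| := by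
        gcongr
        · linarith
        · linarith
      _ = _ := by ring
  have hB0 : 0 ≤ B := by positivity
  rw [e1, norm_mul, Complex.norm_real, Real.norm_eq_abs, abs_of_pos hs1]
  have e4 : ‖D.Y k x a b‖ = √(D.A k) * ‖D.lin k x a b‖ := by
    unfold Y
    rw [norm_mul, Complex.norm_real, Real.norm_eq_abs, abs_of_pos hs]
  rw [e4]
  calc √(D.A (k+1)) * ‖D.lin (k+1) x a' b' - D.lin k x a' b'‖
      ≤ (2 * √(D.A k)) * ((|ε k| + |ε' k|) * (B * (C * ‖D.lin k x a b‖))) := by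
        gcongr
        refine e2.trans ?_
        gcongr
        refine e3.trans ?_
        gcongr
    _ = _ := by ring

/-- scaled solution -/
def y (k : ℕ) (x : ℝ) : ℂ := D.Y k x (D.v1 k x) (D.v2 k x)

lemma c_y (k : ℕ) : Continuous (D.y k) := by
  unfold y Y lin
  have h1 := D.c_lam k
  have h2 := D.cR k
  have h3 := D.cP k
  have h4 := D.cv1 k
  have h5 := D.cv2 k
  have h6 := Complex.continuous_ofReal
  exact continuous_const.mul (((h6.comp h2).mul (h6.comp h4)).add
    ((h1.sub (h6.comp h3)).mul (h6.comp h5)))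

lemma norm_Y (k : ℕ) (x a b : ℝ) : ‖D.Y k x a b‖ = √(D.A k) * ‖D.lin k x a b‖ := by
  unfold Y
  rw [norm_mul, Complex.norm_real, Real.norm_eq_abs, abs_of_nonneg (Real.sqrt_nonneg _)]

def U (k0 k : ℕ) (x : ℝ) : ℂ := ∏ j ∈ Finset.Ico k0 k, D.u j x

end Dyn

namespace Dyn
variable (D : Dyn)

/-- step for the solution -/
lemma step_y (Rd : ℝ) : ∃ ε : ℕ → ℝ, Summable ε ∧ (∀ k, 0 ≤ ε k) ∧
    ∀ᶠ k in atTop, ∀ x, |x| ≤ Rd →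
    ‖D.y (k + 1) x - D.u k x * D.y k x‖ ≤ ε k * ‖D.y k x‖ := by
  obtain ⟨ε, h1, h2, h3⟩ := D.step Rd
  refine ⟨ε, h1, h2, ?_⟩
  filter_upwards [h3, D.rec1, D.rec2] with k h r1 r2 x hx
  have := h x hx (D.v1 k x) (D.v2 k x)
  rw [← r1, ← r2] at this
  exact this

lemma y_nz (Rd : ℝ) : ∀ᶠ k in atTop, ∀ x, |x| ≤ Rd → 0 < ‖D.y k x‖ := by
  obtain ⟨C, hC, h⟩ := D.coercive Rd
  filter_upwards [h, D.nz] with k h1 h2 x hx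
  have h3 := (h1 x hx (D.v1 k x) (D.v2 k x)).1
  rw [y, norm_Y]
  apply mul_pos (Real.sqrt_pos.2 (D.hA k))
  by_contra hc
  have hc' : ‖D.lin k x (D.v1 k x) (D.v2 k x)‖ = 0 := le_antisymm (not_lt.1 hc) (norm_nonneg _)
  rw [hc', mul_zero] at h3
  have a1 := abs_nonneg (D.v1 k x)
  have a2 := abs_nonneg (D.v2 k x)
  rcases h2 x with h | h
  · exact h (abs_eq_zero.1 (by linarith))
  · exact h (abs_eq_zero.1 (by linarith))

/-- Existence of the limiting amplitude on compacts. -/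
lemma amplitude (Rd : ℝ) (K : ℕ) : ∃ (k0 : ℕ) (Ψ : ℝ → ℂ) (η : ℕ → ℝ), K ≤ k0 ∧
    ContinuousOn Ψ {x | |x| ≤ Rd} ∧ Tendsto η atTop (𝓝 0) ∧
    (∀ k, k0 ≤ k → ∀ x, |x| ≤ Rd → ‖D.u k x‖ = 1) ∧
    (∀ k, k0 ≤ k → ∀ x, |x| ≤ Rd →
      ‖D.y k x * (starRingEnd ℂ) (D.U k0 k x) - Ψ x‖ ≤ η k) ∧
    (∀ x, |x| ≤ Rd → Ψ x ≠ 0) := by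
  obtain ⟨ε, hs, hpos, hst⟩ := D.step_y Rd
  have hhalf : ∀ᶠ k in atTop, ε k ≤ 1 / 2 :=
    (hs.tendsto_atTop_zero.eventually (gt_mem_nhds (by norm_num : (0:ℝ) < 1/2))).mono
      fun k hk => le_of_lt hk
  obtain ⟨k0, hk0⟩ := eventually_atTop.1 (((hst.and hhalf).and (D.u_conj Rd)).and
    ((D.c_u_on Rd).and ((D.y_nz Rd).and (eventually_ge_atTop K))))
  have Hst : ∀ k, k0 ≤ k → ∀ x, |x| ≤ Rd →
    ‖D.y (k + 1) x - D.u k x * D.y k x‖ ≤ ε k * ‖D.y k x‖ := fun k hk => (hk0 k hk).1.1.1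
  have Hh : ∀ k, k0 ≤ k → ε k ≤ 1 / 2 := fun k hk => (hk0 k hk).1.1.2
  have Hu : ∀ k, k0 ≤ k → ∀ x, |x| ≤ Rd → ‖D.u k x‖ = 1 := fun k hk => (hk0 k hk).1.2
  have Hc : ∀ k, k0 ≤ k → ContinuousOn (D.u k) {x | |x| ≤ Rd} := fun k hk => (hk0 k hk).2.1
  have Hy : ∀ x, |x| ≤ Rd → 0 < ‖D.y k0 x‖ := (hk0 k0 le_rfl).2.2.1
  set d : ℕ → ℝ := fun j => ε (k0 + j) with hd
  have hds : Summable d := by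
    have := (summable_nat_add_iff k0).2 hs
    simpa [hd, add_comm] using this
  have hd0 : ∀ j, 0 ≤ d j := fun j => hpos _
  set T := ∑' j, d j with hT
  have hpart : ∀ j, ∑ i ∈ Finset.range j, d i ≤ T := fun j => hds.sum_le_tsum _ (fun i _ => hd0 i)
  -- two sided bounds
  have hup : ∀ j x, |x| ≤ Rd →
      ‖D.y (k0 + j) x‖ ≤ Real.exp (∑ i ∈ Finset.range j, d i) * ‖D.y k0 x‖ := by
    intro j x hx
    induction j with
    | zero => simp
    | succ j ih =>
      rw [Finset.sum_range_succ, Real.exp_add]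
      have h1 := Hst (k0 + j) (by omega) x hx
      have h2 : ‖D.y (k0 + j + 1) x‖ ≤ (1 + d j) * ‖D.y (k0 + j) x‖ := by
        have := norm_le_norm_add_norm_sub' (D.y (k0 + j + 1) x) (D.u (k0+j) x * D.y (k0+j) x)
        rw [norm_mul, Hu (k0+j) (by omega) x hx, one_mul] at this
        simp only [hd]
        linarith
      have h3 : 1 + d j ≤ Real.exp (d j) := by linarith [Real.add_one_le_exp (d j)]
      calc ‖D.y (k0 + (j + 1)) x‖ ≤ (1 + d j) * ‖D.y (k0 + j) x‖ := h2
        _ ≤ Real.exp (d j) * (Real.exp (∑ i ∈ Finset.range j, d i) * ‖D.y k0 x‖) := by gcongr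
        _ = _ := by ring
  have hlow : ∀ j x, |x| ≤ Rd →
      Real.exp (-2 * ∑ i ∈ Finset.range j, d i) * ‖D.y k0 x‖ ≤ ‖D.y (k0 + j) x‖ := by
    intro j x hx
    induction j with
    | zero => simp
    | succ j ih =>
      rw [Finset.sum_range_succ, mul_add, Real.exp_add]
      have h1 := Hst (k0 + j) (by omega) x hx
      have h2 : (1 - d j) * ‖D.y (k0 + j) x‖ ≤ ‖D.y (k0 + j + 1) x‖ := by
        have := norm_le_norm_add_norm_sub' (D.u (k0+j) x * D.y (k0+j) x) (D.y (k0 + j + 1) x)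
        rw [norm_mul, Hu (k0+j) (by omega) x hx, one_mul, norm_sub_rev] at this
        simp only [hd]
        linarith
      have h3 : Real.exp (-2 * d j) ≤ 1 - d j := by
        have hh : d j ≤ 1/2 := Hh _ (by omega)
        have h5 : Real.exp (-2 * d j) ≤ 1 / (1 + 2 * d j) := by
          rw [show -2 * d j = -(2 * d j) by ring, Real.exp_neg, ← one_div]
          have := Real.add_one_le_exp (2 * d j)
          have := hd0 j
          gcongr
          linarith
        refine h5.trans ?_
        have := hd0 j
        rw [div_le_iff₀ (by linarith)]
        nlinarith
      calc _ = Real.exp (-2 * d j) * (Real.exp (-2 * ∑ i ∈ Finset.range j, d i) * ‖D.y k0 x‖) := by ring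
        _ ≤ (1 - d j) * ‖D.y (k0 + j) x‖ := by
          have hh : d j ≤ 1/2 := Hh _ (by omega)
          gcongr
          linarith
        _ ≤ _ := h2
  -- uniform bound
  obtain ⟨M0, hM0⟩ : ∃ M0, ∀ x, |x| ≤ Rd → ‖D.y k0 x‖ ≤ M0 := by
    have hK : IsCompact (Set.Icc (-Rd) Rd) := isCompact_Icc
    obtain ⟨M, hM⟩ := hK.exists_bound_of_continuousOn (D.c_y k0).continuousOn
    exact ⟨M, fun x hx => hM x (abs_le.1 hx)⟩
  set M := Real.exp T * |M0| with hM
  have hMpos : 0 ≤ M := by positivity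
  have hup' : ∀ j x, |x| ≤ Rd → ‖D.y (k0 + j) x‖ ≤ M := by
    intro j x hx
    refine (hup j x hx).trans ?_
    have := (hM0 x hx).trans (le_abs_self _)
    exact mul_le_mul (Real.exp_le_exp.2 (hpart j)) this (norm_nonneg _) (Real.exp_pos _).le
  set f : ℕ → ℝ → ℂ := fun j x => D.y (k0 + j) x * (starRingEnd ℂ) (D.U k0 (k0 + j) x) with hf
  have hUn : ∀ j x, |x| ≤ Rd → ‖D.U k0 (k0 + j) x‖ = 1 := by
    intro j x hx
    unfold U
    rw [norm_prod]
    exact Finset.prod_eq_one fun i hi => Hu i (Finset.mem_Ico.1 hi).1 x hx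
  have hfd : ∀ x, |x| ≤ Rd → ∀ j, dist (f j x) (f j.succ x) ≤ M * d j := by
    intro x hx j
    have hU : D.U k0 (k0 + (j + 1)) x = D.U k0 (k0 + j) x * D.u (k0 + j) x := by
      unfold U
      rw [← add_assoc, Finset.prod_Ico_succ_top (by omega)]
    have hu1 : D.u (k0 + j) x * (starRingEnd ℂ) (D.u (k0 + j) x) = 1 := by
      rw [Complex.mul_conj, Complex.normSq_eq_norm_sq, Hu (k0+j) (by omega) x hx]; simp
    have e : f j.succ x - f j x = (D.y (k0 + j + 1) x - D.u (k0 + j) x * D.y (k0 + j) x) *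
        (starRingEnd ℂ) (D.U k0 (k0 + (j+1)) x) := by
      simp only [hf, Nat.succ_eq_add_one, hU, map_mul]
      rw [← add_assoc]
      linear_combination (D.y (k0 + j) x * (starRingEnd ℂ) (D.U k0 (k0 + j) x)) * hu1
    rw [dist_comm, dist_eq_norm, e, norm_mul, RCLike.norm_conj, hUn _ x hx, mul_one]
    refine (Hst (k0+j) (by omega) x hx).trans ?_
    rw [mul_comm]
    exact mul_le_mul_of_nonneg_right (hup' j x hx) (hd0 j)
  have hsum : Summable fun j => M * d j := hds.mul_left M
  have hlim : ∀ x, |x| ≤ Rd → ∃ z, Tendsto (fun j => f j x) atTop (𝓝 z) := fun x hx =>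
    cauchySeq_tendsto_of_complete (cauchySeq_of_dist_le_of_summable _ (hfd x hx) hsum)
  choose! Ψ hΨ using hlim
  set η : ℕ → ℝ := fun k => ∑' m, M * d (k - k0 + m) with hη
  have hηt : Tendsto (fun j => ∑' m, M * d (j + m)) atTop (𝓝 0) := by
    have := tendsto_sum_nat_add (fun j => M * d j)
    simpa [add_comm] using this
  have hbd : ∀ j x, |x| ≤ Rd → ‖f j x - Ψ x‖ ≤ ∑' m, M * d (j + m) := by
    intro j x hx
    rw [← dist_eq_norm]
    exact dist_le_tsum_of_dist_le_of_tendsto _ (hfd x hx) hsum (hΨ x hx) j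
  refine ⟨k0, Ψ, η, (hk0 k0 le_rfl).2.2.2, ?_, ?_, Hu, ?_, ?_⟩
  · have hu : TendstoUniformlyOn f Ψ atTop {x | |x| ≤ Rd} := by
      rw [Metric.tendstoUniformlyOn_iff]
      intro r hr
      filter_upwards [hηt.eventually (gt_mem_nhds hr)] with j hj x hx
      rw [dist_comm, dist_eq_norm]
      exact (hbd j x hx).trans_lt hj
    refine hu.continuousOn (Frequently.of_forall fun j => ?_)
    refine (D.c_y _).continuousOn.mul (Complex.continuous_conj.comp_continuousOn ?_)
    unfold U
    exact continuousOn_finsetProd _ fun i hi => Hc i (Finset.mem_Ico.1 hi).1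
  · exact hηt.comp (tendsto_sub_atTop_nat k0)
  · intro k hk x hx
    have := hbd (k - k0) x hx
    simp only [hf, Nat.add_sub_cancel' hk] at this
    exact this
  · intro x hx h0
    have h1 : Tendsto (fun j => ‖f j x‖) atTop (𝓝 0) := by
      have := (hΨ x hx).norm
      rwa [h0, norm_zero] at this
    have h2 : ∀ j, Real.exp (-2 * T) * ‖D.y k0 x‖ ≤ ‖f j x‖ := by
      intro j
      simp only [hf]
      rw [norm_mul, RCLike.norm_conj, hUn _ x hx, mul_one]
      refine le_trans ?_ (hlow j x hx)
      have := hpart j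
      exact mul_le_mul_of_nonneg_right (Real.exp_le_exp.2 (by linarith)) (norm_nonneg _)
    have h3 := ge_of_tendsto' h1 h2
    have := mul_pos (Real.exp_pos (-2 * T)) (Hy x hx)
    linarith

end Dyn

namespace Dyn
variable (D : Dyn)

def sig (k : ℕ) : ℝ := ∑ j ∈ Finset.range k, D.e j
def g (x : ℝ) : ℝ := limUnder atTop (fun k => ‖D.y k x‖ ^ 2)

lemma amplitude' (Rd : ℝ) (K : ℕ) : ∃ (k0 : ℕ) (Ψ : ℝ → ℂ) (η : ℕ → ℝ), K ≤ k0 ∧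
    ContinuousOn Ψ {x | |x| ≤ Rd} ∧ Tendsto η atTop (𝓝 0) ∧
    (∀ k, k0 ≤ k → ∀ x, |x| ≤ Rd → ‖D.u k x‖ = 1) ∧
    (∀ k, k0 ≤ k → ∀ x, |x| ≤ Rd → ‖D.U k0 k x‖ = 1) ∧
    (∀ k, k0 ≤ k → ∀ x, |x| ≤ Rd →
      ‖D.y k x * (starRingEnd ℂ) (D.U k0 k x) - Ψ x‖ ≤ η k) ∧
    (∀ x, |x| ≤ Rd → Tendsto (fun k => ‖D.y k x‖) atTop (𝓝 ‖Ψ x‖)) ∧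
    (∀ x, |x| ≤ Rd → D.g x = ‖Ψ x‖ ^ 2 ∧ 0 < ‖Ψ x‖ ) := by
  obtain ⟨k0, Ψ, η, hK, h1, h2, h3, h4, h5⟩ := D.amplitude Rd K
  have hU : ∀ k, k0 ≤ k → ∀ x, |x| ≤ Rd → ‖D.U k0 k x‖ = 1 := by
    intro k hk x hx
    unfold U
    rw [norm_prod]
    exact Finset.prod_eq_one fun i hi => h3 i (Finset.mem_Ico.1 hi).1 x hx
  have ht : ∀ x, |x| ≤ Rd → Tendsto (fun k => ‖D.y k x‖) atTop (𝓝 ‖Ψ x‖) := by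
    intro x hx
    have : Tendsto (fun k => D.y k x * (starRingEnd ℂ) (D.U k0 k x)) atTop (𝓝 (Ψ x)) := by
      rw [tendsto_iff_norm_sub_tendsto_zero]
      refine squeeze_zero' (Eventually.of_forall fun _ => norm_nonneg _) ?_ h2
      filter_upwards [eventually_ge_atTop k0] with k hk using h4 k hk x hx
    refine this.norm.congr' ?_
    filter_upwards [eventually_ge_atTop k0] with k hk
    rw [norm_mul, RCLike.norm_conj, hU k hk x hx, mul_one]
  refine ⟨k0, Ψ, η, hK, h1, h2, h3, hU, h4, ht, fun x hx => ⟨?_, norm_pos_iff.2 (h5 x hx)⟩⟩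
  exact ((ht x hx).pow 2).limUnder_eq

lemma g_pos (x : ℝ) : 0 < D.g x := by
  obtain ⟨k0, Ψ, η, -, -, -, -, -, -, -, h⟩ := D.amplitude' |x| 0
  rw [(h x le_rfl).1]
  exact pow_pos (h x le_rfl).2 2

lemma nhds_ball (x : ℝ) : {y : ℝ | |y| ≤ |x| + 1} ∈ 𝓝 x := by
  have : ∀ᶠ y in 𝓝 x, |y| < |x| + 1 := (continuous_abs.tendsto x).eventually
    (gt_mem_nhds (by linarith))
  exact this.mono fun y hy => le_of_lt hy

lemma g_cont : Continuous D.g := by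
  rw [continuous_iff_continuousAt]
  intro x
  obtain ⟨k0, Ψ, η, -, hc, -, -, -, -, -, h⟩ := D.amplitude' (|x| + 1) 0
  have h1 : ContinuousAt Ψ x := hc.continuousAt (nhds_ball x)
  refine (h1.norm.pow 2).congr ?_
  filter_upwards [nhds_ball x] with y hy
  exact (h y hy).1.symm

lemma bound_y (Rd : ℝ) : ∃ C : ℝ, 0 < C ∧ ∀ᶠ k in atTop, ∀ x, |x| ≤ Rd → ‖D.y k x‖ ≤ C := by
  obtain ⟨k0, Ψ, η, -, hc, hη, -, hU, h4, -, h⟩ := D.amplitude' Rd 0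
  have hK : IsCompact (Set.Icc (-Rd) Rd) := isCompact_Icc
  have hc' : ContinuousOn Ψ (Set.Icc (-Rd) Rd) := hc.mono fun x hx => abs_le.2 hx
  obtain ⟨M, hM⟩ := hK.exists_bound_of_continuousOn hc'
  refine ⟨|M| + 1, by positivity, ?_⟩
  filter_upwards [eventually_ge_atTop k0, hη.eventually (gt_mem_nhds one_pos)] with k hk hk1 x hx
  have e1 := h4 k hk x hx
  have e2 := (hM x (abs_le.1 hx)).trans (le_abs_self M)
  have e3 := norm_le_norm_add_norm_sub' (D.y k x * (starRingEnd ℂ) (D.U k0 k x)) (Ψ x)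
  rw [norm_mul, RCLike.norm_conj, hU k hk x hx, mul_one] at e3
  linarith

lemma bound_v (Rd : ℝ) : ∃ C : ℝ, 0 < C ∧ ∀ᶠ k in atTop, ∀ x, |x| ≤ Rd →
    √(D.A k) * (|D.v1 k x| + |D.v2 k x|) ≤ C := by
  obtain ⟨C1, hC1, h1⟩ := D.coercive Rd
  obtain ⟨C2, hC2, h2⟩ := D.bound_y Rd
  refine ⟨C1 * C2, by positivity, ?_⟩
  filter_upwards [h1, h2] with k h1 h2 x hx
  have e1 := (h1 x hx (D.v1 k x) (D.v2 k x)).1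
  have e2 := h2 x hx
  rw [y, norm_Y] at e2
  calc _ ≤ √(D.A k) * (C1 * ‖D.lin k x (D.v1 k x) (D.v2 k x)‖) := by gcongr
    _ = C1 * (√(D.A k) * ‖D.lin k x (D.v1 k x) (D.v2 k x)‖) := by ring
    _ ≤ _ := by gcongr

lemma lower_v (x : ℝ) : ∃ c : ℝ, 0 < c ∧ ∀ᶠ k in atTop,
    c ≤ √(D.A k) * (|D.v1 k x| + |D.v2 k x|) := by
  obtain ⟨C1, hC1, h1⟩ := D.coercive |x|
  obtain ⟨k0, Ψ, η, -, -, -, -, -, -, ht, h⟩ := D.amplitude' |x| 0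
  have hp := (h x le_rfl).2
  refine ⟨(‖Ψ x‖ / 2) / C1, by positivity, ?_⟩
  filter_upwards [h1, (ht x le_rfl).eventually (lt_mem_nhds (half_lt_self hp))] with k h1 h2
  have e1 := (h1 x le_rfl (D.v1 k x) (D.v2 k x)).2
  rw [div_le_iff₀ hC1]
  rw [y, norm_Y] at h2
  calc _ ≤ _ := h2.le
    _ ≤ √(D.A k) * (C1 * (|D.v1 k x| + |D.v2 k x|)) := by gcongr
    _ = _ := by ring

lemma sqrtA_ratio : ∀ᶠ k in atTop, √(D.A (k+1)) ≤ 2 * √(D.A k) := by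
  filter_upwards [D.dt_lower 1, D.det] with k hd hdet
  rw [show 2 * √(D.A k) = √(4 * D.A k) by
      rw [Real.sqrt_mul (by norm_num), show (4:ℝ) = 2^2 by norm_num, Real.sqrt_sq (by norm_num)]]
  apply Real.sqrt_le_sqrt
  have := (hd 0 (by simp)).1
  have hdd : D.dt k 0 = D.A k / D.A (k+1) := hdet 0
  rw [hdd, le_div_iff₀ (D.hA (k+1))] at this
  linarith [D.hA k]

lemma Y_add (k : ℕ) (x a b a' b' : ℝ) :
    D.Y k x (a + a') (b + b') = D.Y k x a b + D.Y k x a' b' := by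
  unfold Y; rw [lin_add, mul_add]

set_option maxHeartbeats 1000000 in
lemma lipschitz (Rd : ℝ) : ∃ C : ℝ, 0 < C ∧ ∀ᶠ k in atTop, ∀ x, |x| ≤ Rd → ∀ y, |y| ≤ Rd →
    √(D.A k) * (|D.v1 k x - D.v1 k y| + |D.v2 k x - D.v2 k y|) ≤ C * (|x - y| * (1 + D.sig k)) := by
  obtain ⟨C1, hC1, h1⟩ := D.coercive Rd
  obtain ⟨C2, hC2, h2⟩ := D.bound_v Rd
  obtain ⟨ε, hs, hε0, hst⟩ := D.step Rd
  set B := (‖D.P1‖ + 1) + (‖D.Q1‖ + 1) + (‖D.R1‖ + 1) + (‖D.S1‖ + 1) with hB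
  have hB0 : 0 ≤ B := by positivity
  obtain ⟨k0, hk0⟩ := eventually_atTop.1 (((h1.and h2).and (hst.and (D.sqrtA_ratio.and (D.u_conj Rd)))).and
    (((D.tP.lip D.he' Rd).and (D.tQ.lip D.he' Rd)).and
    (((D.tR.lip D.he' Rd).and (D.tS.lip D.he' Rd)).and (D.rec1.and D.rec2))))
  obtain ⟨L, hL⟩ := D.lip k0 Rd
  set L' := √(D.A k0) * (C1 * |L|) with hL'
  set C3 := 2 * C1 * B * C2 with hC3
  have hC30 : 0 ≤ C3 := by positivity
  have hL0 : 0 ≤ L' := by positivity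
  have hsig : ∀ k, 0 ≤ D.sig k := fun k => Finset.sum_nonneg fun j _ => D.he' j
  have key : ∀ k, k0 ≤ k → ∀ x, |x| ≤ Rd → ∀ y, |y| ≤ Rd →
      ‖D.Y k x (D.v1 k x - D.v1 k y) (D.v2 k x - D.v2 k y)‖ ≤
      Real.exp (∑ j ∈ Finset.range k, ε j) * (L' * |x - y| + C3 * |x - y| * D.sig k) := by
    intro k hk x hx y hy
    induction k, hk using Nat.le_induction with
    | base =>
      obtain ⟨⟨⟨a1, a2⟩, a3, a4, au⟩, ⟨a5, a6⟩, ⟨a7, a8⟩, a9, a10⟩ := hk0 k0 le_rfl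
      rw [norm_Y]
      have i1 := (a1 x hx (D.v1 k0 x - D.v1 k0 y) (D.v2 k0 x - D.v2 k0 y)).2
      have i2 := hL x hx y hy
      have i3 : (1:ℝ) ≤ Real.exp (∑ j ∈ Finset.range k0, ε j) :=
        Real.one_le_exp (Finset.sum_nonneg fun j _ => hε0 j)
      calc _ ≤ √(D.A k0) * (C1 * (L * |x - y|)) := by
            gcongr
            exact i1.trans (by gcongr)
        _ ≤ √(D.A k0) * (C1 * (|L| * |x - y|)) := by gcongr; exact le_abs_self L
        _ = L' * |x - y| := by rw [hL']; ring
        _ ≤ 1 * (L' * |x - y| + C3 * |x - y| * D.sig k0) := by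
            have := hsig k0
            have : 0 ≤ C3 * |x - y| * D.sig k0 := by positivity
            linarith
        _ ≤ _ := by
            have := hsig k0
            gcongr
    | succ k hk ih =>
      obtain ⟨⟨⟨a1, a2⟩, a3, a4, au⟩, ⟨a5, a6⟩, ⟨a7, a8⟩, a9, a10⟩ := hk0 k hk
      have b1 := (hk0 (k+1) (by omega)).1.1.1
      set d1 := D.v1 k x - D.v1 k y with hd1
      set d2 := D.v2 k x - D.v2 k y with hd2
      set r1 := (D.P k x - D.P k y) * D.v1 k y + (D.Q k x - D.Q k y) * D.v2 k y with hr1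
      set r2 := (D.R k x - D.R k y) * D.v1 k y + (D.S k x - D.S k y) * D.v2 k y with hr2
      have e1 : D.v1 (k+1) x - D.v1 (k+1) y = (D.P k x * d1 + D.Q k x * d2) + r1 := by
        rw [a9, a9, hd1, hd2, hr1]; ring
      have e2 : D.v2 (k+1) x - D.v2 (k+1) y = (D.R k x * d1 + D.S k x * d2) + r2 := by
        rw [a10, a10, hd1, hd2, hr2]; ring
      rw [e1, e2, Y_add]
      have s1 : ‖D.Y (k+1) x (D.P k x * d1 + D.Q k x * d2) (D.R k x * d1 + D.S k x * d2)‖ ≤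
          (1 + ε k) * ‖D.Y k x d1 d2‖ := by
        have := norm_le_norm_add_norm_sub'
          (D.Y (k+1) x (D.P k x * d1 + D.Q k x * d2) (D.R k x * d1 + D.S k x * d2))
          (D.u k x * D.Y k x d1 d2)
        have h3 := a3 x hx d1 d2
        have hu : ‖D.u k x * D.Y k x d1 d2‖ ≤ ‖D.Y k x d1 d2‖ := by
          rw [norm_mul, au x hx, one_mul]
        linarith
      have pe := D.he' k
      have s2 : |r1| + |r2| ≤ B * (|x - y| * D.e k) * (|D.v1 k y| + |D.v2 k y|) := by
        have q1 := a5 x hx y hy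
        have q2 := a6 x hx y hy
        have q3 := a7 x hx y hy
        have q4 := a8 x hx y hy
        rw [Real.norm_eq_abs] at q1 q2 q3 q4
        set q := |x - y| * D.e k with hq
        have hq0 : 0 ≤ q := by positivity
        have i1 : |r1| ≤ (‖D.P1‖ + 1) * q * |D.v1 k y| + (‖D.Q1‖ + 1) * q * |D.v2 k y| := by
          refine (abs_add_le _ _).trans ?_
          rw [abs_mul, abs_mul]; gcongr
        have i2 : |r2| ≤ (‖D.R1‖ + 1) * q * |D.v1 k y| + (‖D.S1‖ + 1) * q * |D.v2 k y| := by
          refine (abs_add_le _ _).trans ?_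
          rw [abs_mul, abs_mul]; gcongr
        refine (add_le_add i1 i2).trans ?_
        have : B * q * (|D.v1 k y| + |D.v2 k y|) - ((‖D.P1‖ + 1) * q * |D.v1 k y| +
          (‖D.Q1‖ + 1) * q * |D.v2 k y| + ((‖D.R1‖ + 1) * q * |D.v1 k y| +
          (‖D.S1‖ + 1) * q * |D.v2 k y|)) = ((‖D.P1‖ + 1) + (‖D.R1‖ + 1)) * q * |D.v2 k y| +
          ((‖D.Q1‖ + 1) + (‖D.S1‖ + 1)) * q * |D.v1 k y| := by rw [hB]; ring
        have : 0 ≤ ((‖D.P1‖ + 1) + (‖D.R1‖ + 1)) * q * |D.v2 k y| +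
          ((‖D.Q1‖ + 1) + (‖D.S1‖ + 1)) * q * |D.v1 k y| := by positivity
        linarith
      have s3 : ‖D.Y (k+1) x r1 r2‖ ≤ C3 * |x - y| * D.e k := by
        rw [norm_Y]
        have i1 := (b1 x hx r1 r2).2
        have i2 := a2 y hy
        calc _ ≤ (2 * √(D.A k)) * (C1 * (B * (|x - y| * D.e k) * (|D.v1 k y| + |D.v2 k y|))) := by
              gcongr
              exact i1.trans (by gcongr)
          _ = 2 * C1 * B * (|x - y| * D.e k) * (√(D.A k) * (|D.v1 k y| + |D.v2 k y|)) := by ring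
          _ ≤ 2 * C1 * B * (|x - y| * D.e k) * C2 := by gcongr
          _ = _ := by rw [hC3]; ring
      have hsg : D.sig (k+1) = D.sig k + D.e k := Finset.sum_range_succ _ _
      rw [hsg, Finset.sum_range_succ, Real.exp_add]
      set E := Real.exp (∑ j ∈ Finset.range k, ε j) with hE
      have hE1 : 1 ≤ E := Real.one_le_exp (Finset.sum_nonneg fun j _ => hε0 j)
      have h3 : 1 + ε k ≤ Real.exp (ε k) := by linarith [Real.add_one_le_exp (ε k)]
      have h4 : 1 ≤ Real.exp (ε k) := Real.one_le_exp (hε0 k)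
      have := hsig k
      have h5 : (1:ℝ) ≤ E * Real.exp (ε k) := one_le_mul_of_one_le_of_one_le hE1 h4
      have h6 : 0 ≤ C3 * |x - y| * D.e k := by positivity
      calc _ ≤ _ := norm_add_le _ _
        _ ≤ (1 + ε k) * ‖D.Y k x d1 d2‖ + C3 * |x - y| * D.e k := add_le_add s1 s3
        _ ≤ Real.exp (ε k) * (E * (L' * |x - y| + C3 * |x - y| * D.sig k)) +
            (E * Real.exp (ε k)) * (C3 * |x - y| * D.e k) := by
            have q1 := le_mul_of_one_le_left h6 h5
            have q2 := mul_le_mul h3 ih (norm_nonneg _) (Real.exp_pos _).le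
            exact add_le_add q2 q1
        _ = _ := by ring
  set T := ∑' j, ε j with hT
  refine ⟨C1 * (Real.exp T * (L' + C3)) + 1, by positivity, ?_⟩
  filter_upwards [eventually_ge_atTop k0] with k hk x hx y hy
  have e1 := key k hk x hx y hy
  rw [norm_Y] at e1
  have e2 := ((hk0 k hk).1.1.1 x hx (D.v1 k x - D.v1 k y) (D.v2 k x - D.v2 k y)).1
  have hTk : ∑ j ∈ Finset.range k, ε j ≤ T := hs.sum_le_tsum _ (fun i _ => hε0 i)
  have := hsig k
  calc _ ≤ √(D.A k) * (C1 * ‖D.lin k x (D.v1 k x - D.v1 k y) (D.v2 k x - D.v2 k y)‖) := by gcongr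
    _ = C1 * (√(D.A k) * ‖D.lin k x (D.v1 k x - D.v1 k y) (D.v2 k x - D.v2 k y)‖) := by ring
    _ ≤ C1 * (Real.exp T * (L' * |x - y| + C3 * |x - y| * D.sig k)) := by
      refine mul_le_mul_of_nonneg_left (e1.trans ?_) hC1.le
      gcongr
    _ ≤ C1 * (Real.exp T * (L' * (|x - y| * (1 + D.sig k)) + C3 * (|x - y| * (1 + D.sig k)))) := by
      have q1 : |x - y| ≤ |x - y| * (1 + D.sig k) := by
        nlinarith [abs_nonneg (x - y)]
      have q2 : |x - y| * D.sig k ≤ |x - y| * (1 + D.sig k) := by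
        nlinarith [abs_nonneg (x - y)]
      rw [mul_assoc C3]
      gcongr
    _ = C1 * (Real.exp T * (L' + C3)) * (|x - y| * (1 + D.sig k)) := by ring
    _ ≤ _ := by
      have : 0 ≤ |x - y| * (1 + D.sig k) := by positivity
      nlinarith
end Dyn


lemma norm_prod_sub_prod_le' {ι : Type*} [DecidableEq ι] (s : Finset ι) (z w : ι → ℂ)
    (hz : ∀ i ∈ s, ‖z i‖ ≤ 1) (hw : ∀ i ∈ s, ‖w i‖ ≤ 1) :
    ‖∏ i ∈ s, z i - ∏ i ∈ s, w i‖ ≤ ∑ i ∈ s, ‖z i - w i‖ := by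
  induction s using Finset.induction_on with
  | empty => simp
  | insert a s ha ih =>
    rw [Finset.prod_insert ha, Finset.prod_insert ha, Finset.sum_insert ha]
    have ih := ih (fun i hi => hz i (Finset.mem_insert_of_mem hi))
      (fun i hi => hw i (Finset.mem_insert_of_mem hi))
    have e : z a * ∏ i ∈ s, z i - w a * ∏ i ∈ s, w i =
      (z a - w a) * ∏ i ∈ s, z i + w a * (∏ i ∈ s, z i - ∏ i ∈ s, w i) := by ring
    rw [e]
    refine (norm_add_le _ _).trans ?_
    rw [norm_mul, norm_mul]
    have h1 : ‖∏ i ∈ s, z i‖ ≤ 1 := by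
      rw [norm_prod]
      exact Finset.prod_le_one (fun _ _ => norm_nonneg _)
        fun i hi => hz i (Finset.mem_insert_of_mem hi)
    have h2 := hw a (Finset.mem_insert_self _ _)
    have h3 := mul_le_mul_of_nonneg_left h1 (norm_nonneg (z a - w a))
    have h4 := mul_le_mul_of_nonneg_right h2 (norm_nonneg (∏ i ∈ s, z i - ∏ i ∈ s, w i))
    linarith

namespace Dyn
variable (D : Dyn)

/-- weighted sums of a null sequence are negligible -/
lemma littleO_sum {e δ : ℕ → ℝ} (he : ∀ k, 0 ≤ e k) (hδ : Tendsto δ atTop (𝓝 0))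
    (hs : Tendsto (fun k => ∑ j ∈ Finset.range k, e j) atTop atTop) :
    Tendsto (fun k => (∑ j ∈ Finset.range k, δ j * e j) / ∑ j ∈ Finset.range k, e j)
      atTop (𝓝 0) := by
  have h1 : (fun k => δ k * e k) =o[atTop] e := by
    rw [Asymptotics.isLittleO_iff]
    intro c hc
    have := (tendsto_zero_iff_abs_tendsto_zero δ).1 hδ
    filter_upwards [this.eventually (gt_mem_nhds hc)] with k hk
    rw [norm_mul]
    exact mul_le_mul_of_nonneg_right hk.le (norm_nonneg _)
  exact (h1.sum_range he hs).tendsto_div_nhds_zero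

lemma phases {ι : Type*} {l : Filter ι} (hs : Tendsto D.sig atTop atTop)
    {k : ι → ℕ} {x1 x2 : ι → ℝ} {x ξ : ℝ} (hk : Tendsto k l atTop)
    (h1 : Tendsto x1 l (𝓝 x)) (h2 : Tendsto x2 l (𝓝 x))
    (hξ : Tendsto (fun i => (x1 i - x2 i) * D.sig (k i)) l (𝓝 ξ)) (k0 : ℕ)
    {δ : ℕ → ℝ} (hδ : Tendsto δ atTop (𝓝 0)) (hph : ∀ k, k0 ≤ k →
    ∀ x', |x'| ≤ |x| + 1 → ∀ y, |y| ≤ |x| + 1 →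
    ‖D.u k x' * (starRingEnd ℂ) (D.u k y) -
      Complex.exp (Complex.I * ((D.th * ((x' - y) * D.e k) : ℝ) : ℂ))‖
      ≤ δ k * (|x' - y| * D.e k))
    (hu : ∀ k, k0 ≤ k → ∀ y, |y| ≤ |x| + 1 → ‖D.u k y‖ = 1) :
    Tendsto (fun i => D.U k0 (k i) (x1 i) * (starRingEnd ℂ) (D.U k0 (k i) (x2 i))) l
      (𝓝 (Complex.exp (Complex.I * ((D.th * ξ : ℝ) : ℂ)))) := by
  set δ' : ℕ → ℝ := fun j => |δ j| with hδ'
  have hδ't : Tendsto δ' atTop (𝓝 0) := (tendsto_zero_iff_abs_tendsto_zero δ).1 hδ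
  have hx12 : Tendsto (fun i => x1 i - x2 i) l (𝓝 0) := by simpa using h1.sub h2
  -- exponential
  set w : ℕ → ι → ℂ := fun j i => Complex.exp (Complex.I * ((D.th * ((x1 i - x2 i) * D.e j) : ℝ) : ℂ))
    with hw
  set z : ℕ → ι → ℂ := fun j i => D.u j (x1 i) * (starRingEnd ℂ) (D.u j (x2 i)) with hz
  have hwn : ∀ j i, ‖w j i‖ = 1 := fun j i => by
    simp only [hw]; rw [mul_comm, Complex.norm_exp_ofReal_mul_I]
  have hb1 := h1.eventually (nhds_ball x)
  have hb2 := h2.eventually (nhds_ball x)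
  have hzn : ∀ i, |x1 i| ≤ |x| + 1 → |x2 i| ≤ |x| + 1 → ∀ j, k0 ≤ j → ‖z j i‖ = 1 := by
    intro i hi1 hi2 j hj
    simp only [hz]
    rw [norm_mul, RCLike.norm_conj, hu j hj _ hi1, hu j hj _ hi2, one_mul]
  -- initial finite piece for the difference
  have hprodw : ∀ i, k0 ≤ k i → ∏ j ∈ Finset.Ico k0 (k i), w j i =
      Complex.exp (Complex.I * ((D.th * ((x1 i - x2 i) * D.sig (k i) - (x1 i - x2 i) * D.sig k0) : ℝ) : ℂ)) := by
    intro i hi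
    simp only [hw]
    rw [← Complex.exp_sum, ← Finset.mul_sum, ← Complex.ofReal_sum, ← Finset.mul_sum,
      ← Finset.mul_sum, Finset.sum_Ico_eq_sub _ hi]
    congr 3
    unfold sig; ring_nf
  have hW : Tendsto (fun i => ∏ j ∈ Finset.Ico k0 (k i), w j i) l
      (𝓝 (Complex.exp (Complex.I * ((D.th * ξ : ℝ) : ℂ)))) := by
    have hc : Tendsto (fun i => D.th * ((x1 i - x2 i) * D.sig (k i) - (x1 i - x2 i) * D.sig k0)) l
        (𝓝 (D.th * ξ)) := by
      have := (hξ.sub (hx12.mul_const (D.sig k0))).const_mul D.th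
      simpa using this
    have hcont : Continuous fun t : ℝ => Complex.exp (Complex.I * (t : ℂ)) := by fun_prop
    refine ((hcont.tendsto _).comp hc).congr' ?_
    filter_upwards [hk.eventually (eventually_ge_atTop k0)] with i hi
    rw [hprodw i hi]; rfl
  -- individual factors with index below k1 tend to each other; bound the sum
  have hSum : Tendsto (fun i => ∑ j ∈ Finset.Ico k0 (k i), ‖z j i - w j i‖) l (𝓝 0) := by
    have hlo := littleO_sum D.he' hδ't hs
    have hprod := (hξ.abs).mul (hlo.comp hk)
    rw [mul_zero] at hprod
    refine squeeze_zero' (Eventually.of_forall fun _ => Finset.sum_nonneg fun _ _ => norm_nonneg _)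
      ?_ hprod
    filter_upwards [hb1, hb2, hk.eventually (hs.eventually (eventually_gt_atTop 0))] with i hi1 hi2 hp
    have hp' : 0 < D.sig (k i) := hp
    have : ∑ j ∈ Finset.Ico k0 (k i), ‖z j i - w j i‖ ≤
        ∑ j ∈ Finset.range (k i), |x1 i - x2 i| * (δ' j * D.e j) := by
      have hsub : Finset.Ico k0 (k i) ⊆ Finset.range (k i) := fun j hj =>
        Finset.mem_range.2 (Finset.mem_Ico.1 hj).2
      refine (Finset.sum_le_sum fun j hj => ?_).trans (Finset.sum_le_sum_of_subset_of_nonneg hsub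
        fun j _ _ => ?_)
      · refine (hph j (Finset.mem_Ico.1 hj).1 _ hi1 _ hi2).trans ?_
        have := mul_le_mul_of_nonneg_right (le_abs_self (δ j))
          (mul_nonneg (abs_nonneg (x1 i - x2 i)) (D.he' j))
        simp only [hδ']
        linarith
      · have := D.he' j
        simp only [hδ']
        positivity
    refine this.trans (le_of_eq ?_)
    rw [← Finset.mul_sum, abs_mul, abs_of_pos hp']
    simp only [Function.comp]
    change _ = |x1 i - x2 i| * D.sig (k i) * (_ / D.sig (k i))
    field_simp
  have hdiff : Tendsto (fun i => ∏ j ∈ Finset.Ico k0 (k i), z j i - ∏ j ∈ Finset.Ico k0 (k i), w j i) l (𝓝 0) := by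
    rw [tendsto_zero_iff_norm_tendsto_zero]
    refine squeeze_zero' (Eventually.of_forall fun _ => norm_nonneg _) ?_ hSum
    filter_upwards [hb1, hb2] with i hi1 hi2
    exact norm_prod_sub_prod_le' _ _ _
      (fun j hj => (hzn i hi1 hi2 j (Finset.mem_Ico.1 hj).1).le) (fun j _ => (hwn j i).le)
  have := hdiff.add hW
  rw [zero_add] at this
  refine this.congr fun i => ?_
  simp only [hz, U, sub_add_cancel, Finset.prod_mul_distrib, map_prod]


lemma lin0_im (a b a' b' : ℝ) :
    (D.lin0 a b * (starRingEnd ℂ) (D.lin0 a' b')).im = D.R0 * D.om0 * (b * a' - a * b') := by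
  simp only [lin0, lam0]
  simp
  ring

def y0 (k : ℕ) (x : ℝ) : ℂ := (√(D.A k) : ℂ) * D.lin0 (D.v1 k x) (D.v2 k x)

lemma y0_close (Rd : ℝ) : ∃ η : ℕ → ℝ, Tendsto η atTop (𝓝 0) ∧
    ∀ᶠ k in atTop, ∀ x, |x| ≤ Rd → ‖D.y k x - D.y0 k x‖ ≤ η k := by
  obtain ⟨ε, δ, hε, hδ, H⟩ := D.tame_LP Rd
  obtain ⟨ε', δ', hε', hδ', H'⟩ := D.tR Rd
  obtain ⟨C, hC, hb⟩ := D.bound_v Rd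
  refine ⟨fun k => (|δ k| + |δ' k|) * C, ?_, ?_⟩
  · have := (((tendsto_zero_iff_abs_tendsto_zero δ).1 hδ).add
      ((tendsto_zero_iff_abs_tendsto_zero δ').1 hδ')).mul_const C
    simpa using this
  filter_upwards [H, H', hb] with k h1 h2 h3 x hx
  have g1 := (h1 x hx).1
  have g2 := (h2 x hx).1
  have e : D.y k x - D.y0 k x = (√(D.A k) : ℂ) * (((D.R k x - D.R0 : ℝ) : ℂ) * (D.v1 k x : ℂ) +
      (D.lam k x - (D.P k x : ℂ) - (D.lam0 - (D.P0 : ℂ))) * (D.v2 k x : ℂ)) := by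
    unfold y y0 Y lin lin0
    push_cast
    ring
  rw [e, norm_mul, Complex.norm_real, Real.norm_of_nonneg (Real.sqrt_nonneg _)]
  have f1 : ‖((D.R k x - D.R0 : ℝ) : ℂ) * (D.v1 k x : ℂ) +
      (D.lam k x - (D.P k x : ℂ) - (D.lam0 - (D.P0 : ℂ))) * (D.v2 k x : ℂ)‖ ≤
      (|δ k| + |δ' k|) * (|D.v1 k x| + |D.v2 k x|) := by
    refine (norm_add_le _ _).trans ?_
    rw [norm_mul, norm_mul, Complex.norm_real, Complex.norm_real, Complex.norm_real,
      Real.norm_eq_abs (D.v1 k x), Real.norm_eq_abs (D.v2 k x), mul_add]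
    have i1 := g1.trans ((le_abs_self _).trans (show |δ k| ≤ |δ k| + |δ' k| by
      linarith [abs_nonneg (δ' k)]))
    have i2 := g2.trans ((le_abs_self _).trans (show |δ' k| ≤ |δ k| + |δ' k| by
      linarith [abs_nonneg (δ k)]))
    gcongr
  calc _ ≤ √(D.A k) * ((|δ k| + |δ' k|) * (|D.v1 k x| + |D.v2 k x|)) := by gcongr
    _ = (|δ k| + |δ' k|) * (√(D.A k) * (|D.v1 k x| + |D.v2 k x|)) := by ring
    _ ≤ _ := mul_le_mul_of_nonneg_left (h3 x hx) (by positivity)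

/-- The main asymptotic statement for Wronskian-type expressions. -/
theorem wronskian {ι : Type*} {l : Filter ι} (hs : Tendsto D.sig atTop atTop)
    {k : ι → ℕ} {x1 x2 : ι → ℝ} {x ξ : ℝ} (hk : Tendsto k l atTop)
    (h1 : Tendsto x1 l (𝓝 x)) (h2 : Tendsto x2 l (𝓝 x))
    (hξ : Tendsto (fun i => (x1 i - x2 i) * D.sig (k i)) l (𝓝 ξ)) :
    Tendsto (fun i => D.A (k i) * (D.v2 (k i) (x1 i) * D.v1 (k i) (x2 i) -
      D.v1 (k i) (x1 i) * D.v2 (k i) (x2 i))) l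
      (𝓝 (D.g x * Real.sin (D.th * ξ) / (D.R0 * D.om0))) := by
  obtain ⟨δ, hδ, hph⟩ := D.phase (|x| + 1)
  obtain ⟨k1, hk1⟩ := eventually_atTop.1 hph
  obtain ⟨k0, Ψ, η, hK, hc, hη, hu, hU, hψ, -, hg⟩ := D.amplitude' (|x| + 1) k1
  obtain ⟨η', hη', hy0⟩ := D.y0_close (|x| + 1)
  have hP := D.phases hs hk h1 h2 hξ k0 hδ (fun k hk => hk1 k (hK.trans hk)) hu
  have hΨc : ContinuousAt Ψ x := hc.continuousAt (nhds_ball x)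
  have hψt : ∀ z : ι → ℝ, Tendsto z l (𝓝 x) → Tendsto (fun i => D.y (k i) (z i) *
      (starRingEnd ℂ) (D.U k0 (k i) (z i))) l (𝓝 (Ψ x)) := by
    intro z hz
    have e1 : Tendsto (fun i => D.y (k i) (z i) * (starRingEnd ℂ) (D.U k0 (k i) (z i)) - Ψ (z i)) l
        (𝓝 0) := by
      rw [tendsto_zero_iff_norm_tendsto_zero]
      refine squeeze_zero' (Eventually.of_forall fun _ => norm_nonneg _) ?_ (hη.comp hk)
      filter_upwards [hk.eventually (eventually_ge_atTop k0), hz.eventually (nhds_ball x)]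
        with i hi hi' using hψ _ hi _ hi'
    simpa using e1.add (hΨc.tendsto.comp hz)
  have hyb : ∀ z : ι → ℝ, Tendsto z l (𝓝 x) → Tendsto (fun i => (D.y (k i) (z i) - D.y0 (k i) (z i)) *
      (starRingEnd ℂ) (D.U k0 (k i) (z i))) l (𝓝 0) := by
    intro z hz
    rw [tendsto_zero_iff_norm_tendsto_zero]
    refine squeeze_zero' (Eventually.of_forall fun _ => norm_nonneg _) ?_ (hη'.comp hk)
    filter_upwards [hk.eventually (eventually_ge_atTop k0), hz.eventually (nhds_ball x),
      hk.eventually hy0] with i hi hi' h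
    rw [norm_mul, RCLike.norm_conj, hU _ hi _ hi', mul_one]
    exact h _ hi'
  have hy0t : ∀ z : ι → ℝ, Tendsto z l (𝓝 x) → Tendsto (fun i => D.y0 (k i) (z i) *
      (starRingEnd ℂ) (D.U k0 (k i) (z i))) l (𝓝 (Ψ x)) := by
    intro z hz
    have := (hψt z hz).sub (hyb z hz)
    rw [sub_zero] at this
    refine this.congr fun i => ?_
    ring
  have hmain := ((hy0t x1 h1).mul ((Complex.continuous_conj.tendsto _).comp (hy0t x2 h2))).mul hP
  have hIm := (Complex.continuous_im.tendsto _).comp hmain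
  have hne : D.R0 * D.om0 ≠ 0 := mul_ne_zero D.R0_ne D.om0_pos.ne'
  have hfin := hIm.div_const (D.R0 * D.om0)
  have hlimv : (Ψ x * (starRingEnd ℂ) (Ψ x) * Complex.exp (Complex.I * ((D.th * ξ : ℝ) : ℂ))).im =
      D.g x * Real.sin (D.th * ξ) := by
    have hx : |x| ≤ |x| + 1 := by linarith
    rw [(hg x hx).1, Complex.mul_conj, Complex.normSq_eq_norm_sq, Complex.re_ofReal_mul
      |> fun _ => Complex.im_ofReal_mul, mul_comm Complex.I, Complex.exp_ofReal_mul_I_im]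
  rw [hlimv] at hfin
  refine hfin.congr' ?_
  filter_upwards [hk.eventually (eventually_ge_atTop k0), h1.eventually (nhds_ball x),
    h2.eventually (nhds_ball x)] with i hi hi1 hi2
  rw [div_eq_iff hne]
  have c1 : (starRingEnd ℂ) (D.U k0 (k i) (x1 i)) * D.U k0 (k i) (x1 i) = 1 := by
    rw [mul_comm, Complex.mul_conj, Complex.normSq_eq_norm_sq, hU _ hi _ hi1]; simp
  have c2 : (starRingEnd ℂ) (D.U k0 (k i) (x2 i)) * D.U k0 (k i) (x2 i) = 1 := by
    rw [mul_comm, Complex.mul_conj, Complex.normSq_eq_norm_sq, hU _ hi _ hi2]; simp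
  have e1 : D.y0 (k i) (x1 i) * (starRingEnd ℂ) (D.U k0 (k i) (x1 i)) *
      (starRingEnd ℂ) (D.y0 (k i) (x2 i) * (starRingEnd ℂ) (D.U k0 (k i) (x2 i))) *
      (D.U k0 (k i) (x1 i) * (starRingEnd ℂ) (D.U k0 (k i) (x2 i))) =
      D.y0 (k i) (x1 i) * (starRingEnd ℂ) (D.y0 (k i) (x2 i)) := by
    rw [map_mul, Complex.conj_conj]
    linear_combination (D.y0 (k i) (x1 i) * (starRingEnd ℂ) (D.y0 (k i) (x2 i)) *
      ((starRingEnd ℂ) (D.U k0 (k i) (x2 i)) * D.U k0 (k i) (x2 i))) * c1 +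
      (D.y0 (k i) (x1 i) * (starRingEnd ℂ) (D.y0 (k i) (x2 i))) * c2
  have e2 : D.y0 (k i) (x1 i) * (starRingEnd ℂ) (D.y0 (k i) (x2 i)) = ((D.A (k i) : ℝ) : ℂ) *
      (D.lin0 (D.v1 (k i) (x1 i)) (D.v2 (k i) (x1 i)) * (starRingEnd ℂ)
        (D.lin0 (D.v1 (k i) (x2 i)) (D.v2 (k i) (x2 i)))) := by
    have : ((D.A (k i) : ℝ) : ℂ) = (√(D.A (k i)) : ℂ) * (√(D.A (k i)) : ℂ) := by
      rw [← Complex.ofReal_mul, Real.mul_self_sqrt (D.hA _).le]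
    rw [this]
    unfold y0
    rw [map_mul, Complex.conj_ofReal]
    ring
  simp only [Function.comp]
  rw [e1, e2, Complex.im_ofReal_mul, lin0_im]
  ring

end Dyn


lemma Tame.seq {e : ℕ → ℝ} (he : ∀ k, 0 ≤ e k) {f : ℕ → ℝ} {c : ℝ} (hf : Tendsto f atTop (𝓝 c))
    (hs : Summable fun k => |f (k + 1) - f k|) : Tame e (fun k _ => f k) c 0 := by
  intro R
  refine ⟨fun k => |f (k+1) - f k|, fun k => |f k - c|, hs, ?_, Eventually.of_forall ?_⟩
  · have := hf.sub_const c
    rw [sub_self] at this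
    exact (tendsto_zero_iff_abs_tendsto_zero _).1 this
  intro k x _
  refine ⟨le_rfl, le_rfl, fun y _ => ?_⟩
  simp only [sub_self, smul_zero, norm_zero]
  have := he k
  positivity

lemma Tame.linx {e : ℕ → ℝ} (he : ∀ k, 0 < e k) {s : ℕ → ℝ} {G : ℝ} (hf : Tendsto s atTop (𝓝 0))
    (hs : Summable fun k => |s (k + 1) - s k|) (hG : Tendsto (fun k => s k / e k) atTop (𝓝 G)) :
    Tame e (fun k x => x * s k) 0 G := by
  intro R
  refine ⟨fun k => |R| * |s (k+1) - s k|, fun k => |R| * |s k| + |s k / e k - G|, hs.mul_left _, ?_,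
    Eventually.of_forall ?_⟩
  · have h1 := hG.sub_const G
    rw [sub_self] at h1
    have := (((tendsto_zero_iff_abs_tendsto_zero _).1 hf).const_mul |R|).add
      ((tendsto_zero_iff_abs_tendsto_zero _).1 h1)
    simpa using this
  intro k x hx
  have hx' : |x| ≤ |R| := hx.trans (le_abs_self R)
  have hek := he k
  refine ⟨?_, ?_, fun y _ => ?_⟩
  · rw [sub_zero, Real.norm_eq_abs, abs_mul]
    have := mul_le_mul_of_nonneg_right hx' (abs_nonneg (s k))
    linarith [abs_nonneg (s k / e k - G)]
  · rw [← mul_sub, Real.norm_eq_abs, abs_mul]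
    exact mul_le_mul_of_nonneg_right hx' (abs_nonneg _)
  · have : x * s k - y * s k - ((x - y) * e k) • G = ((x - y) * e k) * (s k / e k - G) := by
      rw [smul_eq_mul]; field_simp
    rw [this, Real.norm_eq_abs, abs_mul, abs_mul, abs_of_pos hek, mul_comm]
    gcongr
    have : 0 ≤ |R| * |s k| := by positivity
    linarith

/-- All standing hypotheses on the Jacobi parameters. -/
structure Setup where
  N : ℕ
  hN : 0 < N
  a : ℕ → ℝ
  b : ℕ → ℝ
  ha : ∀ n, 0 < a n
  α : ℤ → ℝ
  β : ℤ → ℝ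
  hα : ∀ n, 0 < α n
  hαper : ∀ n : ℤ, α (n + N) = α n
  hβper : ∀ n : ℤ, β (n + N) = β n
  hmod_a : Tendsto a atTop atTop
  hmod_r : Tendsto (fun n : ℕ => |a n / a (n + 1) - α (n : ℤ) / α ((n : ℤ) + 1)|) atTop (𝓝 0)
  hmod_b : Tendsto (fun n : ℕ => |b n / a n - β (n : ℤ) / α (n : ℤ)|) atTop (𝓝 0)
  hD1 : ∀ i < N, memD1 (fun k => a ((k + 1) * N + i - 1) / a ((k + 1) * N + i))
  hD2 : ∀ i < N, memD1 (fun k => b ((k + 1) * N + i) / a ((k + 1) * N + i))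
  hD3 : ∀ i < N, memD1 (fun k => 1 / a ((k + 1) * N + i))
  hCarleman : Tendsto (fun n : ℕ => ∑ k ∈ Finset.range n, 1 / a k) atTop atTop
  htr : |Matrix.trace (frakX0 α β N 0)| < 2

namespace Setup
variable (S : Setup)

def p (n : ℕ) (x : ℝ) : ℝ := opoly S.a S.b n x
/-- block scale -/
def e (k : ℕ) : ℝ := S.α 0 / S.a (k * S.N)

lemma he (k : ℕ) : 0 < S.e k := div_pos (S.hα 0) (S.ha _)
lemma he' (k : ℕ) : 0 ≤ S.e k := (S.he k).le

lemma α_per (k : ℕ) (n : ℤ) : S.α ((k * S.N : ℕ) + n) = S.α n := by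
  induction k with
  | zero => simp
  | succ k ih =>
    rw [← ih, ← S.hαper ((k * S.N : ℕ) + n)]; congr 1; push_cast; ring

lemma β_per (k : ℕ) (n : ℤ) : S.β ((k * S.N : ℕ) + n) = S.β n := by
  induction k with
  | zero => simp
  | succ k ih =>
    rw [← ih, ← S.hβper ((k * S.N : ℕ) + n)]; congr 1; push_cast; ring

lemma tendsto_block (m : ℕ) : Tendsto (fun k : ℕ => k * S.N + m) atTop atTop :=
  tendsto_atTop_mono (fun k => by
    have := Nat.le_mul_of_pos_right k S.hN
    simp only [id]; omega) tendsto_id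

lemma tendsto_block' : Tendsto (fun k : ℕ => k * S.N - 1) atTop atTop := by
  have := (tendsto_sub_atTop_nat 1).comp (S.tendsto_block 0)
  exact this

lemma he0 : Tendsto S.e atTop (𝓝 0) := by
  have := (S.hmod_a.comp (S.tendsto_block 0))
  exact this.const_div_atTop (S.α 0)

lemma tend_ratio (m : ℕ) : Tendsto (fun k : ℕ => S.a (k * S.N + m - 1) / S.a (k * S.N + m)) atTop
    (𝓝 (S.α ((m : ℤ) - 1) / S.α m)) := by
  have h1 := S.hmod_r.comp ((tendsto_sub_atTop_nat 1).comp (S.tendsto_block m))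
  rw [tendsto_iff_norm_sub_tendsto_zero]
  refine h1.congr' ?_
  filter_upwards [eventually_ge_atTop 1] with k hk
  have h2 : 1 ≤ k * S.N + m := by nlinarith [S.hN]
  simp only [Function.comp, Real.norm_eq_abs]
  rw [Nat.sub_add_cancel h2]
  have h3 : ((k * S.N + m - 1 : ℕ) : ℤ) = ((k * S.N : ℕ) : ℤ) + ((m : ℤ) - 1) := by
    rw [Nat.cast_sub h2]; push_cast; ring
  rw [h3, S.α_per, show ((k * S.N : ℕ) : ℤ) + ((m : ℤ) - 1) + 1 = ((k * S.N : ℕ) : ℤ) + (m : ℤ) by ring,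
    S.α_per]

lemma tend_b (m : ℕ) : Tendsto (fun k : ℕ => S.b (k * S.N + m) / S.a (k * S.N + m)) atTop
    (𝓝 (S.β m / S.α m)) := by
  have h1 := S.hmod_b.comp (S.tendsto_block m)
  rw [tendsto_iff_norm_sub_tendsto_zero]
  refine h1.congr fun k => ?_
  simp only [Function.comp, Real.norm_eq_abs]
  rw [Nat.cast_add, S.α_per, S.β_per]

lemma tend_inv (m : ℕ) : Tendsto (fun k : ℕ => 1 / S.a (k * S.N + m)) atTop (𝓝 0) :=
  (S.hmod_a.comp (S.tendsto_block m)).const_div_atTop 1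

lemma tend_a0 (m : ℕ) : Tendsto (fun k : ℕ => S.a (k * S.N) / S.a (k * S.N + m)) atTop
    (𝓝 (S.α 0 / S.α m)) := by
  induction m with
  | zero =>
    have h1 : ∀ k, S.a (k * S.N) ≠ 0 := fun k => (S.ha _).ne'
    simp [div_self (S.hα 0).ne', h1]
  | succ m ih =>
    have h := ih.mul (S.tend_ratio (m + 1))
    have e : S.α 0 / S.α m * (S.α (((m + 1 : ℕ) : ℤ) - 1) / S.α ((m + 1 : ℕ) : ℤ)) =
        S.α 0 / S.α ((m + 1 : ℕ) : ℤ) := by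
      rw [show (((m + 1 : ℕ) : ℤ) - 1) = (m : ℤ) by push_cast; ring]
      have := (S.hα m).ne'
      have := (S.hα ((m + 1 : ℕ) : ℤ)).ne'
      field_simp
    rw [e] at h
    refine h.congr fun k => ?_
    have := (S.ha (k * S.N + m)).ne'
    have := (S.ha (k * S.N + (m + 1))).ne'
    rw [show k * S.N + (m + 1) - 1 = k * S.N + m by omega]
    field_simp

lemma summ_shift {f : ℕ → ℝ} (h : Summable fun k => |f (k + 1 + 1) - f (k + 1)|) :
    Summable fun k => |f (k + 1) - f k| :=
  (summable_nat_add_iff 1).1 h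

lemma tame_r {m : ℕ} (hm : m < S.N) : Tame S.e
    (fun k _ => S.a (k * S.N + m - 1) / S.a (k * S.N + m)) (S.α ((m : ℤ) - 1) / S.α m) 0 :=
  Tame.seq S.he' (S.tend_ratio m) (summ_shift (f := fun k => S.a (k * S.N + m - 1) / S.a (k * S.N + m))
    (S.hD1 m hm).2)

lemma tame_b {m : ℕ} (hm : m < S.N) : Tame S.e
    (fun k _ => S.b (k * S.N + m) / S.a (k * S.N + m)) (S.β m / S.α m) 0 :=
  Tame.seq S.he' (S.tend_b m) (summ_shift (f := fun k => S.b (k * S.N + m) / S.a (k * S.N + m))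
    (S.hD2 m hm).2)

lemma tame_x {m : ℕ} (hm : m < S.N) : Tame S.e
    (fun k x => x * (1 / S.a (k * S.N + m))) 0 (1 / S.α m) := by
  apply Tame.linx S.he (S.tend_inv m) (summ_shift (f := fun k => 1 / S.a (k * S.N + m)) (S.hD3 m hm).2)
  have h := (S.tend_a0 m).div_const (S.α 0)
  have := (S.hα 0).ne'
  have := (S.hα m).ne'
  rw [show S.α 0 / S.α m / S.α 0 = 1 / S.α m by field_simp] at h
  refine h.congr fun k => ?_
  have := (S.ha (k * S.N + m)).ne'
  have := (S.ha (k * S.N)).ne'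
  unfold e
  field_simp

/-- one-step transfer matrices -/
def C (n : ℕ) (x : ℝ) : Mat2 :=
  !![0, 1; -(S.a (n - 1) / S.a n), (x * (1 / S.a n) - S.b n / S.a n)]

def M (k : ℕ) : ℕ → ℝ → Mat2
  | 0, _ => 1
  | (m + 1), x => S.C (k * S.N + m) x * M k m x

def X (m : ℕ) (x : ℝ) : Mat2 := prodDZ (fun j => frakB S.α S.β j x) 0 m

lemma X_succ (m : ℕ) (x : ℝ) : S.X (m + 1) x = frakB S.α S.β m x * S.X m x := by
  unfold X; rw [prodDZ, zero_add]

lemma tame_M (m : ℕ) (hm : m ≤ S.N) : ∀ i j : Fin 2, ∃ d : ℝ,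
    HasDerivAt (fun y => S.X m y i j) d 0 ∧
    Tame S.e (fun k x => S.M k m x i j) (S.X m 0 i j) d := by
  induction m with
  | zero =>
    intro i j
    refine ⟨0, ?_, ?_⟩
    · simp only [X, prodDZ]
      exact hasDerivAt_const _ _
    · simp only [X, prodDZ, M]
      exact Tame.const S.he' _
  | succ m ih =>
    have ih := ih (by omega)
    have hm' : m < S.N := by omega
    intro i j
    obtain ⟨d0, h0, t0⟩ := ih 0 j
    obtain ⟨d1, h1, t1⟩ := ih 1 j
    fin_cases i
    · refine ⟨d1, ?_, ?_⟩
      · refine h1.congr_of_eventuallyEq (Eventually.of_forall fun y => ?_)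
        simp [X_succ, frakB, Matrix.mul_apply, Fin.sum_univ_two]
      · refine (t1.congr_val ?_ rfl).congr_fun (Eventually.of_forall fun k x => ?_)
        · simp [X_succ, frakB, Matrix.mul_apply, Fin.sum_univ_two]
        · simp [M, C, Matrix.mul_apply, Fin.sum_univ_two]
    · have hα := (S.hα m).ne'
      refine ⟨-(S.α ((m:ℤ) - 1)) / S.α m * d0 + (1 / S.α m * S.X m 0 1 j + (0 - S.β m) / S.α m * d1), ?_, ?_⟩
      · have hd := (h0.const_mul (-(S.α ((m:ℤ) - 1)) / S.α m)).add
          ((((hasDerivAt_id (0:ℝ)).sub_const (S.β m)).div_const (S.α m)).mul h1)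
        refine hd.congr_of_eventuallyEq (Eventually.of_forall fun y => ?_)
        simp [X_succ, frakB, Matrix.mul_apply, Fin.sum_univ_two]
      · have ht := (((S.tame_r hm').neg S.he').mul S.he' t0).add S.he'
          ((((S.tame_x hm').sub S.he' (S.tame_b hm'))).mul S.he' t1)
        refine (ht.congr_val ?_ ?_).congr_fun (Eventually.of_forall fun k x => ?_)
        · simp [X_succ, frakB, Matrix.mul_apply, Fin.sum_univ_two]; ring
        · ring
        · simp [M, C, Matrix.mul_apply, Fin.sum_univ_two]

lemma c_M (k m : ℕ) : ∀ i j : Fin 2, Continuous fun x => S.M k m x i j := by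
  induction m with
  | zero => intro i j; simp only [M]; exact continuous_const
  | succ m ih =>
    intro i j
    have h0 := ih 0 j
    have h1 := ih 1 j
    fin_cases i
    · simp [M, C, Matrix.mul_apply, Fin.sum_univ_two]; fun_prop
    · simp [M, C, Matrix.mul_apply, Fin.sum_univ_two]; fun_prop

lemma det_M (k m : ℕ) (hk : 1 ≤ k) (x : ℝ) :
    (S.M k m x).det = S.a (k * S.N - 1) / S.a (k * S.N + m - 1) := by
  induction m with
  | zero => simp [M, div_self (S.ha _).ne']
  | succ m ih =>
    have h2 : 1 ≤ k * S.N := by nlinarith [S.hN]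
    rw [M, Matrix.det_mul, ih, C, Matrix.det_fin_two_of,
      show k * S.N + (m + 1) - 1 = k * S.N + m by omega]
    have := (S.ha (k * S.N + m - 1)).ne'
    have := (S.ha (k * S.N + m)).ne'
    field_simp
    ring

lemma det_X (m : ℕ) (x : ℝ) : (S.X m x).det = S.α (-1) / S.α ((m:ℤ) - 1) := by
  induction m with
  | zero => simp [X, prodDZ, div_self (S.hα _).ne']
  | succ m ih =>
    rw [X_succ, Matrix.det_mul, ih, frakB, Matrix.det_fin_two_of,
      show (((m + 1 : ℕ) : ℤ) - 1) = (m : ℤ) by push_cast; ring]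
    have := (S.hα m).ne'
    have := (S.hα ((m:ℤ) - 1)).ne'
    field_simp
    ring

lemma det_XN (x : ℝ) : (S.X S.N x).det = 1 := by
  rw [det_X]
  have := S.hαper (-1)
  rw [show (S.N : ℤ) - 1 = -1 + S.N by ring, this, div_self (S.hα _).ne']

lemma p_rec (n : ℕ) (x : ℝ) : S.p (n + 2) x =
    ((x - S.b (n + 1)) * S.p (n + 1) x - S.a n * S.p n x) / S.a (n + 1) := rfl

lemma p_rec' {n : ℕ} (hn : 1 ≤ n) (x : ℝ) : S.p (n + 1) x =
    -(S.a (n - 1) / S.a n) * S.p (n - 1) x + (x * (1 / S.a n) - S.b n / S.a n) * S.p n x := by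
  obtain ⟨m, rfl⟩ : ∃ m, n = m + 1 := ⟨n - 1, by omega⟩
  rw [p_rec, Nat.add_sub_cancel]
  ring

lemma p_contDiff (n : ℕ) : ContDiff ℝ 1 (S.p n) := by
  have : ∀ n, ContDiff ℝ 1 (S.p n) ∧ ContDiff ℝ 1 (S.p (n + 1)) := by
    intro n
    induction n with
    | zero =>
      refine ⟨contDiff_const, ?_⟩
      exact (contDiff_id.sub contDiff_const).div_const _
    | succ n ih =>
      refine ⟨ih.2, ?_⟩
      have : S.p (n + 1 + 1) = fun x => ((x - S.b (n + 1)) * S.p (n + 1) x - S.a n * S.p n x) / S.a (n + 1) := rfl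
      rw [this]
      exact (((contDiff_id.sub contDiff_const).mul ih.2).sub (contDiff_const.mul ih.1)).div_const _
  exact (this n).1

lemma c_p (n : ℕ) : Continuous (S.p n) := (S.p_contDiff n).continuous

lemma p_lip (n : ℕ) (Rd : ℝ) : ∃ L : ℝ, 0 ≤ L ∧ ∀ x, |x| ≤ Rd → ∀ y, |y| ≤ Rd →
    |S.p n x - S.p n y| ≤ L * |x - y| := by
  obtain ⟨K, hK⟩ := LocallyLipschitzOn.exists_lipschitzOnWith_of_compact
    (isCompact_Icc (a := -Rd) (b := Rd)) ((S.p_contDiff n).locallyLipschitz.locallyLipschitzOn)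
  refine ⟨K, K.2, fun x hx y hy => ?_⟩
  have := hK.dist_le_mul x (abs_le.1 hx) y (abs_le.1 hy)
  simpa [Real.dist_eq] using this

lemma p_nz (n : ℕ) (x : ℝ) : S.p n x ≠ 0 ∨ S.p (n + 1) x ≠ 0 := by
  induction n with
  | zero => left; simp [p, opoly]
  | succ n ih =>
    by_contra hc
    push Not at hc
    obtain ⟨h1, h2⟩ := hc
    rw [p_rec, h1] at h2
    have h3 := (S.ha (n+1)).ne'
    rw [div_eq_zero_iff] at h2
    rcases h2 with h2 | h2
    · rw [mul_zero, zero_sub, neg_eq_zero, mul_eq_zero] at h2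
      rcases h2 with h2 | h2
      · exact (S.ha n).ne' h2
      · rcases ih with h | h
        · exact h h2
        · exact h h1
    · exact h3 h2

lemma rec_M (k m : ℕ) (hk : 1 ≤ k) (x : ℝ) :
    S.p (k * S.N + m - 1) x = S.M k m x 0 0 * S.p (k * S.N - 1) x + S.M k m x 0 1 * S.p (k * S.N) x ∧
    S.p (k * S.N + m) x = S.M k m x 1 0 * S.p (k * S.N - 1) x + S.M k m x 1 1 * S.p (k * S.N) x := by
  have h2 : 1 ≤ k * S.N := by nlinarith [S.hN]
  induction m with
  | zero => simp [M]
  | succ m ih =>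
    rw [show k * S.N + (m + 1) - 1 = k * S.N + m by omega, ← add_assoc]
    rw [p_rec' S (show 1 ≤ k * S.N + m by omega), ih.1, ih.2]
    constructor
    · simp [M, C, Matrix.mul_apply, Fin.sum_univ_two]
    · simp [M, C, Matrix.mul_apply, Fin.sum_univ_two]; ring

lemma exists_dyn : ∃ D : Dyn, D.e = S.e ∧ (∀ k, D.A k = S.a (k * S.N - 1)) ∧
    (∀ k x, D.v1 k x = S.p (k * S.N - 1) x) ∧ (∀ k x, D.v2 k x = S.p (k * S.N) x) ∧
    D.t0 = Matrix.trace (frakX0 S.α S.β S.N 0) ∧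
    D.t1 = deriv (fun y => Matrix.trace (frakX0 S.α S.β S.N y)) 0 := by
  obtain ⟨d00, h00, t00⟩ := S.tame_M S.N le_rfl 0 0
  obtain ⟨d01, h01, t01⟩ := S.tame_M S.N le_rfl 0 1
  obtain ⟨d10, h10, t10⟩ := S.tame_M S.N le_rfl 1 0
  obtain ⟨d11, h11, t11⟩ := S.tame_M S.N le_rfl 1 1
  refine ⟨{ e := S.e, A := fun k => S.a (k * S.N - 1)
            P := fun k x => S.M k S.N x 0 0, Q := fun k x => S.M k S.N x 0 1
            R := fun k x => S.M k S.N x 1 0, S := fun k x => S.M k S.N x 1 1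
            v1 := fun k => S.p (k * S.N - 1), v2 := fun k => S.p (k * S.N)
            P0 := S.X S.N 0 0 0, Q0 := S.X S.N 0 0 1, R0 := S.X S.N 0 1 0, S0 := S.X S.N 0 1 1
            P1 := d00, Q1 := d01, R1 := d10, S1 := d11
            he := S.he, he0 := S.he0, hA := fun k => S.ha _
            tP := t00, tQ := t01, tR := t10, tS := t11
            cP := fun k => S.c_M k _ 0 0, cQ := fun k => S.c_M k _ 0 1
            cR := fun k => S.c_M k _ 1 0, cS := fun k => S.c_M k _ 1 1
            cv1 := fun k => S.c_p _, cv2 := fun k => S.c_p _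
            rec1 := ?_, rec2 := ?_, det := ?_, det0 := ?_, dis := ?_, lip := ?_, nz := ?_ },
    rfl, fun _ => rfl, fun _ _ => rfl, fun _ _ => rfl, ?_, ?_⟩
  · filter_upwards [eventually_ge_atTop 1] with k hk x
    rw [Nat.add_mul, one_mul]
    exact (S.rec_M k S.N hk x).1
  · filter_upwards [eventually_ge_atTop 1] with k hk x
    rw [Nat.add_mul, one_mul]
    exact (S.rec_M k S.N hk x).2
  · filter_upwards [eventually_ge_atTop 1] with k hk x
    rw [Nat.add_mul, one_mul]
    rw [← Matrix.det_fin_two]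
    exact S.det_M k S.N hk x
  · rw [← Matrix.det_fin_two]; exact S.det_XN 0
  · have := S.htr
    rw [Matrix.trace_fin_two] at this
    change |S.X S.N 0 0 0 + S.X S.N 0 1 1| < 2 at this
    have h2 := sq_lt_sq' (abs_lt.1 this).1 (abs_lt.1 this).2
    linarith
  · intro k Rd
    obtain ⟨L1, -, h1⟩ := S.p_lip (k * S.N - 1) Rd
    obtain ⟨L2, -, h2⟩ := S.p_lip (k * S.N) Rd
    refine ⟨L1 + L2, fun x hx y hy => ?_⟩
    linarith [h1 x hx y hy, h2 x hx y hy]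
  · filter_upwards [eventually_ge_atTop 1] with k hk x
    have h2 : 1 ≤ k * S.N := by nlinarith [S.hN]
    have := S.p_nz (k * S.N - 1) x
    rwa [Nat.sub_add_cancel h2] at this
  · simp [Dyn.t0, Matrix.trace_fin_two, X, frakX0]
  · have : HasDerivAt (fun y => Matrix.trace (frakX0 S.α S.β S.N y)) (d00 + d11) 0 := by
      refine (h00.add h11).congr_of_eventuallyEq (Eventually.of_forall fun y => ?_)
      simp [Matrix.trace_fin_two, X, frakX0]
    rw [this.deriv]; rfl

end Setup

namespace Setup
variable (S : Setup)

def rr (n : ℕ) : ℝ := ∑ j ∈ Finset.range n, S.α (j : ℤ) / S.a j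
def KK (n : ℕ) (x y : ℝ) : ℝ := ∑ j ∈ Finset.range n, S.p j x * S.p j y

lemma term_pos (n : ℕ) : 0 < S.α (n : ℤ) / S.a n := div_pos (S.hα _) (S.ha _)
lemma rr_succ (n : ℕ) : S.rr (n + 1) = S.rr n + S.α (n : ℤ) / S.a n := Finset.sum_range_succ _ _
lemma KK_succ (n : ℕ) (x y : ℝ) : S.KK (n + 1) x y = S.KK n x y + S.p n x * S.p n y :=
  Finset.sum_range_succ _ _
lemma rr_mono : Monotone S.rr := monotone_nat_of_le_succ fun n => by
  rw [rr_succ]; linarith [S.term_pos n]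
lemma rr_nonneg (n : ℕ) : 0 ≤ S.rr n := Finset.sum_nonneg fun j _ => (S.term_pos j).le
lemma rr_pos (n : ℕ) : 0 < S.rr (n + 1) := by
  rw [rr_succ]; linarith [S.term_pos n, S.rr_nonneg n]

lemma α_mod (n : ℕ) : S.α n = S.α ((n % S.N : ℕ) : ℤ) := by
  conv_lhs => rw [← Nat.div_add_mod' n S.N]
  rw [Nat.cast_add, S.α_per]

lemma α_bounds : ∃ c C : ℝ, 0 < c ∧ 0 < C ∧ ∀ n : ℕ, c ≤ S.α n ∧ S.α n ≤ C := by
  have hne : (Finset.range S.N).Nonempty := ⟨0, Finset.mem_range.2 S.hN⟩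
  obtain ⟨i, -, hi⟩ := Finset.exists_min_image (Finset.range S.N) (fun n : ℕ => S.α n) hne
  obtain ⟨j, -, hj⟩ := Finset.exists_max_image (Finset.range S.N) (fun n : ℕ => S.α n) hne
  refine ⟨S.α i, S.α j, S.hα _, S.hα _, fun n => ?_⟩
  rw [S.α_mod n]
  have hm := Finset.mem_range.2 (Nat.mod_lt n S.hN)
  exact ⟨hi _ hm, hj _ hm⟩

lemma rr_tendsto : Tendsto S.rr atTop atTop := by
  obtain ⟨c, C, hc, hC, h⟩ := S.α_bounds
  refine tendsto_atTop_mono (fun n => ?_) (S.hCarleman.const_mul_atTop hc)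
  rw [Finset.mul_sum]
  refine Finset.sum_le_sum fun j _ => ?_
  rw [mul_one_div]
  exact div_le_div_of_nonneg_right (h j).1 (S.ha j).le

lemma term_tendsto : Tendsto (fun n : ℕ => S.α (n : ℤ) / S.a n) atTop (𝓝 0) := by
  obtain ⟨c, C, hc, hC, h⟩ := S.α_bounds
  refine squeeze_zero (fun n => (S.term_pos n).le) (fun n => ?_) (S.hmod_a.const_div_atTop C)
  exact div_le_div_of_nonneg_right (h n).2 (S.ha n).le

def sg (k : ℕ) : ℝ := ∑ j ∈ Finset.range k, S.e j
def f (j : ℕ) : ℝ := ∑ i ∈ Finset.range S.N, S.α (i : ℤ) / S.a (j * S.N + i)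

lemma rr_block (k : ℕ) : S.rr (k * S.N) = ∑ j ∈ Finset.range k, S.f j := by
  induction k with
  | zero => simp [rr]
  | succ k ih =>
    rw [Finset.sum_range_succ, ← ih, Nat.add_mul, one_mul, rr, Finset.sum_range_add, f]
    congr 1
    refine Finset.sum_congr rfl fun i _ => ?_
    rw [Nat.cast_add, S.α_per]

lemma f_ratio : Tendsto (fun j => S.f j / S.e j) atTop (𝓝 S.N) := by
  have h : ∀ i ∈ Finset.range S.N, Tendsto (fun j => S.α (i : ℤ) / S.a (j * S.N + i) / S.e j) atTop
      (𝓝 1) := by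
    intro i _
    have h1 := (S.tend_a0 i).const_mul (S.α i / S.α 0)
    have a1 := (S.hα 0).ne'
    have a2 := (S.hα i).ne'
    rw [show S.α i / S.α 0 * (S.α 0 / S.α i) = 1 by field_simp] at h1
    refine h1.congr fun j => ?_
    have := (S.ha (j * S.N + i)).ne'
    have := (S.ha (j * S.N)).ne'
    unfold e
    field_simp
  have h2 := tendsto_finsetSum _ h
  simp only [Finset.sum_const, Finset.card_range, nsmul_eq_mul, mul_one] at h2
  refine h2.congr fun j => ?_
  rw [f, Finset.sum_div]

lemma e_le_f (j : ℕ) : S.e j ≤ S.f j := by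
  have := Finset.single_le_sum (f := fun i : ℕ => S.α (i : ℤ) / S.a (j * S.N + i))
    (fun i _ => (div_pos (S.hα _) (S.ha _)).le) (Finset.mem_range.2 S.hN)
  simpa [e, f] using this

lemma sg_le_rr (k : ℕ) : S.sg k ≤ S.rr (k * S.N) := by
  rw [rr_block]
  exact Finset.sum_le_sum fun j _ => S.e_le_f j

lemma sg_tendsto : Tendsto S.sg atTop atTop := by
  by_contra hc
  have hmono : Monotone S.sg := monotone_nat_of_le_succ fun n => by
    rw [sg, sg, Finset.sum_range_succ]; linarith [S.he' n]
  have hsum : Summable S.e := by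
    by_contra hns
    exact hc ((not_summable_iff_tendsto_nat_atTop_of_nonneg S.he').1 hns)
  have hf : Summable S.f := by
    refine summable_of_isBigO_nat hsum ?_
    refine Asymptotics.isBigO_of_div_tendsto_nhds (Eventually.of_forall fun k hk => ?_) _ S.f_ratio
    exact absurd hk (S.he k).ne'
  have h1 := (hf.hasSum.tendsto_sum_nat)
  have h2 : Tendsto (fun k => S.rr (k * S.N)) atTop atTop := S.rr_tendsto.comp (S.tendsto_block 0)
  simp only [rr_block] at h2
  exact not_tendsto_nhds_of_tendsto_atTop h2 _ h1

lemma rr_ratio : Tendsto (fun k => S.rr (k * S.N) / S.sg k) atTop (𝓝 S.N) := by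
  have hδ : Tendsto (fun j => S.f j / S.e j - S.N) atTop (𝓝 0) := by
    simpa using S.f_ratio.sub_const (S.N : ℝ)
  have h := Dyn.littleO_sum S.he' hδ S.sg_tendsto
  have h2 := h.add_const (S.N : ℝ)
  rw [zero_add] at h2
  refine h2.congr' ?_
  filter_upwards [S.sg_tendsto.eventually (eventually_gt_atTop 0)] with k hk
  have hk' : (∑ j ∈ Finset.range k, S.e j) ≠ 0 := hk.ne'
  have e1 : ∑ j ∈ Finset.range k, (S.f j / S.e j - S.N) * S.e j =
      S.rr (k * S.N) - S.N * ∑ j ∈ Finset.range k, S.e j := by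
    rw [rr_block, Finset.mul_sum, ← Finset.sum_sub_distrib]
    refine Finset.sum_congr rfl fun j _ => ?_
    have := (S.he j).ne'
    field_simp
  rw [e1]
  unfold sg
  field_simp
  ring

/-- from residue classes to all indices -/
lemma bound_all {Z : Type*} (s : Set Z) (F : ℕ → Z → ℝ)
    (h1 : ∀ m < S.N, ∃ C : ℝ, ∀ᶠ k in atTop, ∀ z ∈ s, F (k * S.N + m) z ≤ C)
    (h2 : ∀ n, ∃ C : ℝ, ∀ z ∈ s, F n z ≤ C) : ∃ C : ℝ, 0 < C ∧ ∀ n, ∀ z ∈ s, F n z ≤ C := by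
  choose! C1 hC1 using h1
  choose C2 hC2 using h2
  obtain ⟨k0, hk0⟩ : ∃ k0, ∀ m < S.N, ∀ k, k0 ≤ k → ∀ z ∈ s, F (k * S.N + m) z ≤ C1 m := by
    have : ∀ᶠ k in atTop, ∀ m ∈ Finset.range S.N, ∀ z ∈ s, F (k * S.N + m) z ≤ C1 m := by
      rw [Filter.eventually_all_finset]
      intro m hm
      exact hC1 m (Finset.mem_range.1 hm)
    obtain ⟨k0, h⟩ := eventually_atTop.1 this
    exact ⟨k0, fun m hm k hk => h k hk m (Finset.mem_range.2 hm)⟩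
  have nn1 : 0 ≤ ∑ m ∈ Finset.range S.N, |C1 m| := Finset.sum_nonneg fun _ _ => abs_nonneg _
  have nn2 : 0 ≤ ∑ n ∈ Finset.range (k0 * S.N), |C2 n| := Finset.sum_nonneg fun _ _ => abs_nonneg _
  refine ⟨∑ m ∈ Finset.range S.N, |C1 m| + ∑ n ∈ Finset.range (k0 * S.N), |C2 n| + 1,
    by positivity, fun n z hz => ?_⟩
  by_cases hn : n < k0 * S.N
  · have := Finset.single_le_sum (f := fun n => |C2 n|) (fun _ _ => abs_nonneg _) (Finset.mem_range.2 hn)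
    have h3 := (hC2 n z hz).trans (le_abs_self _)
    linarith
  · have hk : k0 ≤ n / S.N := (Nat.le_div_iff_mul_le S.hN).2 (not_lt.1 hn)
    have hm := Nat.mod_lt n S.hN
    have h3 := hk0 _ hm _ hk z hz
    rw [Nat.div_add_mod'] at h3
    have := Finset.single_le_sum (f := fun n => |C1 n|) (fun _ _ => abs_nonneg _) (Finset.mem_range.2 hm)
    have h4 := h3.trans (le_abs_self _)
    linarith

lemma A_ratio (m : ℕ) : ∃ C : ℝ, 0 < C ∧ ∀ᶠ k in atTop,
    √(S.a (k * S.N + m)) ≤ C * √(S.a (k * S.N - 1)) := by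
  have h1 := (S.tend_ratio 0).mul (S.tend_a0 m)
  set L := S.α (((0 : ℕ) : ℤ) - 1) / S.α ((0 : ℕ) : ℤ) * (S.α 0 / S.α m) with hL
  have hLpos : 0 < L := mul_pos (div_pos (S.hα _) (S.hα _)) (div_pos (S.hα _) (S.hα _))
  refine ⟨√(2 / L), by positivity, ?_⟩
  filter_upwards [h1.eventually (lt_mem_nhds (half_lt_self hLpos))] with k hk
  rw [← Real.sqrt_mul (by positivity)]
  apply Real.sqrt_le_sqrt
  have a1 := S.ha (k * S.N)
  have a2 := S.ha (k * S.N + m)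
  rw [Nat.add_zero, div_mul_div_cancel₀ a1.ne', lt_div_iff₀ a2] at hk
  rw [div_mul_eq_mul_div, le_div_iff₀ hLpos]
  linarith

lemma bound_p (Rd : ℝ) : ∃ C : ℝ, 0 < C ∧ ∀ n, ∀ x, |x| ≤ Rd → √(S.a n) * |S.p n x| ≤ C := by
  obtain ⟨D, hDe, hDA, hv1, hv2, -⟩ := S.exists_dyn
  refine S.bound_all {x | |x| ≤ Rd} (fun n x => √(S.a n) * |S.p n x|) ?_ ?_
  · intro m hm
    obtain ⟨d0, -, t0⟩ := S.tame_M m hm.le 1 0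
    obtain ⟨d1, -, t1⟩ := S.tame_M m hm.le 1 1
    obtain ⟨C1, hC1, h1⟩ := S.A_ratio m
    obtain ⟨C2, hC2, h2⟩ := D.bound_v Rd
    set B := (‖S.X m 0 1 0‖ + 1) + (‖S.X m 0 1 1‖ + 1) with hB
    refine ⟨C1 * (B * C2), ?_⟩
    filter_upwards [t0.bdd Rd, t1.bdd Rd, h1, h2, eventually_ge_atTop 1] with k b0 b1 h1 h2 hk x hx
    have q0 := b0 x hx
    have q1 := b1 x hx
    have q2 := h2 x hx
    rw [hDA, hv1, hv2] at q2
    rw [Real.norm_eq_abs] at q0 q1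
    rw [(S.rec_M k m hk x).2]
    have : |S.M k m x 1 0 * S.p (k * S.N - 1) x + S.M k m x 1 1 * S.p (k * S.N) x| ≤
        B * (|S.p (k * S.N - 1) x| + |S.p (k * S.N) x|) := by
      refine (abs_add_le _ _).trans ?_
      rw [abs_mul, abs_mul, mul_add]
      have n0 := norm_nonneg (S.X m 0 1 0)
      have n1 := norm_nonneg (S.X m 0 1 1)
      exact add_le_add (mul_le_mul_of_nonneg_right (by linarith) (abs_nonneg _))
        (mul_le_mul_of_nonneg_right (by linarith) (abs_nonneg _))
    calc _ ≤ (C1 * √(S.a (k * S.N - 1))) * (B * (|S.p (k * S.N - 1) x| + |S.p (k * S.N) x|)) :=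
          mul_le_mul h1 this (abs_nonneg _) (by positivity)
      _ = C1 * (B * (√(S.a (k * S.N - 1)) * (|S.p (k * S.N - 1) x| + |S.p (k * S.N) x|))) := by ring
      _ ≤ _ := by gcongr
  · intro n
    obtain ⟨M, hM⟩ := (isCompact_Icc (a := -Rd) (b := Rd)).exists_bound_of_continuousOn
      (S.c_p n).continuousOn
    refine ⟨√(S.a n) * M, fun x hx => ?_⟩
    exact mul_le_mul_of_nonneg_left (hM x (abs_le.1 hx)) (Real.sqrt_nonneg _)

lemma lip_p (Rd : ℝ) : ∃ C : ℝ, 0 < C ∧ ∀ n, ∀ x, |x| ≤ Rd → ∀ y, |y| ≤ Rd →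
    √(S.a n) * |S.p n x - S.p n y| ≤ C * (|x - y| * (1 + S.rr n)) := by
  obtain ⟨D, hDe, hDA, hv1, hv2, -⟩ := S.exists_dyn
  suffices H : ∃ C : ℝ, 0 < C ∧ ∀ n, ∀ z ∈ {z : ℝ × ℝ | |z.1| ≤ Rd ∧ |z.2| ≤ Rd},
      (fun n z => √(S.a n) * |S.p n z.1 - S.p n z.2| / (|z.1 - z.2| * (1 + S.rr n))) n z ≤ C by
    obtain ⟨C, hC, h⟩ := H
    refine ⟨C, hC, fun n x hx y hy => ?_⟩
    by_cases hxy : x = y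
    · simp [hxy]
    have h1 := h n (x, y) ⟨hx, hy⟩
    have h2 : 0 < |x - y| := abs_pos.2 (sub_ne_zero.2 hxy)
    have h3 := S.rr_nonneg n
    rwa [div_le_iff₀ (by positivity)] at h1
  refine S.bound_all _ _ ?_ ?_
  · intro m hm
    obtain ⟨d0, -, t0⟩ := S.tame_M m hm.le 1 0
    obtain ⟨d1, -, t1⟩ := S.tame_M m hm.le 1 1
    obtain ⟨C1, hC1, h1⟩ := S.A_ratio m
    obtain ⟨C2, hC2, h2⟩ := D.bound_v Rd
    obtain ⟨C3, hC3, h3⟩ := D.lipschitz Rd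
    set B := (‖S.X m 0 1 0‖ + 1) + (‖S.X m 0 1 1‖ + 1) with hB
    set B' := (‖d0‖ + 1) + (‖d1‖ + 1) with hB'
    refine ⟨C1 * (B * C3 + B' * C2), ?_⟩
    filter_upwards [t0.bdd Rd, t1.bdd Rd, t0.lip S.he' Rd, t1.lip S.he' Rd, h1, h2, h3,
      eventually_ge_atTop 1, S.he0.eventually (gt_mem_nhds one_pos)]
      with k b0 b1 l0 l1 h1 h2 h3 hk hek
    rintro ⟨x, y⟩ ⟨hx, hy⟩
    simp only at hx hy ⊢
    have hrn := S.rr_nonneg (k * S.N + m)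
    refine div_le_of_le_mul₀ (by positivity) (by positivity) ?_
    have q0 := b0 y hy
    have q1 := b1 y hy
    have w0 := l0 x hx y hy
    have w1 := l1 x hx y hy
    have q2 := h2 x hx
    have q3 := h3 x hx y hy
    have hsg : D.sig k ≤ S.rr (k * S.N + m) := by
      have : D.sig k = S.sg k := by unfold Dyn.sig sg; rw [hDe]
      rw [this]
      exact (S.sg_le_rr k).trans (S.rr_mono (by omega))
    rw [hDA, hv1, hv2] at q2
    rw [hDA, hv1, hv2, hv1, hv2] at q3
    rw [Real.norm_eq_abs] at q0 q1 w0 w1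
    rw [(S.rec_M k m hk x).2, (S.rec_M k m hk y).2]
    set v := S.p (k * S.N - 1) x with hv
    set v' := S.p (k * S.N - 1) y with hv'
    set t := S.p (k * S.N) x with ht
    set t' := S.p (k * S.N) y with ht'
    set s := √(S.a (k * S.N - 1)) with hs
    have hs0 : 0 ≤ s := Real.sqrt_nonneg _
    have n0 := norm_nonneg (S.X m 0 1 0)
    have n1 := norm_nonneg (S.X m 0 1 1)
    have n2 := norm_nonneg d0
    have n3 := norm_nonneg d1
    set q := |x - y| with hq
    have hq0 : 0 ≤ q := abs_nonneg _
    have he1 : q * S.e k ≤ q := by nlinarith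
    have key : |S.M k m x 1 0 * v + S.M k m x 1 1 * t - (S.M k m y 1 0 * v' + S.M k m y 1 1 * t')| ≤
        B * (|v - v'| + |t - t'|) + B' * q * (|v| + |t|) := by
      have e : S.M k m x 1 0 * v + S.M k m x 1 1 * t - (S.M k m y 1 0 * v' + S.M k m y 1 1 * t') =
        (S.M k m y 1 0 * (v - v') + S.M k m y 1 1 * (t - t')) +
        ((S.M k m x 1 0 - S.M k m y 1 0) * v + (S.M k m x 1 1 - S.M k m y 1 1) * t) := by ring
      rw [e]
      refine (abs_add_le _ _).trans (add_le_add ?_ ?_)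
      · refine (abs_add_le _ _).trans ?_
        rw [abs_mul, abs_mul, mul_add]
        exact add_le_add (mul_le_mul_of_nonneg_right (by linarith) (abs_nonneg _))
          (mul_le_mul_of_nonneg_right (by linarith) (abs_nonneg _))
      · refine (abs_add_le _ _).trans ?_
        rw [abs_mul, abs_mul, mul_add]
        have i0 : |S.M k m x 1 0 - S.M k m y 1 0| ≤ B' * q := w0.trans <|
          (mul_le_mul_of_nonneg_left he1 (by linarith)).trans
          (mul_le_mul_of_nonneg_right (by linarith) hq0)
        have i1 : |S.M k m x 1 1 - S.M k m y 1 1| ≤ B' * q := w1.trans <|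
          (mul_le_mul_of_nonneg_left he1 (by linarith)).trans
          (mul_le_mul_of_nonneg_right (by linarith) hq0)
        exact add_le_add (mul_le_mul_of_nonneg_right i0 (abs_nonneg _))
          (mul_le_mul_of_nonneg_right i1 (abs_nonneg _))
    have hB0 : 0 ≤ B := by positivity
    have hB'0 : 0 ≤ B' := by positivity
    calc _ ≤ (C1 * s) * (B * (|v - v'| + |t - t'|) + B' * q * (|v| + |t|)) :=
          mul_le_mul h1 key (abs_nonneg _) (by positivity)
      _ = C1 * (B * (s * (|v - v'| + |t - t'|)) + B' * q * (s * (|v| + |t|))) := by ring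
      _ ≤ C1 * (B * (C3 * (q * (1 + S.rr (k * S.N + m)))) + B' * q * C2) := by
          have q4 : s * (|v - v'| + |t - t'|) ≤ C3 * (q * (1 + S.rr (k * S.N + m))) :=
            q3.trans (by gcongr)
          have i1 := mul_le_mul_of_nonneg_left q4 hB0
          have i2 := mul_le_mul_of_nonneg_left q2 (mul_nonneg hB'0 hq0)
          exact mul_le_mul_of_nonneg_left (add_le_add i1 i2) hC1.le
      _ ≤ C1 * (B * (C3 * (q * (1 + S.rr (k * S.N + m)))) + B' * (q * (1 + S.rr (k * S.N + m))) * C2) := by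
          gcongr
          nlinarith
      _ = _ := by ring
  · intro n
    obtain ⟨L, hL, h⟩ := S.p_lip n Rd
    refine ⟨√(S.a n) * L, ?_⟩
    rintro ⟨x, y⟩ ⟨hx, hy⟩
    simp only at hx hy ⊢
    have hrn := S.rr_nonneg n
    refine div_le_of_le_mul₀ (by positivity) (by positivity) ?_
    have h1 := h x hx y hy
    calc √(S.a n) * |S.p n x - S.p n y| ≤ √(S.a n) * (L * |x - y|) := by gcongr
      _ = √(S.a n) * L * (|x - y| * 1) := by ring
      _ ≤ √(S.a n) * L * (|x - y| * (1 + S.rr n)) := by gcongr; linarith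

end Setup

namespace Setup
variable (S : Setup)

lemma KK_diff (Rd : ℝ) : ∃ C : ℝ, 0 < C ∧ ∀ n m, n ≤ m → ∀ x, |x| ≤ Rd → ∀ y, |y| ≤ Rd →
    |S.KK m x y - S.KK n x y| ≤ C * (S.rr m - S.rr n) := by
  obtain ⟨B, hB, h⟩ := S.bound_p Rd
  obtain ⟨c, C0, hc, -, hα⟩ := S.α_bounds
  refine ⟨B * B / c, by positivity, fun n m hnm x hx y hy => ?_⟩
  have hterm : ∀ j, |S.p j x * S.p j y| ≤ B * B / c * (S.α (j : ℤ) / S.a j) := by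
    intro j
    have ha := S.ha j
    have h3 := mul_le_mul (h j x hx) (h j y hy) (by positivity) hB.le
    have h4 : √(S.a j) * |S.p j x| * (√(S.a j) * |S.p j y|) = S.a j * |S.p j x * S.p j y| := by
      rw [abs_mul]
      linear_combination (|S.p j x| * |S.p j y|) * Real.mul_self_sqrt ha.le
    rw [h4] at h3
    rw [div_mul_div_comm, le_div_iff₀ (by positivity)]
    have h5 := (hα j).1
    have := abs_nonneg (S.p j x * S.p j y)
    calc _ = c * (S.a j * |S.p j x * S.p j y|) := by ring
      _ ≤ c * (B * B) := by gcongr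
      _ ≤ _ := by rw [mul_comm]; gcongr
  induction m, hnm using Nat.le_induction with
  | base => simp
  | succ m hm ih =>
    rw [KK_succ, rr_succ]
    calc _ = |(S.KK m x y - S.KK n x y) + S.p m x * S.p m y| := by ring_nf
      _ ≤ _ := abs_add_le _ _
      _ ≤ _ := add_le_add ih (hterm m)
      _ = _ := by ring

lemma KK_bound (Rd : ℝ) : ∃ C : ℝ, 0 < C ∧ ∀ m, ∀ x, |x| ≤ Rd → ∀ y, |y| ≤ Rd →
    |S.KK m x y| ≤ C * S.rr m := by
  obtain ⟨C, hC, h⟩ := S.KK_diff Rd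
  refine ⟨C, hC, fun m x hx y hy => ?_⟩
  have := h 0 m (Nat.zero_le _) x hx y hy
  simpa [KK, rr] using this

lemma KK_lip (Rd : ℝ) : ∃ C : ℝ, 0 < C ∧ ∀ m, ∀ x, |x| ≤ Rd → ∀ x', |x'| ≤ Rd → ∀ y, |y| ≤ Rd →
    |S.KK m x y - S.KK m x' y| ≤ C * (|x - x'| * (1 + S.rr m) * S.rr m) := by
  obtain ⟨B, hB, h⟩ := S.bound_p Rd
  obtain ⟨L, hL, hl⟩ := S.lip_p Rd
  obtain ⟨c, C0, hc, -, hα⟩ := S.α_bounds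
  refine ⟨L * B / c, by positivity, fun m x hx x' hx' y hy => ?_⟩
  have hr := S.rr_nonneg m
  have hterm : ∀ j < m, |(S.p j x - S.p j x') * S.p j y| ≤
      L * B / c * (|x - x'| * (1 + S.rr m)) * (S.α (j : ℤ) / S.a j) := by
    intro j hj
    have ha := S.ha j
    have hrj : S.rr j ≤ S.rr m := S.rr_mono hj.le
    have hrj0 := S.rr_nonneg j
    have h3 := mul_le_mul (hl j x hx x' hx') (h j y hy) (by positivity) (by positivity)
    have h4 : √(S.a j) * |S.p j x - S.p j x'| * (√(S.a j) * |S.p j y|) =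
        S.a j * |(S.p j x - S.p j x') * S.p j y| := by
      rw [abs_mul]
      linear_combination (|S.p j x - S.p j x'| * |S.p j y|) * Real.mul_self_sqrt ha.le
    rw [h4] at h3
    have h6 : S.a j * |(S.p j x - S.p j x') * S.p j y| ≤ L * (|x - x'| * (1 + S.rr m)) * B :=
      h3.trans (by gcongr)
    rw [div_mul_eq_mul_div, div_mul_div_comm, le_div_iff₀ (by positivity)]
    have h5 := (hα j).1
    calc _ = c * (S.a j * |(S.p j x - S.p j x') * S.p j y|) := by ring
      _ ≤ c * (L * (|x - x'| * (1 + S.rr m)) * B) := by gcongr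
      _ ≤ S.α j * (L * (|x - x'| * (1 + S.rr m)) * B) := by gcongr
      _ = _ := by ring
  have e : S.KK m x y - S.KK m x' y = ∑ j ∈ Finset.range m, (S.p j x - S.p j x') * S.p j y := by
    unfold KK
    rw [← Finset.sum_sub_distrib]
    exact Finset.sum_congr rfl fun j _ => by ring
  rw [e]
  refine (Finset.abs_sum_le_sum_abs _ _).trans
    ((Finset.sum_le_sum fun j hj => hterm j (Finset.mem_range.1 hj)).trans_eq ?_)
  rw [← Finset.mul_sum]
  change _ * S.rr m = _
  ring

lemma CD (m : ℕ) (x y : ℝ) : (x - y) * S.KK (m + 1) x y =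
    S.a m * (S.p (m + 1) x * S.p m y - S.p m x * S.p (m + 1) y) := by
  induction m with
  | zero =>
    have := (S.ha 0).ne'
    simp only [KK, p, opoly, zero_add, Finset.sum_range_one]
    field_simp
    ring
  | succ m ih =>
    rw [KK_succ, mul_add, ih]
    have := (S.ha (m+1)).ne'
    rw [show S.p (m + 1 + 1) x = ((x - S.b (m + 1)) * S.p (m + 1) x - S.a m * S.p m x) / S.a (m + 1)
      from S.p_rec m x, show S.p (m + 1 + 1) y =
        ((y - S.b (m + 1)) * S.p (m + 1) y - S.a m * S.p m y) / S.a (m + 1) from S.p_rec m y]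
    field_simp
    ring

lemma f_tendsto : Tendsto S.f atTop (𝓝 0) := by
  have := S.f_ratio.mul S.he0
  rw [mul_zero] at this
  exact this.congr fun j => div_mul_cancel₀ _ (S.he j).ne'

lemma rr_gap (m : ℕ) : S.rr m - S.rr (m / S.N * S.N) ≤ S.f (m / S.N) := by
  have h : m ≤ (m / S.N + 1) * S.N := by
    rw [Nat.add_mul, one_mul, mul_comm]; exact (Nat.lt_mul_div_succ m S.hN).le.trans_eq (by ring)
  have h1 := S.rr_mono h
  rw [S.rr_block (m / S.N + 1), Finset.sum_range_succ, ← S.rr_block] at h1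
  linarith

lemma rr_gap0 (m : ℕ) : 0 ≤ S.rr m - S.rr (m / S.N * S.N) :=
  sub_nonneg.2 (S.rr_mono (Nat.div_mul_le_self _ _))

lemma tendsto_div : Tendsto (fun m : ℕ => m / S.N) atTop atTop := by
  refine tendsto_atTop.2 fun b => ?_
  filter_upwards [eventually_ge_atTop (b * S.N)] with m hm
  exact (Nat.le_div_iff_mul_le S.hN).2 hm

lemma gap_tendsto : Tendsto (fun m : ℕ => S.rr m - S.rr (m / S.N * S.N)) atTop (𝓝 0) :=
  squeeze_zero S.rr_gap0 S.rr_gap (S.f_tendsto.comp S.tendsto_div)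

end Setup

lemma sinc_mul (θ ξ : ℝ) (hξ : ξ ≠ 0) : Real.sin (θ * ξ) / ξ = θ * Real.sinc (θ * ξ) := by
  by_cases h : θ = 0
  · simp [h]
  · rw [Real.sinc_of_ne_zero (mul_ne_zero h hξ)]; field_simp

lemma ev_ball {ι : Type*} {l : Filter ι} {x1 : ι → ℝ} {x : ℝ} (h : Tendsto x1 l (𝓝 x)) :
    ∀ᶠ i in l, |x1 i| ≤ |x| + 1 := h.eventually (Dyn.nhds_ball x)

namespace Setup
variable (S : Setup)

lemma kernel0 : ∃ (κ : ℝ → ℝ) (θ : ℝ), Continuous κ ∧ |θ| = tauC S.α S.β S.N ∧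
    (θ = 0 → ∀ x, κ x = 0) ∧ 
    ∀ (ι : Type) (l : Filter ι) (m : ι → ℕ) (x1 x2 : ι → ℝ) (x ξ : ℝ), Tendsto m l atTop →
      Tendsto x1 l (𝓝 x) → Tendsto x2 l (𝓝 x) →
      Tendsto (fun i => (x1 i - x2 i) * S.rr (m i)) l (𝓝 ξ) →
      Tendsto (fun i => S.KK (m i) (x1 i) (x2 i) / S.rr (m i)) l (𝓝 (κ x * Real.sinc (θ * ξ))) := by
  obtain ⟨D, hDe, hDA, hv1, hv2, ht0, ht1⟩ := S.exists_dyn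
  have hsig : D.sig = S.sg := by funext k; unfold Dyn.sig sg; rw [hDe]
  have hN : (0:ℝ) < S.N := Nat.cast_pos.2 S.hN
  have hom := D.om0_pos
  refine ⟨fun x => D.g x * (D.th / S.N) / (D.R0 * D.om0), D.th / S.N, ?_, ?_, ?_, ?_⟩
  · have := D.g_cont
    fun_prop
  · have hd : (frakX0 S.α S.β S.N 0).det = 1 := S.det_XN 0
    have : -discr (frakX0 S.α S.β S.N 0) = (2 * D.om0) ^ 2 := by
      unfold discr
      rw [hd, ← ht0, mul_pow, pow_two D.om0, D.om0_sq]
      ring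
    rw [tauC, this, Real.sqrt_sq (by positivity), ← ht1, Dyn.th, abs_div, abs_div, abs_neg,
      abs_of_pos hN, abs_of_pos (show 0 < 2 * D.om0 by positivity), div_div]
    ring
  · intro h x
    simp [h]
  have key : ∀ (ι : Type) (l : Filter ι) (m : ι → ℕ) (x1 x2 : ι → ℝ) (x ξ : ℝ), Tendsto m l atTop →
      Tendsto x1 l (𝓝 x) → Tendsto x2 l (𝓝 x) →
      Tendsto (fun i => (x1 i - x2 i) * S.rr (m i)) l (𝓝 ξ) →
      Tendsto (fun i => (x1 i - x2 i) * S.KK (m i) (x1 i) (x2 i)) l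
        (𝓝 (D.g x * Real.sin (D.th / S.N * ξ) / (D.R0 * D.om0))) := by
    intro ι l m x1 x2 x ξ hm h1 h2 hξ
    have hk : Tendsto (fun i => m i / S.N) l atTop := S.tendsto_div.comp hm
    have h12 : Tendsto (fun i => x1 i - x2 i) l (𝓝 0) := by simpa using h1.sub h2
    have hgap := S.gap_tendsto.comp hm
    have hξ1 : Tendsto (fun i => (x1 i - x2 i) * S.rr (m i / S.N * S.N)) l (𝓝 ξ) := by
      have := hξ.sub (h12.mul hgap)
      simp only [mul_zero, sub_zero] at this
      exact this.congr fun i => by simp only [Function.comp]; ring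
    have hξ2 : Tendsto (fun i => (x1 i - x2 i) * D.sig (m i / S.N)) l (𝓝 (ξ / S.N)) := by
      have h3 := hξ1.div (S.rr_ratio.comp hk) hN.ne'
      refine h3.congr' ?_
      filter_upwards [hk.eventually (S.sg_tendsto.eventually (eventually_gt_atTop 0))] with i hi
      have : 0 < S.rr (m i / S.N * S.N) := hi.trans_le (S.sg_le_rr _)
      rw [hsig]
      simp only [Function.comp, Pi.div_apply]
      field_simp
    have hW := D.wronskian (hsig ▸ S.sg_tendsto) hk h1 h2 hξ2
    rw [show D.th * (ξ / S.N) = D.th / S.N * ξ by ring] at hW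
    obtain ⟨C, hC, hdiff⟩ := S.KK_diff (|x| + 1)
    have hz : Tendsto (fun i => (x1 i - x2 i) * (S.KK (m i) (x1 i) (x2 i) -
        S.KK (m i / S.N * S.N) (x1 i) (x2 i))) l (𝓝 0) := by
      have hz' : Tendsto (fun i => |x1 i - x2 i| * (C * (S.rr (m i) - S.rr (m i / S.N * S.N)))) l
          (𝓝 0) := by
        have := h12.abs.mul (hgap.const_mul C)
        simpa using this
      refine squeeze_zero_norm' ?_ hz'
      filter_upwards [ev_ball h1, ev_ball h2] with i hi1 hi2
      rw [norm_mul]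
      exact mul_le_mul_of_nonneg_left (hdiff _ _ (Nat.div_mul_le_self _ _) _ hi1 _ hi2)
        (norm_nonneg _)
    have hs := hW.add hz
    rw [add_zero] at hs
    refine hs.congr' ?_
    filter_upwards [hk.eventually (eventually_ge_atTop 1)] with i hi
    rw [hDA, hv1, hv2, hv1, hv2]
    have h5 : 1 ≤ m i / S.N * S.N := by nlinarith [S.hN]
    have := S.CD (m i / S.N * S.N - 1) (x1 i) (x2 i)
    rw [Nat.sub_add_cancel h5] at this
    linarith
  have keyne : ∀ (ι : Type) (l : Filter ι) (m : ι → ℕ) (x1 x2 : ι → ℝ) (x ξ : ℝ), ξ ≠ 0 → Tendsto m l atTop →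
      Tendsto x1 l (𝓝 x) → Tendsto x2 l (𝓝 x) →
      Tendsto (fun i => (x1 i - x2 i) * S.rr (m i)) l (𝓝 ξ) →
      Tendsto (fun i => S.KK (m i) (x1 i) (x2 i) / S.rr (m i)) l
        (𝓝 (D.g x * (D.th / S.N) / (D.R0 * D.om0) * Real.sinc (D.th / S.N * ξ))) := by
    intro ι l m x1 x2 x ξ hne hm h1 h2 hξ
    have h3 := (key ι l m x1 x2 x ξ hm h1 h2 hξ).div hξ hne
    have e : D.g x * Real.sin (D.th / S.N * ξ) / (D.R0 * D.om0) / ξ =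
        D.g x * (D.th / S.N) / (D.R0 * D.om0) * Real.sinc (D.th / S.N * ξ) := by
      have := sinc_mul (D.th / S.N) ξ hne
      rw [show D.g x * (D.th / S.N) / (D.R0 * D.om0) * Real.sinc (D.th / S.N * ξ) =
        D.g x / (D.R0 * D.om0) * (D.th / S.N * Real.sinc (D.th / S.N * ξ)) by ring, ← this]
      ring
    rw [e] at h3
    refine h3.congr' ?_
    filter_upwards [hξ.eventually_ne hne] with i hi
    have : x1 i - x2 i ≠ 0 := left_ne_zero_of_mul hi
    simp only [Pi.div_apply]
    exact mul_div_mul_left _ _ this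
  intro ι l m x1 x2 x ξ hm h1 h2 hξ
  by_cases hne : ξ = 0
  swap
  · exact keyne ι l m x1 x2 x ξ hne hm h1 h2 hξ
  subst hne
  set κ := D.g x * (D.th / S.N) / (D.R0 * D.om0) with hκ
  obtain ⟨C, hC, hlip⟩ := S.KK_lip (|x| + 1)
  rw [Metric.tendsto_nhds]
  intro ε hε
  have hcont : Tendsto (fun h : ℝ => |κ * Real.sinc (D.th / S.N * h) - κ * Real.sinc (D.th / S.N * 0)|
      + 2 * C * |h|) (𝓝[≠] 0) (𝓝 0) := by
    have hc : Continuous (fun h : ℝ => |κ * Real.sinc (D.th / S.N * h) -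
      κ * Real.sinc (D.th / S.N * 0)| + 2 * C * |h|) := by
      have := continuous_sinc
      fun_prop
    have := hc.tendsto 0
    simp only [sub_self, abs_zero, mul_zero, add_zero] at this
    refine Tendsto.mono_left ?_ nhdsWithin_le_nhds
    simpa using this
  obtain ⟨h, hh, hh0⟩ := ((hcont.eventually (gt_mem_nhds hε)).and self_mem_nhdsWithin).exists
  have hh0 : h ≠ 0 := hh0
  have hrr := S.rr_tendsto.comp hm
  have hsm : Tendsto (fun i => h / S.rr (m i)) l (𝓝 0) := hrr.const_div_atTop h
  have h1' : Tendsto (fun i => x1 i + h / S.rr (m i)) l (𝓝 x) := by simpa using h1.add hsm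
  have hξ' : Tendsto (fun i => (x1 i + h / S.rr (m i) - x2 i) * S.rr (m i)) l (𝓝 h) := by
    have := hξ.add_const h
    rw [zero_add] at this
    refine this.congr' ?_
    filter_upwards [hrr.eventually (eventually_gt_atTop 0)] with i hi
    simp only [Function.comp] at hi
    field_simp
    ring
  have hlim := keyne ι l m _ x2 x h hh0 hm h1' h2 hξ'
  set d := |κ * Real.sinc (D.th / S.N * h) - κ * Real.sinc (D.th / S.N * 0)| with hd
  have hpos : 0 < ε - (d + 2 * C * |h|) := by linarith
  filter_upwards [ev_ball h1, ev_ball h1', ev_ball h2, hrr.eventually (eventually_ge_atTop 1),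
    (Metric.tendsto_nhds.1 hlim) _ hpos] with i b1 b1' b2 hr hcl
  simp only [Function.comp] at hr
  rw [Real.dist_eq] at hcl ⊢
  have hL := hlip (m i) _ b1 _ b1' _ b2
  have hr0 : 0 < S.rr (m i) := by linarith
  have hL2 : |S.KK (m i) (x1 i) (x2 i) / S.rr (m i) - S.KK (m i) (x1 i + h / S.rr (m i)) (x2 i) / S.rr (m i)|
      ≤ 2 * C * |h| := by
    rw [← sub_div, abs_div, abs_of_pos hr0, div_le_iff₀ hr0]
    refine hL.trans ?_
    rw [show x1 i - (x1 i + h / S.rr (m i)) = - (h / S.rr (m i)) by ring, abs_neg, abs_div,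
      abs_of_pos hr0]
    have : |h| / S.rr (m i) * (1 + S.rr (m i)) ≤ 2 * |h| := by
      rw [div_mul_eq_mul_div, div_le_iff₀ hr0]
      nlinarith [abs_nonneg h]
    calc _ ≤ C * (2 * |h| * S.rr (m i)) := by gcongr
      _ = _ := by ring
  have t1 := abs_sub_le (S.KK (m i) (x1 i) (x2 i) / S.rr (m i))
    (S.KK (m i) (x1 i + h / S.rr (m i)) (x2 i) / S.rr (m i)) (κ * Real.sinc (D.th / S.N * 0))
  have t2 := abs_sub_le (S.KK (m i) (x1 i + h / S.rr (m i)) (x2 i) / S.rr (m i))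
    (κ * Real.sinc (D.th / S.N * h)) (κ * Real.sinc (D.th / S.N * 0))
  linarith

lemma KK_mono (x : ℝ) : Monotone fun m => S.KK m x x := monotone_nat_of_le_succ fun n => by
  rw [KK_succ]; nlinarith [mul_self_nonneg (S.p n x)]

lemma lower_pair (x : ℝ) : ∃ c : ℝ, 0 < c ∧ ∀ᶠ k in atTop,
    c * S.e k ≤ S.p (k * S.N - 1) x * S.p (k * S.N - 1) x + S.p (k * S.N) x * S.p (k * S.N) x := by
  obtain ⟨D, hDe, hDA, hv1, hv2, ht0, ht1⟩ := S.exists_dyn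
  obtain ⟨c, hc, h⟩ := D.lower_v x
  have hr := S.tend_ratio 0
  set L := S.α (((0 : ℕ) : ℤ) - 1) / S.α ((0 : ℕ) : ℤ) with hL
  have hLpos : 0 < L := div_pos (S.hα _) (S.hα _)
  have h0 := S.hα 0
  refine ⟨c * c / (2 * (2 * L) * S.α 0), by positivity, ?_⟩
  filter_upwards [h, hr.eventually (gt_mem_nhds (show L < 2 * L by linarith))] with k hk hk2
  rw [hDA, hv1, hv2] at hk
  have a1 := S.ha (k * S.N)
  have a2 := S.ha (k * S.N - 1)
  rw [Nat.add_zero, div_lt_iff₀ a1] at hk2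
  have h2 := mul_le_mul hk hk hc.le (hc.le.trans hk)
  set u := |S.p (k * S.N - 1) x|
  set v := |S.p (k * S.N) x|
  rw [show S.p (k * S.N - 1) x * S.p (k * S.N - 1) x = u * u from (abs_mul_abs_self _).symm,
    show S.p (k * S.N) x * S.p (k * S.N) x = v * v from (abs_mul_abs_self _).symm]
  have h3 : √(S.a (k * S.N - 1)) * (u + v) * (√(S.a (k * S.N - 1)) * (u + v)) =
      S.a (k * S.N - 1) * ((u + v) * (u + v)) := by
    linear_combination ((u+v)*(u+v)) * Real.mul_self_sqrt a2.le
  rw [h3] at h2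
  have h4 : (u + v) * (u + v) ≤ 2 * (u * u + v * v) := by nlinarith [mul_self_nonneg (u - v)]
  have h5 : c * c ≤ (2 * L * S.a (k * S.N)) * (2 * (u * u + v * v)) :=
    h2.trans (mul_le_mul hk2.le h4 (mul_self_nonneg _) (by positivity))
  unfold e
  rw [div_mul_div_comm, div_le_iff₀ (by positivity)]
  calc _ = S.α 0 * (c * c) := by ring
    _ ≤ S.α 0 * ((2 * L * S.a (k * S.N)) * (2 * (u * u + v * v))) := by gcongr
    _ = _ := by ring

lemma lower_KK (x : ℝ) : ∃ c K : ℝ, 0 < c ∧ ∀ᶠ k in atTop, c * S.sg k - K ≤ S.KK (k * S.N) x x := by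
  obtain ⟨c, hc, h⟩ := S.lower_pair x
  obtain ⟨k0, hk0⟩ := eventually_atTop.1 h
  obtain ⟨C, hC, hdiff⟩ := S.KK_diff |x|
  obtain ⟨Ca, hCa⟩ := S.term_tendsto.bddAbove_range
  set T : ℕ → ℝ := fun k => S.KK (k * S.N + 1) x x + S.KK (k * S.N) x x with hT
  have hstep : ∀ k, T k + (S.p ((k+1) * S.N - 1) x * S.p ((k+1) * S.N - 1) x +
      S.p ((k+1) * S.N) x * S.p ((k+1) * S.N) x) ≤ T (k+1) := by
    intro k
    have hN := S.hN
    have e1 : (k + 1) * S.N = ((k+1) * S.N - 1) + 1 := by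
      have : 0 < (k+1) * S.N := by positivity
      omega
    have h1 := S.KK_succ ((k+1) * S.N) x x
    have h2 := S.KK_succ ((k+1) * S.N - 1) x x
    rw [← e1] at h2
    have e2 : (k + 1) * S.N = k * S.N + S.N := by ring
    have m1 := S.KK_mono x (show k * S.N + 1 ≤ (k+1) * S.N by omega)
    have m2 := S.KK_mono x (show k * S.N ≤ (k+1) * S.N - 1 by omega)
    simp only at m1 m2
    simp only [hT]
    linarith
  have hind : ∀ k, k0 ≤ k → c * S.sg (k + 1) - c * S.sg (k0 + 1) ≤ T k := by
    intro k hk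
    induction k, hk using Nat.le_induction with
    | base =>
      have : 0 ≤ T k0 := by
        have m1 := S.KK_mono x (Nat.zero_le (k0 * S.N + 1))
        have m2 := S.KK_mono x (Nat.zero_le (k0 * S.N))
        simp only [KK, Finset.range_zero, Finset.sum_empty] at m1 m2
        exact add_nonneg m1 m2
      linarith
    | succ k hk ih =>
      have := hk0 (k+1) (by omega)
      have h3 := hstep k
      rw [show S.sg (k + 1 + 1) = S.sg (k+1) + S.e (k+1) from Finset.sum_range_succ _ _]
      linarith
  refine ⟨c / 2, (c * S.sg (k0 + 1) + C * Ca) / 2, by positivity, ?_⟩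
  filter_upwards [eventually_ge_atTop k0] with k hk
  have h1 := hind k hk
  have h2 := (abs_le.1 (hdiff (k * S.N) (k * S.N + 1) (by omega) x le_rfl x le_rfl)).2
  rw [rr_succ] at h2
  have h3 : S.α ((k * S.N : ℕ) : ℤ) / S.a (k * S.N) ≤ Ca := hCa ⟨k * S.N, rfl⟩
  have h4 : C * (S.α ((k * S.N : ℕ) : ℤ) / S.a (k * S.N)) ≤ C * Ca := by gcongr
  have h5 : S.sg k ≤ S.sg (k + 1) := by
    rw [show S.sg (k + 1) = S.sg k + S.e k from Finset.sum_range_succ _ _]; linarith [S.he' k]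
  have h6 : c * S.sg k ≤ c * S.sg (k + 1) := by gcongr
  simp only [hT] at h1
  rw [add_sub_cancel_left] at h2
  linarith

/-- scaling limits of the kernel -/
theorem kernel : ∃ (κ : ℝ → ℝ), Continuous κ ∧ 0 < tauC S.α S.β S.N ∧ (∀ x, 0 < κ x) ∧
    ∀ (ι : Type) (l : Filter ι) (m : ι → ℕ) (x1 x2 : ι → ℝ) (x ξ : ℝ), Tendsto m l atTop →
      Tendsto x1 l (𝓝 x) → Tendsto x2 l (𝓝 x) →
      Tendsto (fun i => (x1 i - x2 i) * S.rr (m i)) l (𝓝 ξ) →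
      Tendsto (fun i => S.KK (m i) (x1 i) (x2 i) / S.rr (m i)) l
        (𝓝 (κ x * Real.sinc (tauC S.α S.β S.N * ξ))) := by
  obtain ⟨κ, θ, hκ, hθ, hz, H⟩ := S.kernel0
  have hpos : ∀ x, 0 < κ x := by
    intro x
    obtain ⟨c, K, hc, h⟩ := S.lower_KK x
    have h1 := H ℕ atTop (fun k => k * S.N) (fun _ => x) (fun _ => x) x 0 (S.tendsto_block 0)
      tendsto_const_nhds tendsto_const_nhds (by simp)
    simp only [mul_zero, sinc_zero, mul_one] at h1
    have hN : (0:ℝ) < S.N := Nat.cast_pos.2 S.hN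
    have hrr : Tendsto (fun k => S.rr (k * S.N)) atTop atTop := S.rr_tendsto.comp (S.tendsto_block 0)
    have h2 : Tendsto (fun k => c * (S.rr (k * S.N) / S.sg k)⁻¹ - K / S.rr (k * S.N)) atTop
        (𝓝 (c * (S.N : ℝ)⁻¹ - 0)) :=
      ((S.rr_ratio.inv₀ hN.ne').const_mul c).sub (hrr.const_div_atTop K)
    have h3 := le_of_tendsto_of_tendsto h2 h1 (by
      filter_upwards [h, hrr.eventually (eventually_gt_atTop 0)] with k hk hk2
      rw [inv_div, ← mul_div_assoc, ← sub_div]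
      exact div_le_div_of_nonneg_right hk hk2.le)
    have : 0 < c * (S.N : ℝ)⁻¹ := by positivity
    linarith
  refine ⟨κ, hκ, ?_, hpos, ?_⟩
  · rw [← hθ, abs_pos]
    intro h
    exact (hpos 0).ne' (hz h 0)
  · intro ι l m x1 x2 x ξ hm h1 h2 hξ
    have := H ι l m x1 x2 x ξ hm h1 h2 hξ
    rw [← hθ]
    have e : Real.sinc (|θ| * ξ) = Real.sinc (θ * ξ) := by
      rcases abs_choice θ with h | h <;> rw [h]
      rw [neg_mul, sinc_neg]
    rwa [e]

end Setup


lemma abs_sin_sub_le (h : ℝ) : |Real.sin h - h| ≤ 2 * h ^ 2 := by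
  have key : ∀ h : ℝ, 0 ≤ h → |Real.sin h - h| ≤ 2 * h ^ 2 := by
    intro h hh
    have h1 := Real.sin_le hh
    rw [abs_sub_comm, abs_of_nonneg (by linarith)]
    rcases hh.eq_or_lt with h0 | h0
    · simp [← h0]
    by_cases h2 : h ≤ 1
    · have := Real.sin_gt_sub_cube h0
      nlinarith [pow_nonneg hh 2]
    · have := Real.neg_one_le_sin h
      push Not at h2
      nlinarith
  rcases le_total 0 h with hh | hh
  · exact key h hh
  · have := key (-h) (by linarith)
    rw [Real.sin_neg, ← abs_neg] at this
    rw [neg_sq] at this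
    convert this using 2
    ring

lemma cos_taylor (a h : ℝ) : |Real.cos a - Real.cos (a + h) - h * Real.sin a| ≤ 3 * h ^ 2 := by
  have e : Real.cos a - Real.cos (a + h) - h * Real.sin a =
      Real.cos a * (1 - Real.cos h) + Real.sin a * (Real.sin h - h) := by
    rw [Real.cos_add]; ring
  rw [e]
  have h1 : |1 - Real.cos h| ≤ h ^ 2 := by
    rw [abs_of_nonneg (by linarith [Real.cos_le_one h])]
    nlinarith [Real.one_sub_sq_div_two_le_cos (x := h), sq_nonneg h]
  refine (abs_add_le _ _).trans ?_
  rw [abs_mul, abs_mul]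
  have := mul_le_mul (Real.abs_cos_le_one a) h1 (abs_nonneg _) zero_le_one
  have := mul_le_mul (Real.abs_sin_le_one a) (abs_sin_sub_le h) (abs_nonneg _) zero_le_one
  linarith

namespace Setup
variable (S : Setup)

def dd (i : ℕ) : ℝ := S.α (i : ℤ) / S.a i
lemma dd_nonneg (i : ℕ) : 0 ≤ S.dd i := (S.term_pos i).le
lemma sum_dd (n : ℕ) : ∑ i ∈ Finset.range n, S.dd i = S.rr n := rfl
lemma rr_succ' (n : ℕ) : S.rr (n + 1) = S.rr n + S.dd n := S.rr_succ n

/-- Riemann sums -/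
lemma riemann {y : ℝ} (hy : y ≠ 0) : Tendsto (fun n => (∑ i ∈ Finset.range n,
    S.dd i * (S.rr i * Real.sinc (y * (S.rr i / S.rr n)))) / S.rr n ^ 2) atTop
    (𝓝 ((1 - Real.cos y) / y ^ 2)) := by
  have hl : Tendsto (fun n => (∑ j ∈ Finset.range n, S.dd j * S.dd j) / S.rr n) atTop (𝓝 0) :=
    Dyn.littleO_sum S.dd_nonneg S.term_tendsto S.rr_tendsto
  rw [tendsto_iff_norm_sub_tendsto_zero]
  have h0 : Tendsto (fun n => 3 * ((∑ j ∈ Finset.range n, S.dd j * S.dd j) / S.rr n * (S.rr n)⁻¹)) atTop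
      (𝓝 0) := by
    have := (hl.mul (tendsto_inv_atTop_zero.comp S.rr_tendsto)).const_mul 3
    simpa using this
  refine squeeze_zero' (Eventually.of_forall fun _ => norm_nonneg _) ?_ h0
  filter_upwards [S.rr_tendsto.eventually (eventually_gt_atTop 0)] with n hn
  set R := S.rr n with hR
  have tele : (1 - Real.cos y) = ∑ i ∈ Finset.range n,
      (Real.cos (y * (S.rr i / R)) - Real.cos (y * (S.rr (i + 1) / R))) := by
    rw [Finset.sum_range_sub', ← hR, div_self hn.ne']
    simp [rr]
  have e1 : ∀ i, y ^ 2 * (S.dd i * (S.rr i * Real.sinc (y * (S.rr i / R)))) =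
      R ^ 2 * (y * (S.dd i / R) * Real.sin (y * (S.rr i / R))) := by
    intro i
    by_cases h : S.rr i = 0
    · simp [h]
    · rw [Real.sinc_of_ne_zero (mul_ne_zero hy (div_ne_zero h hn.ne'))]
      field_simp
  have e2 : (∑ i ∈ Finset.range n, S.dd i * (S.rr i * Real.sinc (y * (S.rr i / R)))) / R ^ 2 -
      (1 - Real.cos y) / y ^ 2 = - (∑ i ∈ Finset.range n,
      (Real.cos (y * (S.rr i / R)) - Real.cos (y * (S.rr (i + 1) / R)) -
        y * (S.dd i / R) * Real.sin (y * (S.rr i / R)))) / y ^ 2 := by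
    rw [Finset.sum_sub_distrib, ← tele]
    have : (∑ i ∈ Finset.range n, S.dd i * (S.rr i * Real.sinc (y * (S.rr i / R)))) / R ^ 2 =
        (∑ i ∈ Finset.range n, y * (S.dd i / R) * Real.sin (y * (S.rr i / R))) / y ^ 2 := by
      rw [div_eq_div_iff (by positivity) (by positivity), mul_comm, Finset.mul_sum, mul_comm _ (R^2),
        Finset.mul_sum]
      exact Finset.sum_congr rfl fun i _ => e1 i
    rw [this]
    ring
  rw [e2, norm_div, norm_neg, Real.norm_eq_abs, Real.norm_eq_abs, abs_of_pos (show 0 < y ^ 2 by positivity),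
    div_le_iff₀ (by positivity)]
  refine (Finset.abs_sum_le_sum_abs _ _).trans ?_
  calc _ ≤ ∑ i ∈ Finset.range n, 3 * y ^ 2 / R ^ 2 * (S.dd i * S.dd i) := by
        refine Finset.sum_le_sum fun i _ => ?_
        have := cos_taylor (y * (S.rr i / R)) (y * (S.dd i / R))
        rw [rr_succ', show y * ((S.rr i + S.dd i) / R) = y * (S.rr i / R) + y * (S.dd i / R) by ring]
        refine this.trans_eq ?_
        field_simp
    _ = _ := by
        rw [← Finset.mul_sum]
        field_simp

def G (n : ℕ) (x t : ℝ) : ℝ := (∑ i ∈ Finset.range n, S.dd i * S.KK i x t) / S.rr n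

lemma G_bound (Rd : ℝ) : ∃ C : ℝ, 0 < C ∧ ∀ n, ∀ x, |x| ≤ Rd → ∀ t, |t| ≤ Rd →
    |S.G n x t| ≤ C * S.rr n := by
  obtain ⟨C, hC, h⟩ := S.KK_bound Rd
  refine ⟨C, hC, fun n x hx t ht => ?_⟩
  have hr := S.rr_nonneg n
  unfold G
  rw [abs_div, abs_of_nonneg hr]
  refine div_le_of_le_mul₀ hr (by positivity) ?_
  refine (Finset.abs_sum_le_sum_abs _ _).trans ?_
  calc _ ≤ ∑ i ∈ Finset.range n, S.dd i * (C * S.rr n) := by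
        refine Finset.sum_le_sum fun i hi => ?_
        rw [abs_mul, abs_of_nonneg (S.dd_nonneg i)]
        have h1 := S.rr_mono (Finset.mem_range.1 hi).le
        have h2 := h i x hx t ht
        have := S.dd_nonneg i
        gcongr
        exact h2.trans (by gcongr)
    _ = _ := by rw [← Finset.sum_mul, sum_dd]; ring

lemma c_KK (n : ℕ) : Continuous fun z : ℝ × ℝ => S.KK n z.1 z.2 := by
  unfold KK
  exact continuous_finsetSum _ fun j _ =>
    ((S.c_p j).comp continuous_fst).mul ((S.c_p j).comp continuous_snd)

lemma c_G (n : ℕ) : Continuous fun z : ℝ × ℝ => S.G n z.1 z.2 := by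
  unfold G
  exact (continuous_finsetSum _ fun j _ => (S.c_KK j).const_mul _).div_const _

lemma KK_lu {κ : ℝ → ℝ} {τ : ℝ}
    (H : ∀ (ι : Type) (l : Filter ι) (m : ι → ℕ) (x1 x2 : ι → ℝ) (x ξ : ℝ), Tendsto m l atTop →
      Tendsto x1 l (𝓝 x) → Tendsto x2 l (𝓝 x) →
      Tendsto (fun i => (x1 i - x2 i) * S.rr (m i)) l (𝓝 ξ) →
      Tendsto (fun i => S.KK (m i) (x1 i) (x2 i) / S.rr (m i)) l
        (𝓝 (κ x * Real.sinc (τ * ξ)))) (t : ℝ) :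
    TendstoLocallyUniformly (fun (i : ℕ) (ξ : ℝ) => S.KK i (t + ξ / S.rr i) t / S.rr i)
      (fun ξ => κ t * Real.sinc (τ * ξ)) atTop := by
  have hc : Continuous (fun ξ => κ t * Real.sinc (τ * ξ)) := by
    have := continuous_sinc
    fun_prop
  rw [tendstoLocallyUniformly_iff_forall_tendsto]
  intro ξ
  have hr : Tendsto (fun z : ℕ × ℝ => S.rr z.1) (atTop ×ˢ 𝓝 ξ) atTop := S.rr_tendsto.comp tendsto_fst
  have h1 := H (ℕ × ℝ) (atTop ×ˢ 𝓝 ξ) (fun z => z.1) (fun z => t + z.2 / S.rr z.1) (fun _ => t) t ξ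
    tendsto_fst (by
      have : Tendsto (fun z : ℕ × ℝ => z.2 / S.rr z.1) (atTop ×ˢ 𝓝 ξ) (𝓝 0) :=
        tendsto_snd.div_atTop hr
      simpa using this.const_add t) tendsto_const_nhds (by
      refine (tendsto_snd (f := (atTop : Filter ℕ)) (g := 𝓝 ξ)).congr' ?_
      filter_upwards [hr.eventually (eventually_gt_atTop 0)] with z hz
      field_simp
      ring)
  have h2 : Tendsto (fun z : ℕ × ℝ => κ t * Real.sinc (τ * z.2)) (atTop ×ˢ 𝓝 ξ)
      (𝓝 (κ t * Real.sinc (τ * ξ))) := (hc.tendsto ξ).comp tendsto_snd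
  have h3 := h2.prodMk_nhds h1
  exact h3.mono_right (nhds_le_uniformity _)

lemma G_lim {κ : ℝ → ℝ} {τ : ℝ} (hτ : τ ≠ 0)
    (H : ∀ (ι : Type) (l : Filter ι) (m : ι → ℕ) (x1 x2 : ι → ℝ) (x ξ : ℝ), Tendsto m l atTop →
      Tendsto x1 l (𝓝 x) → Tendsto x2 l (𝓝 x) →
      Tendsto (fun i => (x1 i - x2 i) * S.rr (m i)) l (𝓝 ξ) →
      Tendsto (fun i => S.KK (m i) (x1 i) (x2 i) / S.rr (m i)) l
        (𝓝 (κ x * Real.sinc (τ * ξ)))) (t u : ℝ) (hu : u ≠ 0) :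
    Tendsto (fun n => S.G n (t + u / S.rr n) t / S.rr n) atTop
      (𝓝 (κ t * ((1 - Real.cos (τ * u)) / (τ * u) ^ 2))) := by
  have hlu := (tendstoLocallyUniformlyOn_iff_tendstoUniformlyOn_of_compact
    (isCompact_Icc (a := -|u|) (b := |u|))).1 (S.KK_lu H t).tendstoLocallyUniformlyOn
  have hcs := continuous_sinc
  have hc : ∀ i, Continuous fun ξ => |S.KK i (t + ξ / S.rr i) t / S.rr i - κ t * Real.sinc (τ * ξ)| := by
    intro i
    have : Continuous fun ξ => S.KK i (t + ξ / S.rr i) t :=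
      (S.c_KK i).comp (by fun_prop : Continuous fun ξ : ℝ => (t + ξ / S.rr i, t))
    fun_prop
  have hmax : ∀ i, ∃ ξ ∈ Set.Icc (-|u|) |u|, IsMaxOn (fun ξ => |S.KK i (t + ξ / S.rr i) t / S.rr i -
      κ t * Real.sinc (τ * ξ)|) (Set.Icc (-|u|) |u|) ξ := fun i =>
    isCompact_Icc.exists_isMaxOn ⟨u, neg_abs_le u, le_abs_self u⟩ (hc i).continuousOn
  choose ξ hξ hm using hmax
  set δ : ℕ → ℝ := fun i => |S.KK i (t + ξ i / S.rr i) t / S.rr i - κ t * Real.sinc (τ * ξ i)| with hδdef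
  have hδ : Tendsto δ atTop (𝓝 0) := by
    rw [Metric.tendsto_nhds]
    intro ε hε
    filter_upwards [(Metric.tendstoUniformlyOn_iff.1 hlu) ε hε] with i hi
    have := hi (ξ i) (hξ i)
    rw [dist_comm, Real.dist_eq] at this
    rw [Real.dist_eq, sub_zero, abs_abs]
    exact this
  have hsm : Tendsto (fun n => (∑ j ∈ Finset.range n, δ j * S.dd j) / S.rr n) atTop (𝓝 0) :=
    Dyn.littleO_sum S.dd_nonneg hδ S.rr_tendsto
  have hrie := (S.riemann (mul_ne_zero hτ hu)).const_mul (κ t)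
  have hdiff : Tendsto (fun n => S.G n (t + u / S.rr n) t / S.rr n - κ t * ((∑ i ∈ Finset.range n,
    S.dd i * (S.rr i * Real.sinc (τ * u * (S.rr i / S.rr n)))) / S.rr n ^ 2)) atTop (𝓝 0) := by
    refine squeeze_zero_norm' ?_ hsm
    filter_upwards [S.rr_tendsto.eventually (eventually_gt_atTop 0)] with n hn
    set R := S.rr n with hR
    have e : S.G n (t + u / R) t / R - κ t * ((∑ i ∈ Finset.range n,
        S.dd i * (S.rr i * Real.sinc (τ * u * (S.rr i / R)))) / R ^ 2) =
        (∑ i ∈ Finset.range n, S.dd i * (S.KK i (t + u / R) t -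
          κ t * (S.rr i * Real.sinc (τ * u * (S.rr i / R))))) / R ^ 2 := by
      simp only [mul_sub, Finset.sum_sub_distrib]
      rw [G, ← hR, sub_div, div_div, pow_two, mul_div_assoc', Finset.mul_sum]
      congr 2
      exact Finset.sum_congr rfl fun i _ => by ring
    rw [e, norm_div, Real.norm_eq_abs, Real.norm_eq_abs, abs_of_pos (show 0 < R ^ 2 by positivity),
      div_le_iff₀ (by positivity)]
    refine (Finset.abs_sum_le_sum_abs _ _).trans ?_
    rw [show (∑ j ∈ Finset.range n, δ j * S.dd j) / R * R ^ 2 =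
      (∑ j ∈ Finset.range n, δ j * S.dd j) * R by field_simp, Finset.sum_mul]
    refine Finset.sum_le_sum fun i hi => ?_
    have hi' := S.rr_mono (Finset.mem_range.1 hi).le
    rw [abs_mul, abs_of_nonneg (S.dd_nonneg i)]
    have hd := S.dd_nonneg i
    have hri := S.rr_nonneg i
    have hbd : |S.KK i (t + u / R) t - κ t * (S.rr i * Real.sinc (τ * u * (S.rr i / R)))| ≤ δ i * S.rr i := by
      cases i with
      | zero => simp [rr, KK]
      | succ i =>
      have hri := S.rr_pos i
      set r := S.rr (i+1) with hr
      have hmem : u * r / R ∈ Set.Icc (-|u|) |u| := by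
        rw [Set.mem_Icc, ← abs_le, abs_div, abs_mul, abs_of_pos hri, abs_of_pos hn, div_le_iff₀ hn]
        exact mul_le_mul_of_nonneg_left hi' (abs_nonneg _)
      have h1 := hm (i+1) hmem
      simp only [Set.mem_setOf_eq, ← hr] at h1
      have e2 : S.KK (i+1) (t + u / R) t - κ t * (r * Real.sinc (τ * u * (r / R))) =
          (S.KK (i+1) (t + u * r / R / r) t / r - κ t * Real.sinc (τ * (u * r / R))) * r := by
        rw [show u * r / R / r = u / R by field_simp, show τ * (u * r / R) = τ * u * (r / R) by ring]
        field_simp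
      rw [e2, abs_mul, abs_of_pos hri]
      exact mul_le_mul_of_nonneg_right h1 hri.le
    have hδ0 : 0 ≤ δ i := abs_nonneg _
    calc _ ≤ S.dd i * (δ i * S.rr i) := by gcongr
      _ ≤ S.dd i * (δ i * R) := by gcongr
      _ = _ := by ring
  have := hdiff.add hrie
  rw [zero_add] at this
  exact this.congr fun n => by ring

end Setup


def fejer (y : ℝ) : ℝ := (1 - Real.cos y) / y ^ 2

lemma fejer_nonneg (y : ℝ) : 0 ≤ fejer y :=
  div_nonneg (by linarith [Real.cos_le_one y]) (sq_nonneg _)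

lemma fejer_meas : Measurable fejer := by
  unfold fejer; fun_prop

lemma fejer_le (y : ℝ) : fejer y ≤ 4 * (1 + y ^ 2)⁻¹ := by
  have h1 := Real.one_sub_sq_div_two_le_cos (x := y)
  have h2 := Real.neg_one_le_cos y
  unfold fejer
  by_cases hy : y = 0
  · simp [hy]
  have : 0 < y ^ 2 := by positivity
  rw [← div_eq_mul_inv, div_le_div_iff₀ this (by positivity)]
  have h0 := Real.cos_le_one y
  by_cases h : y ^ 2 ≤ 1
  · nlinarith
  · nlinarith

lemma fejer_int : Integrable fejer := by
  refine (integrable_inv_one_add_sq.const_mul 4).mono' fejer_meas.aestronglyMeasurable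
    (Eventually.of_forall fun y => ?_)
  rw [Real.norm_eq_abs, abs_of_nonneg (fejer_nonneg y)]
  exact fejer_le y

lemma inner1 {y : ℝ} (hy : 0 < y) : ∫⁻ t in Set.Ioi (0:ℝ), ENNReal.ofReal ((1 - Real.cos y) * (t * Real.exp (-(y * t))))
    = ENNReal.ofReal (fejer y) := by
  have h1 := Real.integral_rpow_mul_exp_neg_mul_Ioi (a := 2) two_pos hy
  have hG : Real.Gamma 2 = 1 := by
    simpa using Real.Gamma_nat_eq_factorial 1
  rw [hG, mul_one] at h1
  have h2 : ∫ t in Set.Ioi (0:ℝ), t * Real.exp (-(y * t)) = 1 / y ^ 2 := by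
    rw [show (1:ℝ) / y ^ 2 = (1 / y) ^ (2:ℝ) by norm_num, ← h1]
    refine setIntegral_congr_fun measurableSet_Ioi fun t ht => ?_
    norm_num
  have hi : Integrable (fun t => t * Real.exp (-(y * t))) (volume.restrict (Set.Ioi 0)) := by
    by_contra hc
    rw [integral_undef hc] at h2
    have : 0 < 1 / y ^ 2 := by positivity
    linarith
  rw [← ofReal_integral_eq_lintegral_ofReal (hi.const_mul _), integral_const_mul, h2]
  · unfold fejer; congr 1; ring
  · filter_upwards [ae_restrict_mem measurableSet_Ioi] with t ht
    have ht : 0 < t := ht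
    have := Real.cos_le_one y
    have := Real.exp_pos (-(y * t))
    simp only [Pi.zero_apply]
    exact mul_nonneg (by linarith) (by positivity)

lemma inner2 {t : ℝ} (ht : 0 < t) : ∫⁻ y in Set.Ioi (0:ℝ), ENNReal.ofReal ((1 - Real.cos y) * (t * Real.exp (-(y * t))))
    = ENNReal.ofReal ((1 + t ^ 2)⁻¹) := by
  set A : ℝ → ℝ := fun y => - Real.exp (-(y * t)) -
    t * (Real.exp (-(y * t)) * (-t * Real.cos y + Real.sin y)) / (1 + t ^ 2) with hA
  have h1 : 0 < 1 + t ^ 2 := by positivity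
  have hd : ∀ y ∈ Set.Ici (0:ℝ), HasDerivAt A ((1 - Real.cos y) * (t * Real.exp (-(y * t)))) y := by
    intro y _
    have e1 : HasDerivAt (fun y => Real.exp (-(y * t))) (Real.exp (-(y * t)) * (-(1 * t))) y :=
      ((hasDerivAt_id y).mul_const t).neg.exp
    have e2 : HasDerivAt (fun y => -t * Real.cos y + Real.sin y) (-t * (-Real.sin y) + Real.cos y) y :=
      ((Real.hasDerivAt_cos y).const_mul (-t)).add (Real.hasDerivAt_sin y)
    have e3 := e1.neg.sub (((e1.mul e2).const_mul t).div_const (1 + t ^ 2))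
    convert! e3 using 1
    field_simp
    ring
  have hexp : Tendsto (fun y => Real.exp (-(y * t))) atTop (𝓝 0) :=
    Real.tendsto_exp_neg_atTop_nhds_zero.comp (tendsto_id.atTop_mul_const ht)
  have hlim : Tendsto A atTop (𝓝 0) := by
    have hb : Tendsto (fun y => Real.exp (-(y * t)) * (-t * Real.cos y + Real.sin y)) atTop (𝓝 0) := by
      have h3 : Tendsto (fun y => Real.exp (-(y * t)) * (t + 1)) atTop (𝓝 0) := by
        simpa using hexp.mul_const (t + 1)
      refine squeeze_zero_norm (fun y => ?_) h3
      rw [norm_mul, Real.norm_eq_abs, Real.norm_eq_abs, abs_of_pos (Real.exp_pos _)]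
      refine mul_le_mul_of_nonneg_left ?_ (Real.exp_pos _).le
      refine (abs_add_le _ _).trans (add_le_add ?_ (Real.abs_sin_le_one y))
      rw [abs_mul, abs_neg, abs_of_pos ht]
      exact mul_le_of_le_one_right ht.le (Real.abs_cos_le_one y)
    have := hexp.neg.sub ((hb.const_mul t).div_const (1 + t ^ 2))
    simp only [neg_zero, mul_zero, zero_div, sub_zero] at this
    exact this
  have hpos : ∀ y ∈ Set.Ioi (0:ℝ), 0 ≤ (1 - Real.cos y) * (t * Real.exp (-(y * t))) := by
    intro y _
    have := Real.cos_le_one y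
    have := Real.exp_pos (-(y * t))
    exact mul_nonneg (by linarith) (by positivity)
  have hi := integrableOn_Ioi_deriv_of_nonneg' hd hpos hlim
  have hv := integral_Ioi_of_hasDerivAt_of_nonneg' hd hpos hlim
  rw [← ofReal_integral_eq_lintegral_ofReal hi, hv]
  · congr 1
    simp only [hA]
    simp
    field_simp
    ring
  · filter_upwards [ae_restrict_mem measurableSet_Ioi] with y hy
    exact hpos y hy

lemma fejer_Ioi : ∫⁻ y in Set.Ioi (0:ℝ), ENNReal.ofReal (fejer y) = ENNReal.ofReal (π / 2) := by
  have e1 : ∫⁻ y in Set.Ioi (0:ℝ), ENNReal.ofReal (fejer y) = ∫⁻ y in Set.Ioi (0:ℝ),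
      ∫⁻ t in Set.Ioi (0:ℝ), ENNReal.ofReal ((1 - Real.cos y) * (t * Real.exp (-(y * t)))) :=
    setLIntegral_congr_fun measurableSet_Ioi fun y hy => (inner1 hy).symm
  rw [e1, lintegral_lintegral_swap]
  · rw [setLIntegral_congr_fun measurableSet_Ioi fun t ht => inner2 ht,
      ← ofReal_integral_eq_lintegral_ofReal integrable_inv_one_add_sq.integrableOn]
    · rw [integral_Ioi_inv_one_add_sq]; simp
    · exact Eventually.of_forall fun t => by simp only [Pi.zero_apply]; positivity
  · refine Measurable.aemeasurable ?_
    apply Continuous.measurable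
    simp only [Function.uncurry_def]
    exact ENNReal.continuous_ofReal.comp (by fun_prop)

lemma fejer_total : ∫ y, fejer y = π := by
  have h1 : ∫ y in Set.Ioi (0:ℝ), fejer y = π / 2 := by
    rw [integral_eq_lintegral_of_nonneg_ae (Eventually.of_forall fejer_nonneg)
      fejer_meas.aestronglyMeasurable, fejer_Ioi, ENNReal.toReal_ofReal (by positivity)]
  have h2 := integral_comp_abs (f := fejer)
  have h3 : ∀ y, fejer |y| = fejer y := fun y => by unfold fejer; rw [Real.cos_abs, sq_abs]
  simp only [h3] at h2
  rw [h2, h1]; ring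

lemma fejer_scaled {τ : ℝ} (hτ : 0 < τ) :
    Tendsto (fun L : ℝ => ∫ u in (-L)..L, fejer (τ * u)) atTop (𝓝 (π / τ)) := by
  have hi : Integrable fun u => fejer (τ * u) := fejer_int.comp_mul_left' hτ.ne'
  have hv : ∫ u, fejer (τ * u) = π / τ := by
    rw [Measure.integral_comp_mul_left, fejer_total, abs_of_pos (by positivity), smul_eq_mul]
    field_simp
  rw [← hv]
  exact intervalIntegral_tendsto_integral hi tendsto_neg_atTop_atBot tendsto_id

namespace Setup
variable (S : Setup)

lemma G_exp (n : ℕ) (x t : ℝ) : S.G (n + 1) x t =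
    ∑ j ∈ Finset.range (n + 1), (1 - S.rr (j + 1) / S.rr (n + 1)) * (S.p j x * S.p j t) := by
  have key : ∀ n, ∑ i ∈ Finset.range n, S.dd i * S.KK i x t =
      ∑ j ∈ Finset.range n, (S.rr n - S.rr (j + 1)) * (S.p j x * S.p j t) := by
    intro n
    induction n with
    | zero => simp
    | succ n ih =>
      rw [Finset.sum_range_succ, ih, Finset.sum_range_succ _ n, sub_self, zero_mul, add_zero, KK,
        Finset.mul_sum, ← Finset.sum_add_distrib]
      refine Finset.sum_congr rfl fun j _ => ?_
      rw [S.rr_succ' n]; ring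
  unfold G
  rw [key, Finset.sum_div]
  have := (S.rr_pos n).ne'
  refine Finset.sum_congr rfl fun j _ => ?_
  field_simp

def gam (i : ℕ) : ℝ := S.dd (i + 1) * S.a i

lemma gam_bound : ∃ C : ℝ, 0 < C ∧ ∀ i, S.gam i ^ 2 ≤ C := by
  obtain ⟨c, C, hc, hC, hα⟩ := S.α_bounds
  obtain ⟨K, hK⟩ := S.hmod_r.bddAbove_range
  have hb : ∀ i : ℕ, |S.gam i| ≤ C * (|K| + C / c) := by
    intro i
    have h1 : |S.a i / S.a (i + 1) - S.α (i : ℤ) / S.α ((i : ℤ) + 1)| ≤ K := hK ⟨i, rfl⟩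
    have h2 : S.α (i : ℤ) / S.α ((i : ℤ) + 1) ≤ C / c := by
      have := (hα (i+1)).1
      push_cast at this
      exact div_le_div₀ hC.le (hα i).2 hc this
    have h3 : S.gam i = S.α ((i + 1 : ℕ) : ℤ) * (S.a i / S.a (i + 1)) := by
      unfold gam dd; ring
    have hp : 0 < S.a i / S.a (i + 1) := div_pos (S.ha _) (S.ha _)
    rw [h3, abs_of_pos (mul_pos (S.hα _) hp)]
    refine mul_le_mul (hα (i+1)).2 ?_ hp.le hC.le
    have := le_abs_self K
    have := (abs_le.1 h1).2
    linarith
  refine ⟨(C * (|K| + C / c)) ^ 2 + 1, by positivity, fun i => ?_⟩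
  rw [← sq_abs]
  have := pow_le_pow_left₀ (abs_nonneg _) (hb i) 2
  linarith

def F1 (n : ℕ) (x t : ℝ) : ℝ := ∑ i ∈ Finset.range n, (S.gam i * S.p (i + 1) x) * S.p i t
def F2 (n : ℕ) (x t : ℝ) : ℝ := ∑ i ∈ Finset.range n, (S.gam i * S.p i x) * S.p (i + 1) t

lemma G_mul (n : ℕ) (x t : ℝ) : (x - t) * S.G (n + 1) x t =
    (S.F1 n x t - S.F2 n x t) / S.rr (n + 1) := by
  unfold G F1 F2
  rw [mul_div_assoc', Finset.sum_range_succ', ← Finset.sum_sub_distrib, mul_add, Finset.mul_sum]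
  congr 1
  rw [show S.KK 0 x t = 0 by simp [KK], mul_zero, mul_zero, add_zero]
  refine Finset.sum_congr rfl fun i _ => ?_
  have := S.CD i x t
  unfold gam
  linear_combination (S.dd (i + 1)) * this

lemma G_sq (n : ℕ) (x t : ℝ) : (x - t) ^ 2 * S.G (n + 1) x t ^ 2 ≤
    2 * (S.F1 n x t ^ 2 + S.F2 n x t ^ 2) / S.rr (n + 1) ^ 2 := by
  rw [← mul_pow, G_mul, div_pow]
  refine div_le_div_of_nonneg_right ?_ (by positivity)
  nlinarith [sq_nonneg (S.F1 n x t + S.F2 n x t)]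

section meas
variable (μ : Measure ℝ) [IsProbabilityMeasure μ]
  (ho : ∀ n m : ℕ, ∫ x, S.p n x * S.p m x ∂μ = if n = m then 1 else 0)

lemma int_sq (ho : ∀ n m : ℕ, ∫ x, S.p n x * S.p m x ∂μ = if n = m then 1 else 0) (n : ℕ) :
    Integrable (fun x => S.p n x * S.p n x) μ := by
  by_contra hc
  have := ho n n
  rw [integral_undef hc] at this
  simp at this

lemma int_mul (ho : ∀ n m : ℕ, ∫ x, S.p n x * S.p m x ∂μ = if n = m then 1 else 0) (n m : ℕ) :
    Integrable (fun x => S.p n x * S.p m x) μ := by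
  refine ((S.int_sq μ ho n).add (S.int_sq μ ho m)).mono'
    ((S.c_p n).mul (S.c_p m)).aestronglyMeasurable (Eventually.of_forall fun x => ?_)
  rw [Real.norm_eq_abs, abs_mul]
  simp only [Pi.add_apply]
  rw [← abs_mul_abs_self (S.p n x), ← abs_mul_abs_self (S.p m x)]
  nlinarith [mul_self_nonneg (|S.p n x| - |S.p m x|), abs_nonneg (S.p n x), abs_nonneg (S.p m x)]

lemma int_p (ho : ∀ n m : ℕ, ∫ x, S.p n x * S.p m x ∂μ = if n = m then 1 else 0) (n : ℕ) :
    Integrable (S.p n) μ ∧ ∫ x, S.p n x ∂μ = if n = 0 then 1 else 0 := by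
  have h0 : ∀ x, S.p 0 x = 1 := fun x => rfl
  have h1 := S.int_mul μ ho n 0
  have h2 := ho n 0
  simp only [h0, mul_one] at h1 h2
  exact ⟨h1, h2⟩

lemma sq_int (ho : ∀ n m : ℕ, ∫ x, S.p n x * S.p m x ∂μ = if n = m then 1 else 0)
    (m : ℕ) (c : ℕ → ℝ → ℝ) (hc : ∀ i, Continuous (c i)) (q : ℕ → ℕ) (hq : Function.Injective q)
    (h : ℝ → ℝ) (hh : Continuous h) (hs : HasCompactSupport h) :
    Integrable (fun t => ∫ x, h x * (∑ i ∈ Finset.range m, c i x * S.p (q i) t) ^ 2) μ ∧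
    ∫ t, (∫ x, h x * (∑ i ∈ Finset.range m, c i x * S.p (q i) t) ^ 2) ∂μ =
      ∫ x, h x * ∑ i ∈ Finset.range m, c i x ^ 2 := by
  have hcint : ∀ i j, Integrable (fun x => h x * (c i x * c j x)) := fun i j =>
    (hh.mul ((hc i).mul (hc j))).integrable_of_hasCompactSupport hs.mul_right
  have e : ∀ t, ∫ x, h x * (∑ i ∈ Finset.range m, c i x * S.p (q i) t) ^ 2 =
      ∑ i ∈ Finset.range m, ∑ j ∈ Finset.range m, (∫ x, h x * (c i x * c j x)) *
        (S.p (q i) t * S.p (q j) t) := by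
    intro t
    have e1 : ∀ x, h x * (∑ i ∈ Finset.range m, c i x * S.p (q i) t) ^ 2 =
        ∑ i ∈ Finset.range m, ∑ j ∈ Finset.range m, h x * (c i x * c j x) *
        (S.p (q i) t * S.p (q j) t) := by
      intro x
      rw [pow_two, Finset.sum_mul_sum, Finset.mul_sum]
      refine Finset.sum_congr rfl fun i _ => ?_
      rw [Finset.mul_sum]
      exact Finset.sum_congr rfl fun j _ => by ring
    simp only [e1]
    rw [integral_finsetSum _ fun i _ => integrable_finsetSum _ fun j _ => (hcint i j).mul_const _]
    refine Finset.sum_congr rfl fun i _ => ?_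
    rw [integral_finsetSum _ fun j _ => (hcint i j).mul_const _]
    refine Finset.sum_congr rfl fun j _ => ?_
    rw [integral_mul_const]
  simp only [e]
  have hcint2 : ∀ i j, Integrable (fun t => (∫ x, h x * (c i x * c j x)) *
        (S.p (q i) t * S.p (q j) t)) μ := fun i j => (S.int_mul μ ho _ _).const_mul _
  refine ⟨integrable_finsetSum _ fun i _ => integrable_finsetSum _ fun j _ => hcint2 i j, ?_⟩
  rw [integral_finsetSum _ fun i _ => integrable_finsetSum _ fun j _ => hcint2 i j]
  simp only [Finset.mul_sum]
  rw [integral_finsetSum _ fun i _ => by simpa only [pow_two] using hcint i i]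
  refine Finset.sum_congr rfl fun i hi => ?_
  rw [integral_finsetSum _ fun j _ => hcint2 i j]
  simp only [integral_const_mul, ho, hq.eq_iff]
  simp only [mul_ite, mul_one, mul_zero, Finset.sum_ite_eq, hi, if_true, pow_two]

lemma g_int (ho : ∀ n m : ℕ, ∫ x, S.p n x * S.p m x ∂μ = if n = m then 1 else 0)
    (n : ℕ) (h : ℝ → ℝ) (hh : Continuous h) (hs : HasCompactSupport h) :
    Integrable (fun t => ∫ x, h x * S.G (n + 1) x t) μ ∧
    ∫ t, (∫ x, h x * S.G (n + 1) x t) ∂μ = (1 - S.rr 1 / S.rr (n + 1)) * ∫ x, h x := by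
  have hcint : ∀ j, Integrable (fun x => h x * S.p j x) := fun j =>
    (hh.mul (S.c_p j)).integrable_of_hasCompactSupport hs.mul_right
  have e : ∀ t, ∫ x, h x * S.G (n + 1) x t = ∑ j ∈ Finset.range (n + 1),
      ((1 - S.rr (j + 1) / S.rr (n + 1)) * ∫ x, h x * S.p j x) * S.p j t := by
    intro t
    have e1 : ∀ x, h x * S.G (n + 1) x t = ∑ j ∈ Finset.range (n + 1),
      ((1 - S.rr (j + 1) / S.rr (n + 1)) * (h x * S.p j x)) * S.p j t := by
      intro x
      rw [G_exp, Finset.mul_sum]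
      exact Finset.sum_congr rfl fun j _ => by ring
    simp only [e1]
    rw [integral_finsetSum _ fun j _ => ((hcint j).const_mul _).mul_const _]
    refine Finset.sum_congr rfl fun j _ => ?_
    rw [integral_mul_const, integral_const_mul]
  simp only [e]
  have hcint2 : ∀ j, Integrable (fun t => ((1 - S.rr (j + 1) / S.rr (n + 1)) * ∫ x, h x * S.p j x) * S.p j t) μ :=
    fun j => (S.int_p μ ho j).1.const_mul _
  refine ⟨integrable_finsetSum _ fun j _ => hcint2 j, ?_⟩
  rw [integral_finsetSum _ fun j _ => hcint2 j]
  simp only [integral_const_mul, (S.int_p μ ho _).2]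
  simp only [mul_ite, mul_one, mul_zero, Finset.sum_ite_eq', Finset.mem_range]
  rw [if_pos (by omega)]
  have h0 : ∀ x, S.p 0 x = 1 := fun x => rfl
  simp only [h0, mul_one, zero_add]

end meas

end Setup

lemma cauchy_int {ℓ : ℝ} (hℓ : 0 < ℓ) (t : ℝ) : Integrable (fun x => ((x - t) ^ 2 + ℓ ^ 2)⁻¹) ∧
    ∫ x, ((x - t) ^ 2 + ℓ ^ 2)⁻¹ = π / ℓ := by
  have e : ∀ x, ((x - t) ^ 2 + ℓ ^ 2)⁻¹ = (ℓ ^ 2)⁻¹ * (1 + ((x - t) / ℓ) ^ 2)⁻¹ := by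
    intro x
    rw [← mul_inv]
    congr 1
    field_simp
    ring
  simp only [e]
  have h1 : Integrable (fun x : ℝ => (1 + (x / ℓ) ^ 2)⁻¹) :=
    integrable_inv_one_add_sq.comp_div hℓ.ne'
  refine ⟨(h1.comp_sub_right t).const_mul _, ?_⟩
  rw [integral_const_mul, integral_sub_right_eq_self (fun x : ℝ => (1 + (x / ℓ) ^ 2)⁻¹),
    Measure.integral_comp_div (fun x : ℝ => (1 + x ^ 2)⁻¹), integral_univ_inv_one_add_sq, abs_of_pos hℓ,
    smul_eq_mul]
  field_simp

namespace Setup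
variable (S : Setup)

lemma c_F1 (n : ℕ) (t : ℝ) : Continuous (fun x => S.F1 n x t) := by
  unfold F1
  exact continuous_finsetSum _ fun i _ => (continuous_const.mul (S.c_p _)).mul continuous_const
lemma c_F2 (n : ℕ) (t : ℝ) : Continuous (fun x => S.F2 n x t) := by
  unfold F2
  exact continuous_finsetSum _ fun i _ => (continuous_const.mul (S.c_p _)).mul continuous_const

lemma c_G1 (n : ℕ) (t : ℝ) : Continuous (fun x => S.G n x t) :=
  (S.c_G n).comp (continuous_id.prodMk continuous_const)

lemma G_pt (n : ℕ) {ℓ lam : ℝ} (hℓ : 0 < ℓ) (hlam : 0 < lam) (x t : ℝ) (hx : ℓ ≤ |x - t|) :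
    |S.G (n + 1) x t| ≤ lam / S.rr (n + 1) ^ 2 * (S.F1 n x t ^ 2 + S.F2 n x t ^ 2) +
      lam⁻¹ * ((x - t) ^ 2 + ℓ ^ 2)⁻¹ := by
  have hR := S.rr_pos n
  have h := S.G_sq n x t
  set g := S.G (n + 1) x t
  set F := S.F1 n x t ^ 2 + S.F2 n x t ^ 2
  have hD : ℓ ^ 2 ≤ (x - t) ^ 2 := by
    rw [← sq_abs (x - t)]; exact pow_le_pow_left₀ hℓ.le hx 2
  set D := (x - t) ^ 2
  have hD0 : 0 < D := lt_of_lt_of_le (by positivity) hD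
  have e1 : 2 * |g| ≤ lam * (D * g ^ 2) + lam⁻¹ * D⁻¹ := by
    have h2 : 0 ≤ (lam * D * |g| - 1) ^ 2 * (lam⁻¹ * D⁻¹) := by positivity
    have h3 : (lam * D * |g| - 1) ^ 2 * (lam⁻¹ * D⁻¹) =
        lam * (D * |g| ^ 2) + lam⁻¹ * D⁻¹ - 2 * |g| := by field_simp; ring
    rw [h3, sq_abs] at h2
    linarith
  have e2 : D⁻¹ ≤ 2 * (D + ℓ ^ 2)⁻¹ := by
    rw [← div_eq_mul_inv, inv_eq_one_div, div_le_div_iff₀ hD0 (by positivity)]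
    linarith
  have e3 : lam * (D * g ^ 2) ≤ lam * (2 * F / S.rr (n + 1) ^ 2) :=
    mul_le_mul_of_nonneg_left h hlam.le
  have e4 : lam⁻¹ * D⁻¹ ≤ lam⁻¹ * (2 * (D + ℓ ^ 2)⁻¹) :=
    mul_le_mul_of_nonneg_left e2 (inv_pos.2 hlam).le
  have e5 : lam * (2 * F / S.rr (n + 1) ^ 2) = 2 * (lam / S.rr (n + 1) ^ 2 * F) := by ring
  linarith

lemma tail_pt (n : ℕ) {ℓ lam : ℝ} (hℓ : 0 < ℓ) (hlam : 0 < lam) (t : ℝ)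
    (f : ℝ → ℝ) (hf : Continuous f) (hs : HasCompactSupport f) (Bf : ℝ) (hB : ∀ x, |f x| ≤ Bf) :
    |(∫ x, f x * S.G (n + 1) x t) - ∫ x in (t - ℓ)..(t + ℓ), f x * S.G (n + 1) x t| ≤
      lam / S.rr (n + 1) ^ 2 * ((∫ x, |f x| * S.F1 n x t ^ 2) + ∫ x, |f x| * S.F2 n x t ^ 2) +
      lam⁻¹ * Bf * (π / ℓ) := by
  have i0 : Integrable (fun x => f x * S.G (n + 1) x t) :=
    (hf.mul (S.c_G1 _ t)).integrable_of_hasCompactSupport hs.mul_right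
  have hsa : HasCompactSupport (fun x => |f x|) := hs.comp_left (g := fun y : ℝ => |y|) abs_zero
  have i1 : Integrable (fun x => |f x| * S.F1 n x t ^ 2) :=
    (hf.abs.mul ((S.c_F1 n t).pow 2)).integrable_of_hasCompactSupport hsa.mul_right
  have i2 : Integrable (fun x => |f x| * S.F2 n x t ^ 2) :=
    (hf.abs.mul ((S.c_F2 n t).pow 2)).integrable_of_hasCompactSupport hsa.mul_right
  obtain ⟨i3, e3⟩ := cauchy_int hℓ t
  have hBf : 0 ≤ Bf := (abs_nonneg _).trans (hB 0)
  rw [intervalIntegral.integral_of_le (by linarith), ← integral_add_compl (μ := volume)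
    (s := Set.Ioc (t - ℓ) (t + ℓ)) measurableSet_Ioc i0, add_sub_cancel_left]
  set Φ : ℝ → ℝ := fun x => lam / S.rr (n + 1) ^ 2 * (|f x| * S.F1 n x t ^ 2 + |f x| * S.F2 n x t ^ 2)
    + lam⁻¹ * Bf * ((x - t) ^ 2 + ℓ ^ 2)⁻¹ with hΦ
  have hR := S.rr_pos n
  have iΦ : Integrable Φ := ((i1.add i2).const_mul _).add (i3.const_mul _)
  have eΦ : ∫ x, Φ x = lam / S.rr (n + 1) ^ 2 * ((∫ x, |f x| * S.F1 n x t ^ 2) +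
      ∫ x, |f x| * S.F2 n x t ^ 2) + lam⁻¹ * Bf * (π / ℓ) := by
    have i12 : Integrable (fun x => |f x| * S.F1 n x t ^ 2 + |f x| * S.F2 n x t ^ 2) := i1.add i2
    simp only [hΦ]
    rw [integral_add (i12.const_mul _) (i3.const_mul _), integral_const_mul,
      integral_const_mul, integral_add i1 i2, e3]
  have Φ0 : ∀ x, 0 ≤ Φ x := fun x => by simp only [hΦ]; positivity
  rw [← eΦ]
  refine le_trans ?_ (setIntegral_le_integral (s := (Set.Ioc (t - ℓ) (t + ℓ))ᶜ) iΦ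
    (Eventually.of_forall Φ0))
  rw [← Real.norm_eq_abs]
  refine norm_integral_le_of_norm_le iΦ.integrableOn ?_
  refine (ae_restrict_iff' measurableSet_Ioc.compl).2 (Eventually.of_forall fun x hx => ?_)
  have hx' : ℓ ≤ |x - t| := by
    by_contra hc
    have := abs_lt.1 (not_le.1 hc)
    exact hx ⟨by linarith, by linarith⟩
  have h := S.G_pt n hℓ hlam x t hx'
  rw [Real.norm_eq_abs, abs_mul]
  calc |f x| * |S.G (n + 1) x t| ≤ |f x| * (lam / S.rr (n + 1) ^ 2 * (S.F1 n x t ^ 2 + S.F2 n x t ^ 2) +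
      lam⁻¹ * ((x - t) ^ 2 + ℓ ^ 2)⁻¹) := mul_le_mul_of_nonneg_left h (abs_nonneg _)
    _ = lam / S.rr (n + 1) ^ 2 * (|f x| * S.F1 n x t ^ 2 + |f x| * S.F2 n x t ^ 2)
        + lam⁻¹ * |f x| * ((x - t) ^ 2 + ℓ ^ 2)⁻¹ := by ring
    _ ≤ Φ x := by
      simp only [hΦ]
      have := hB x
      gcongr

section meas
variable (μ : Measure ℝ) [IsProbabilityMeasure μ]

lemma c_main (n : ℕ) (ℓ : ℝ) (f : ℝ → ℝ) (hf : Continuous f) :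
    Continuous (fun t => ∫ x in (t - ℓ)..(t + ℓ), f x * S.G (n + 1) x t) := by
  have : ∀ t, ∫ x in (t - ℓ)..(t + ℓ), f x * S.G (n + 1) x t =
      ∫ u in (-ℓ)..ℓ, f (u + t) * S.G (n + 1) (u + t) t := by
    intro t
    rw [intervalIntegral.integral_comp_add_right (fun x => f x * S.G (n + 1) x t)]
    congr 1 <;> ring
  simp only [this]
  refine intervalIntegral.continuous_parametric_intervalIntegral_of_continuous' ?_ _ _
  have h := (S.c_G (n+1)).comp (f := fun z : ℝ × ℝ => (z.2 + z.1, z.1)) (by fun_prop)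
  exact (hf.comp (continuous_snd.add continuous_fst)).mul h

lemma tail_mu (ho : ∀ n m : ℕ, ∫ x, S.p n x * S.p m x ∂μ = if n = m then 1 else 0)
    (f : ℝ → ℝ) (hf : Continuous f) (hs : HasCompactSupport f) :
    ∃ K : ℝ, ∀ n, ∀ L : ℝ, 0 < L →
      |(1 - S.rr 1 / S.rr (n + 1)) * (∫ x, f x) -
        ∫ t, (∫ x in (t - L / S.rr (n + 1))..(t + L / S.rr (n + 1)), f x * S.G (n + 1) x t) ∂μ|
        ≤ K / √L := by
  obtain ⟨Bf, hB⟩ := hs.exists_bound_of_continuous hf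
  simp only [Real.norm_eq_abs] at hB
  obtain ⟨Rd, hRd⟩ := hs.isBounded.subset_closedBall 0
  obtain ⟨C, hC, hK⟩ := S.KK_bound Rd
  obtain ⟨Γ, hΓ, hg⟩ := S.gam_bound
  have hsa : HasCompactSupport (fun x => |f x|) := hs.comp_left (g := fun y : ℝ => |y|) abs_zero
  have ia : Integrable (fun x => |f x|) := hf.abs.integrable_of_hasCompactSupport hsa
  refine ⟨2 * Γ * C * (∫ x, |f x|) + Bf * π, fun n L hL => ?_⟩
  have hR := S.rr_pos n
  set R := S.rr (n + 1) with hRdef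
  have hsL : 0 < √L := Real.sqrt_pos.2 hL
  have hℓ : 0 < L / R := div_pos hL hR
  have hlam : 0 < R / √L := div_pos hR hsL
  have T := fun t => S.tail_pt n hℓ hlam t f hf hs Bf hB
  obtain ⟨gi, ge⟩ := S.g_int μ ho n f hf hs
  obtain ⟨s1, s1e⟩ := S.sq_int μ ho n (fun i x => S.gam i * S.p (i + 1) x)
    (fun i => continuous_const.mul (S.c_p _)) id Function.injective_id _ hf.abs hsa
  obtain ⟨s2, s2e⟩ := S.sq_int μ ho n (fun i x => S.gam i * S.p i x)
    (fun i => continuous_const.mul (S.c_p _)) (fun i => i + 1) (fun i j h => by simpa using h) _ hf.abs hsa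
  change Integrable (fun t => ∫ x, |f x| * S.F1 n x t ^ 2) μ at s1
  change Integrable (fun t => ∫ x, |f x| * S.F2 n x t ^ 2) μ at s2
  change ∫ t, (∫ x, |f x| * S.F1 n x t ^ 2) ∂μ = _ at s1e
  change ∫ t, (∫ x, |f x| * S.F2 n x t ^ 2) ∂μ = _ at s2e
  have hKx : ∀ x, |f x| * S.KK (n+1) x x ≤ |f x| * (C * R) := by
    intro x
    by_cases hx : f x = 0
    · simp [hx]
    · have : |x| ≤ Rd := by
        have := hRd (subset_tsupport f hx)
        simpa using this
      exact mul_le_mul_of_nonneg_left ((le_abs_self _).trans (hK _ x this x this)) (abs_nonneg _)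
  have hb1 : ∀ x, |f x| * ∑ i ∈ Finset.range n, (S.gam i * S.p (i + 1) x) ^ 2 ≤ |f x| * (Γ * (C * R)) := by
    intro x
    have h1 : ∑ i ∈ Finset.range n, (S.gam i * S.p (i + 1) x) ^ 2 ≤ Γ * S.KK (n+1) x x := by
      rw [KK, Finset.sum_range_succ', mul_add, Finset.mul_sum]
      refine le_add_of_le_of_nonneg (Finset.sum_le_sum fun i _ => ?_) (mul_nonneg hΓ.le (mul_self_nonneg _))
      rw [mul_pow, ← pow_two]
      exact mul_le_mul_of_nonneg_right (hg i) (sq_nonneg _)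
    have h2 := mul_le_mul_of_nonneg_left h1 (abs_nonneg (f x))
    have h3 := mul_le_mul_of_nonneg_left (hKx x) hΓ.le
    linarith
  have hb2 : ∀ x, |f x| * ∑ i ∈ Finset.range n, (S.gam i * S.p i x) ^ 2 ≤ |f x| * (Γ * (C * R)) := by
    intro x
    have h1 : ∑ i ∈ Finset.range n, (S.gam i * S.p i x) ^ 2 ≤ Γ * S.KK (n+1) x x := by
      rw [KK, Finset.sum_range_succ, mul_add, Finset.mul_sum]
      refine le_add_of_le_of_nonneg (Finset.sum_le_sum fun i _ => ?_) (mul_nonneg hΓ.le (mul_self_nonneg _))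
      rw [mul_pow, ← pow_two]
      exact mul_le_mul_of_nonneg_right (hg i) (sq_nonneg _)
    have h2 := mul_le_mul_of_nonneg_left h1 (abs_nonneg (f x))
    have h3 := mul_le_mul_of_nonneg_left (hKx x) hΓ.le
    linarith
  have I1 : ∫ t, (∫ x, |f x| * S.F1 n x t ^ 2) ∂μ ≤ (∫ x, |f x|) * (Γ * (C * R)) := by
    rw [s1e, ← integral_mul_const]
    refine integral_mono ?_ (ia.mul_const _) hb1
    refine (hf.abs.mul (continuous_finsetSum _ fun i _ => (continuous_const.mul (S.c_p _)).pow 2)).integrable_of_hasCompactSupport hsa.mul_right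
  have I2 : ∫ t, (∫ x, |f x| * S.F2 n x t ^ 2) ∂μ ≤ (∫ x, |f x|) * (Γ * (C * R)) := by
    rw [s2e, ← integral_mul_const]
    refine integral_mono ?_ (ia.mul_const _) hb2
    refine (hf.abs.mul (continuous_finsetSum _ fun i _ => (continuous_const.mul (S.c_p _)).pow 2)).integrable_of_hasCompactSupport hsa.mul_right
  have hcm := S.c_main n (L / R) f hf
  have iU : Integrable (fun t => R / √L / R ^ 2 * ((∫ x, |f x| * S.F1 n x t ^ 2) +
      ∫ x, |f x| * S.F2 n x t ^ 2) + (R / √L)⁻¹ * Bf * (π / (L / R))) μ :=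
    ((s1.add s2).const_mul _).add (integrable_const _)
  have idiff : Integrable (fun t => (∫ x, f x * S.G (n + 1) x t) -
      ∫ x in (t - L / R)..(t + L / R), f x * S.G (n + 1) x t) μ :=
    iU.mono' (gi.aestronglyMeasurable.sub hcm.aestronglyMeasurable) (Eventually.of_forall T)
  have iM : Integrable (fun t => ∫ x in (t - L / R)..(t + L / R), f x * S.G (n + 1) x t) μ := by
    refine (gi.sub idiff).congr (Eventually.of_forall fun t => ?_)
    simp
  rw [← ge, ← integral_sub gi iM, ← Real.norm_eq_abs]
  refine (norm_integral_le_of_norm_le iU (Eventually.of_forall T)).trans ?_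
  have s12 : Integrable (fun t => (∫ x, |f x| * S.F1 n x t ^ 2) + ∫ x, |f x| * S.F2 n x t ^ 2) μ :=
    s1.add s2
  rw [integral_add (s12.const_mul _) (integrable_const _), integral_const_mul,
    integral_add s1 s2, integral_const]
  simp only [probReal_univ, one_smul]
  have hsq : √L * √L = L := Real.mul_self_sqrt hL.le
  calc _ ≤ R / √L / R ^ 2 * ((∫ x, |f x|) * (Γ * (C * R)) + (∫ x, |f x|) * (Γ * (C * R))) +
        (R / √L)⁻¹ * Bf * (π / (L / R)) := by gcongr
    _ = _ := by
      clear_value R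
      generalize √L = s at hsL hsq ⊢
      rw [← hsq]
      field_simp
      ring

end meas
end Setup

namespace Setup
variable (S : Setup)

lemma main_cv (n : ℕ) (L t : ℝ) (f : ℝ → ℝ) :
    ∫ x in (t - L / S.rr (n + 1))..(t + L / S.rr (n + 1)), f x * S.G (n + 1) x t =
    ∫ u in (-L)..L, f (t + u / S.rr (n + 1)) *
      (S.G (n + 1) (t + u / S.rr (n + 1)) t / S.rr (n + 1)) := by
  have hR := S.rr_pos n
  have h := intervalIntegral.integral_comp_add_div (a := -L) (b := L)
    (fun x => f x * S.G (n + 1) x t) hR.ne' t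
  have e : ∀ u, f (t + u / S.rr (n + 1)) * (S.G (n + 1) (t + u / S.rr (n + 1)) t / S.rr (n + 1)) =
    (f (t + u / S.rr (n + 1)) * S.G (n + 1) (t + u / S.rr (n + 1)) t) / S.rr (n + 1) := fun u => by ring
  simp only [e]
  rw [intervalIntegral.integral_div, h, smul_eq_mul, mul_div_cancel_left₀ _ hR.ne', neg_div,
    ← sub_eq_add_neg]

section meas
variable (μ : Measure ℝ) [IsProbabilityMeasure μ]

lemma main_lim {κ : ℝ → ℝ} {τ : ℝ} (hτ : τ ≠ 0) 
    (H : ∀ (ι : Type) (l : Filter ι) (m : ι → ℕ) (x1 x2 : ι → ℝ) (x ξ : ℝ), Tendsto m l atTop →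
      Tendsto x1 l (𝓝 x) → Tendsto x2 l (𝓝 x) →
      Tendsto (fun i => (x1 i - x2 i) * S.rr (m i)) l (𝓝 ξ) →
      Tendsto (fun i => S.KK (m i) (x1 i) (x2 i) / S.rr (m i)) l
        (𝓝 (κ x * Real.sinc (τ * ξ))))
    (f : ℝ → ℝ) (hf : Continuous f) (hs : HasCompactSupport f) (L : ℝ) (hL : 0 < L) :
    Tendsto (fun n => ∫ t, (∫ x in (t - L / S.rr (n + 1))..(t + L / S.rr (n + 1)),
      f x * S.G (n + 1) x t) ∂μ) atTop
      (𝓝 ((∫ u in (-L)..L, fejer (τ * u)) * ∫ t, f t * κ t ∂μ)) := by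
  obtain ⟨Bf, hB⟩ := hs.exists_bound_of_continuous hf
  simp only [Real.norm_eq_abs] at hB
  have hBf : 0 ≤ Bf := (abs_nonneg _).trans (hB 0)
  obtain ⟨Rd, hRd⟩ := hs.isBounded.subset_closedBall 0
  obtain ⟨C, hC, hG⟩ := S.G_bound (|Rd| + L)
  have hrt : Tendsto (fun n => S.rr (n + 1)) atTop atTop := S.rr_tendsto.comp (tendsto_add_atTop_nat 1)
  have bd : ∀ᶠ n in atTop, ∀ t u : ℝ, |u| ≤ L → |f (t + u / S.rr (n + 1)) *
      (S.G (n + 1) (t + u / S.rr (n + 1)) t / S.rr (n + 1))| ≤ Bf * C := by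
    filter_upwards [hrt.eventually_ge_atTop 1] with n hn t u hu
    by_cases hx : f (t + u / S.rr (n + 1)) = 0
    · rw [hx, zero_mul, abs_zero]; positivity
    have h1 : |t + u / S.rr (n + 1)| ≤ Rd := by
      have := hRd (subset_tsupport f hx)
      simpa using this
    have h2 : |u / S.rr (n + 1)| ≤ L := by
      rw [abs_div, abs_of_pos (S.rr_pos n)]
      exact (div_le_self (abs_nonneg _) hn).trans hu
    have h3 : |t| ≤ |Rd| + L := by
      have := abs_sub (t + u / S.rr (n + 1)) (u / S.rr (n + 1))
      rw [add_sub_cancel_right] at this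
      have := le_abs_self Rd
      linarith
    have h4 : |t + u / S.rr (n + 1)| ≤ |Rd| + L := by
      have := le_abs_self Rd
      linarith
    have := hG (n + 1) _ h4 _ h3
    rw [abs_mul, abs_div, abs_of_pos (S.rr_pos n)]
    refine mul_le_mul (hB _) ?_ (by have := S.rr_pos n; positivity) hBf
    rw [div_le_iff₀ (S.rr_pos n)]
    exact this
  rw [← integral_const_mul]
  refine tendsto_integral_filter_of_dominated_convergence (fun _ => Bf * C * |L - -L|) ?_ ?_
    (integrable_const _) ?_
  · exact Eventually.of_forall fun n => (S.c_main n _ f hf).aestronglyMeasurable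
  · filter_upwards [bd] with n hn
    refine Eventually.of_forall fun t => ?_
    rw [main_cv]
    refine intervalIntegral.norm_integral_le_of_norm_le_const fun u hu => ?_
    rw [Set.uIoc_of_le (by linarith)] at hu
    exact hn t u (abs_le.2 ⟨hu.1.le, hu.2⟩)
  · refine Eventually.of_forall fun t => ?_
    simp only [main_cv]
    have e : (∫ u in (-L)..L, fejer (τ * u)) * (f t * κ t) =
        ∫ u in (-L)..L, f t * (κ t * fejer (τ * u)) := by
      rw [mul_comm, ← intervalIntegral.integral_const_mul]
      simp only [mul_assoc]
    rw [e]
    refine intervalIntegral.tendsto_integral_filter_of_dominated_convergence (fun _ => Bf * C)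
      ?_ ?_ (by simp) ?_
    · refine Eventually.of_forall fun n => Continuous.aestronglyMeasurable ?_
      have := S.c_G1 (n+1) t
      have h1 : Continuous fun u => t + u / S.rr (n + 1) := by fun_prop
      exact (hf.comp h1).mul ((this.comp h1).div_const _)
    · filter_upwards [bd] with n hn
      refine Eventually.of_forall fun u hu => ?_
      rw [Set.uIoc_of_le (by linarith)] at hu
      exact hn t u (abs_le.2 ⟨hu.1.le, hu.2⟩)
    · have h0 : ∀ᵐ u : ℝ, u ≠ 0 := Measure.ae_ne volume 0
      filter_upwards [h0] with u hu _
      have h1 : Tendsto (fun n => t + u / S.rr (n + 1)) atTop (𝓝 t) := by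
        simpa using tendsto_const_nhds.add (hrt.const_div_atTop u)
      have h2 := (S.G_lim hτ H t u hu).comp (tendsto_add_atTop_nat 1)
      exact ((hf.tendsto t).comp h1).mul h2

lemma weak_id (ho : ∀ n m : ℕ, ∫ x, S.p n x * S.p m x ∂μ = if n = m then 1 else 0)
    {κ : ℝ → ℝ} {τ : ℝ} (hτ : 0 < τ) 
    (H : ∀ (ι : Type) (l : Filter ι) (m : ι → ℕ) (x1 x2 : ι → ℝ) (x ξ : ℝ), Tendsto m l atTop →
      Tendsto x1 l (𝓝 x) → Tendsto x2 l (𝓝 x) →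
      Tendsto (fun i => (x1 i - x2 i) * S.rr (m i)) l (𝓝 ξ) →
      Tendsto (fun i => S.KK (m i) (x1 i) (x2 i) / S.rr (m i)) l
        (𝓝 (κ x * Real.sinc (τ * ξ))))
    (f : ℝ → ℝ) (hf : Continuous f) (hs : HasCompactSupport f) :
    ∫ x, f x = π / τ * ∫ t, f t * κ t ∂μ := by
  obtain ⟨K, hK⟩ := S.tail_mu μ ho f hf hs
  have hrt : Tendsto (fun n => S.rr (n + 1)) atTop atTop := S.rr_tendsto.comp (tendsto_add_atTop_nat 1)
  have key : ∀ L : ℝ, 0 < L → |(∫ x, f x) - (∫ u in (-L)..L, fejer (τ * u)) * ∫ t, f t * κ t ∂μ| ≤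
      K / √L := by
    intro L hL
    have h1 := S.main_lim μ hτ.ne' H f hf hs L hL
    have h2 : Tendsto (fun n => (1 - S.rr 1 / S.rr (n + 1)) * (∫ x, f x)) atTop (𝓝 (∫ x, f x)) := by
      have := (tendsto_const_nhds (x := (1:ℝ))).sub (hrt.const_div_atTop (S.rr 1))
      simpa using this.mul_const (∫ x, f x)
    exact le_of_tendsto (h2.sub h1).abs (Eventually.of_forall fun n => hK n L hL)
  have l1 : Tendsto (fun L : ℝ => |(∫ x, f x) - (∫ u in (-L)..L, fejer (τ * u)) * ∫ t, f t * κ t ∂μ|)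
      atTop (𝓝 |(∫ x, f x) - π / τ * ∫ t, f t * κ t ∂μ|) :=
    (tendsto_const_nhds.sub ((fejer_scaled hτ).mul_const _)).abs
  have l2 : Tendsto (fun L : ℝ => K / √L) atTop (𝓝 0) :=
    Real.tendsto_sqrt_atTop.const_div_atTop K
  have := le_of_tendsto_of_tendsto l1 l2 ((eventually_gt_atTop 0).mono key)
  exact sub_eq_zero.1 (abs_eq_zero.1 (le_antisymm this (abs_nonneg _)))

end meas
end Setup


lemma Setup.final (S : Setup) (μ : Measure ℝ) [IsProbabilityMeasure μ]
    (ho : ∀ n m : ℕ, ∫ x, S.p n x * S.p m x ∂μ = if n = m then 1 else 0) :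
    ∃ w : ℝ → ℝ, Continuous w ∧ (∀ x, 0 < w x) ∧
      μ = volume.withDensity (fun x => ENNReal.ofReal (w x)) ∧
      TendstoLocallyUniformly
        (fun (n : ℕ) (q : ℝ × ℝ × ℝ) =>
          (S.rr (n + 1))⁻¹ * S.KK (n + 1) (q.1 + q.2.1 / S.rr (n + 1)) (q.1 + q.2.2 / S.rr (n + 1)))
        (fun q => (tauC S.α S.β S.N / (π * w q.1)) *
          (if q.2.1 = q.2.2 then 1
            else Real.sin ((q.2.1 - q.2.2) * tauC S.α S.β S.N) /
              ((q.2.1 - q.2.2) * tauC S.α S.β S.N))) atTop := by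
  obtain ⟨κ, hκc, hτ, hκ, H⟩ := S.kernel
  set τ := tauC S.α S.β S.N
  have hwc : Continuous fun x => τ / (π * κ x) :=
    continuous_const.div (continuous_const.mul hκc) fun x => (mul_pos pi_pos (hκ x)).ne'
  have hw : ∀ x, 0 < τ / (π * κ x) := fun x => div_pos hτ (mul_pos pi_pos (hκ x))
  refine ⟨fun x => τ / (π * κ x), hwc, hw, ?_, ?_⟩
  · have : IsLocallyFiniteMeasure (volume.withDensity (fun x => ENNReal.ofReal (τ / (π * κ x)))) :=
      IsLocallyFiniteMeasure.withDensity_ofReal hwc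
    refine Measure.ext_of_integral_eq_on_compactlySupported fun f => ?_
    rw [integral_withDensity_eq_integral_toReal_smul (by fun_prop) (by simp)]
    simp only [ENNReal.toReal_ofReal (hw _).le, smul_eq_mul]
    have h := S.weak_id μ ho hτ H (fun x => τ / (π * κ x) * f x) (hwc.mul f.continuous)
      f.hasCompactSupport.mul_left
    rw [h, ← integral_const_mul]
    congr 1
    ext t
    have := hκ t
    have := pi_pos
    field_simp
  · have e : (fun q : ℝ × ℝ × ℝ => (τ / (π * (τ / (π * κ q.1)))) *
          (if q.2.1 = q.2.2 then 1
            else Real.sin ((q.2.1 - q.2.2) * τ) / ((q.2.1 - q.2.2) * τ))) =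
        fun q => κ q.1 * Real.sinc (τ * (q.2.1 - q.2.2)) := by
      ext q
      have h1 : τ / (π * (τ / (π * κ q.1))) = κ q.1 := by
        have := hκ q.1
        have := pi_pos
        field_simp
      rw [h1]
      congr 1
      split_ifs with h
      · simp [h]
      · rw [Real.sinc_of_ne_zero (mul_ne_zero hτ.ne' (sub_ne_zero.2 h)), mul_comm]
    beta_reduce
    rw [e]
    have hc : Continuous (fun q : ℝ × ℝ × ℝ => κ q.1 * Real.sinc (τ * (q.2.1 - q.2.2))) := by
      have := continuous_sinc
      fun_prop
    rw [tendstoLocallyUniformly_iff_forall_tendsto]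
    intro q
    have hr : Tendsto (fun z : ℕ × (ℝ × ℝ × ℝ) => S.rr (z.1 + 1)) (atTop ×ˢ 𝓝 q) atTop :=
      (S.rr_tendsto.comp (tendsto_add_atTop_nat 1)).comp tendsto_fst
    have hs : Tendsto (fun z : ℕ × (ℝ × ℝ × ℝ) => z.2) (atTop ×ˢ 𝓝 q) (𝓝 q) := tendsto_snd
    have t1 : Tendsto (fun z : ℕ × (ℝ × ℝ × ℝ) => z.2.1) (atTop ×ˢ 𝓝 q) (𝓝 q.1) :=
      (continuous_fst.tendsto q).comp hs
    have t2 : Tendsto (fun z : ℕ × (ℝ × ℝ × ℝ) => z.2.2.1) (atTop ×ˢ 𝓝 q) (𝓝 q.2.1) :=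
      ((continuous_fst.comp continuous_snd).tendsto q).comp hs
    have t3 : Tendsto (fun z : ℕ × (ℝ × ℝ × ℝ) => z.2.2.2) (atTop ×ˢ 𝓝 q) (𝓝 q.2.2) :=
      ((continuous_snd.comp continuous_snd).tendsto q).comp hs
    have h1 := H (ℕ × (ℝ × ℝ × ℝ)) (atTop ×ˢ 𝓝 q) (fun z => z.1 + 1)
      (fun z => z.2.1 + z.2.2.1 / S.rr (z.1 + 1)) (fun z => z.2.1 + z.2.2.2 / S.rr (z.1 + 1))
      q.1 (q.2.1 - q.2.2) ((tendsto_add_atTop_nat 1).comp tendsto_fst)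
      (by simpa using t1.add (t2.div_atTop hr)) (by simpa using t1.add (t3.div_atTop hr)) (by
        refine (t2.sub t3).congr fun z => ?_
        have := S.rr_pos z.1
        field_simp
        ring)
    have h2 : Tendsto (fun z : ℕ × (ℝ × ℝ × ℝ) => κ z.2.1 * Real.sinc (τ * (z.2.2.1 - z.2.2.2)))
      (atTop ×ˢ 𝓝 q) (𝓝 (κ q.1 * Real.sinc (τ * (q.2.1 - q.2.2)))) := (hc.tendsto q).comp hs
    simp only [div_eq_inv_mul _ (S.rr _)] at h1 ⊢
    exact (h2.prodMk_nhds h1).mono_right (nhds_le_uniformity _)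

/-- Theorem 1 of the paper. Universality scaling limit of the
Christoffel–Darboux kernel for `N`-periodically modulated Jacobi parameters in the `𝒟_1`
setting, locally uniformly in `(x, u, v) ∈ ℝ³`. -/
theorem CD_kernel_scaling_limit_modulated_D1
    (N : ℕ) (hN : 0 < N)
    (a b : ℕ → ℝ) (ha : ∀ n, 0 < a n)
    (α β : ℤ → ℝ) (hα : ∀ n, 0 < α n)
    (hαper : ∀ n : ℤ, α (n + N) = α n) (hβper : ∀ n : ℤ, β (n + N) = β n)
    (hmod_a : Tendsto a atTop atTop)
    (hmod_r : Tendsto (fun n : ℕ =>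
      |a n / a (n + 1) - α (n : ℤ) / α ((n : ℤ) + 1)|) atTop (𝓝 0))
    (hmod_b : Tendsto (fun n : ℕ =>
      |b n / a n - β (n : ℤ) / α (n : ℤ)|) atTop (𝓝 0))
    (hD1 : ∀ i < N, memD1 (fun k => a ((k + 1) * N + i - 1) / a ((k + 1) * N + i)))
    (hD2 : ∀ i < N, memD1 (fun k => b ((k + 1) * N + i) / a ((k + 1) * N + i)))
    (hD3 : ∀ i < N, memD1 (fun k => 1 / a ((k + 1) * N + i)))
    (hCarleman : Tendsto (fun n : ℕ => ∑ k ∈ Finset.range n, 1 / a k) atTop atTop)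
    (htr : |Matrix.trace (frakX0 α β N 0)| < 2)
    (μ : Measure ℝ) (hμ : IsProbabilityMeasure μ)
    (horth : ∀ n m : ℕ, ∫ x, opoly a b n x * opoly a b m x ∂μ = if n = m then 1 else 0) :
    ∃ w : ℝ → ℝ, Continuous w ∧ (∀ x, 0 < w x) ∧
      μ = volume.withDensity (fun x => ENNReal.ofReal (w x)) ∧
      TendstoLocallyUniformly
        (fun (n : ℕ) (q : ℝ × ℝ × ℝ) =>
          (rho a α n)⁻¹ * ∑ j ∈ Finset.range (n + 1),
            opoly a b j (q.1 + q.2.1 / rho a α n) * opoly a b j (q.1 + q.2.2 / rho a α n))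
        (fun q => (tauC α β N / (π * w q.1)) *
          (if q.2.1 = q.2.2 then 1
            else Real.sin ((q.2.1 - q.2.2) * tauC α β N) /
              ((q.2.1 - q.2.2) * tauC α β N))) atTop := by
  let S : Setup := ⟨N, hN, a, b, ha, α, β, hα, hαper, hβper, hmod_a, hmod_r, hmod_b, hD1, hD2, hD3,
    hCarleman, htr⟩
  have := hμ
  exact S.final μ horth
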